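/- arXiv:2401.14605 — 3 statements merged into one kernel-verified Lean document; each statement's English description precedes it below -/
import Mathlib

section
/- Let X and Y be standard Borel spaces and let E and F be aperiodic, countable Borel equivalence relations on X and Y respectively. Let n, k > 1 be integers. If E is Borel embeddable into F and the strong Borel Ramsey property F →_B (F)^n_k holds, then the strong Borel Ramsey property E →_B (E)^n_k holds. -/
open Classical

noncomputable section

/-- `Y` is a complete section for `E`: it meets every `E`-class. -/
def IsCompleteSection {X : Type*} (E : X → X → Prop) (Y : Set X) : Prop :=
  ∀ x : X, ∃ y ∈ Y, E x y

/-- `Y` is an infinite complete section for `E`: it meets every `E`-class in an infinite set. -/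
def IsInfiniteCompleteSection {X : Type*} (E : X → X → Prop) (Y : Set X) : Prop :=
  ∀ x : X, {y | y ∈ Y ∧ E x y}.Infinite

/-- A coloring `c` of the `n`-element subsets of single `E`-classes (encoded as a function on
finsets) is `E`-monochromatic on `Y`: for every `x` there is a color `a` such that every
`n`-element subset of `Y` contained in `[x]_E` gets color `a`. -/
def IsMonochromatic {X : Type*} (E : X → X → Prop) (n : ℕ) {k : ℕ}
    (c : Finset X → Fin k) (Y : Set X) : Prop :=
  ∀ x : X, ∃ a : Fin k, ∀ A : Finset X, A.card = n → ↑A ⊆ Y → (∀ y ∈ A, E x y) → c A = a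

/-- `c` is a Borel coloring of dimension `n`: the induced map on `n`-tuples is measurable. -/
def IsBorelColoring {X : Type*} [MeasurableSpace X] (n : ℕ) {k : ℕ}
    (c : Finset X → Fin k) : Prop :=
  Measurable fun v : Fin n → X => c (Set.finite_range v).toFinset

/-- The strong Borel Ramsey property `E →_B (E)^n_k`: every Borel `E`-coloring of dimension
`n` by `k` colors admits a Borel `E`-monochromatic infinite complete section. -/
def StrongBorelRamsey {X : Type*} [MeasurableSpace X] (E : X → X → Prop) (n k : ℕ) : Prop :=
  ∀ c : Finset X → Fin k, IsBorelColoring n c →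
    ∃ Y : Set X, MeasurableSet Y ∧ IsInfiniteCompleteSection E Y ∧ IsMonochromatic E n c Y

/-- The weak Borel Ramsey property `E →*_B (E)^n_k`: every Borel `E`-coloring of dimension
`n` by `k` colors admits a Borel `E`-monochromatic complete section. -/
def WeakBorelRamsey {X : Type*} [MeasurableSpace X] (E : X → X → Prop) (n k : ℕ) : Prop :=
  ∀ c : Finset X → Fin k, IsBorelColoring n c →
    ∃ Y : Set X, MeasurableSet Y ∧ IsCompleteSection E Y ∧ IsMonochromatic E n c Y

/-- `E` is smooth: Borel reducible to equality on a standard Borel space. -/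
def IsSmooth {X : Type*} [MeasurableSpace X] (E : X → X → Prop) : Prop :=
  ∃ (Z : Type) (mZ : MeasurableSpace Z), @StandardBorelSpace Z mZ ∧
    ∃ f : X → Z, @Measurable X Z _ mZ f ∧ ∀ x y : X, E x y ↔ f x = f y

/-- The eventual agreement relation `E₀` on Cantor space `2^ℕ`. -/
def E0 (x y : ℕ → Bool) : Prop := ∃ n : ℕ, ∀ m ≥ n, x m = y m

/-- `Σ_{i<δ(x,y)} x i + Σ_{i<δ(x,y)} y i`, where `δ(x,y)` is the least `n` with
`x m = y m` for all `m ≥ n`; junk value `0` if `x` and `y` are not `E₀`-related. -/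
def colorSum (x y : ℕ → Bool) : ℕ :=
  if h : ∃ n : ℕ, ∀ m ≥ n, x m = y m then
    ((Finset.range (Nat.find h)).sum fun i => (x i).toNat) +
    ((Finset.range (Nat.find h)).sum fun i => (y i).toNat)
  else 0

/-- The coloring `c` of the paper: a pair `{x,y}` of distinct `E₀`-related points gets color
`0` (representing color `1`) if `colorSum x y` is even, and color `1` (representing color `2`)
otherwise. -/
def c0 : Finset (ℕ → Bool) → Fin 2 := fun A =>
  if ∃ x y : ℕ → Bool, x ≠ y ∧ A = {x, y} ∧ E0 x y ∧ Even (colorSum x y) then 0 else 1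

/-- The subrelation `F` of `E₀`: `x F y` iff `x = y` or `c ({x,y}) = 1` (even `colorSum`). -/
def F0 (x y : ℕ → Bool) : Prop := x = y ∨ (E0 x y ∧ Even (colorSum x y))

/-- The map flipping coordinate `0`. -/
def flip0 (x : ℕ → Bool) : ℕ → Bool := fun n => if n = 0 then !(x 0) else x n

/-- Eventual agreement of `X`-valued sequences: the relation `E₀(X)` on `X^ℕ`
(denoted `E₁` when `X` is uncountable). -/
def E1rel {X : Type*} (u v : ℕ → X) : Prop := ∃ N : ℕ, ∀ j ≥ N, u j = v j

/-- `S` is a monochromatic reduction to `E₁` for the coloring `c` of dimension `n`: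
each `S x` is injective, its range is a monochromatic subset of `[x]_E`, and
`x E y ↔ S x E₁ S y`. -/
def IsMonochromaticReduction {X : Type*} (E : X → X → Prop) (n : ℕ) {k : ℕ}
    (c : Finset X → Fin k) (S : X → ℕ → X) : Prop :=
  (∀ x : X, Function.Injective (S x)) ∧
  (∀ x : X, (∀ i : ℕ, E x (S x i)) ∧
    ∃ a : Fin k, ∀ A : Finset X, A.card = n → ↑A ⊆ Set.range (S x) → c A = a) ∧
  (∀ x y : X, E x y ↔ E1rel (S x) (S y))

/-- `c` is an almost transitive coloring of dimension `n` for `E`: for every `m ≥ n`, every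
`A ∈ [X]^m_E` and all `(n-1)`-element subsets `B₁, B₂ ⊆ A`, one has
`c ({z} ∪ B₁) = c ({z} ∪ B₂)` for all but finitely many `z` in the `E`-saturation of `A`
outside `B₁ ∪ B₂`. -/
def AlmostTransitive {X : Type*} (E : X → X → Prop) (n : ℕ) {k : ℕ}
    (c : Finset X → Fin k) : Prop :=
  ∀ m : ℕ, n ≤ m → ∀ A : Finset X, A.card = m → (∀ x ∈ A, ∀ y ∈ A, E x y) →
    ∀ B₁ B₂ : Finset X, B₁ ⊆ A → B₂ ⊆ A → B₁.card = n - 1 → B₂.card = n - 1 →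
      {z : X | (∃ a ∈ A, E a z) ∧ z ∉ B₁ ∪ B₂ ∧ c (insert z B₁) ≠ c (insert z B₂)}.Finite

section Helpers

open MeasureTheory Set Filter Topology

/-- Countable unions of Borel sets on which `g` is injective. -/
def LNSmall {P X : Type*} [MeasurableSpace P] (g : P → X) (C : Set P) : Prop :=
  ∃ S : Set (Set P), S.Countable ∧ (∀ B ∈ S, MeasurableSet B ∧ InjOn g B) ∧ C = ⋃₀ S

lemma LNSmall.measurableSet {P X : Type*} [MeasurableSpace P] {g : P → X} {C : Set P}
    (h : LNSmall g C) : MeasurableSet C := by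
  obtain ⟨S, hS, h1, rfl⟩ := h
  exact MeasurableSet.sUnion hS fun B hB => (h1 B hB).1

lemma LNSmall.iUnion {P X ι : Type*} [Countable ι] [MeasurableSpace P] {g : P → X}
    {C : ι → Set P} (h : ∀ i, LNSmall g (C i)) : LNSmall g (⋃ i, C i) := by
  choose S hS h1 h2 using h
  refine ⟨⋃ i, S i, countable_iUnion hS, ?_, ?_⟩
  · intro B hB
    obtain ⟨i, hi⟩ := mem_iUnion.1 hB
    exact h1 i B hi
  · rw [sUnion_iUnion]
    exact iUnion_congr h2

lemma LNSmall.of_injOn {P X : Type*} [MeasurableSpace P] {g : P → X}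
    {B : Set P} (hB : MeasurableSet B) (h : InjOn g B) : LNSmall g B :=
  ⟨{B}, countable_singleton _, by simp [hB, h], by simp⟩

lemma LNSmall.union {P X : Type*} [MeasurableSpace P] {g : P → X}
    {B C : Set P} (hB : LNSmall g B) (hC : LNSmall g C) : LNSmall g (B ∪ C) := by
  rw [union_eq_iUnion]
  exact LNSmall.iUnion (by rintro (_ | _) <;> simpa)

/-- Neighbourhood of an analytic set in the graph same fibre, distinct is analytic. -/
lemma ln_nbhd_analytic {P X : Type*} [TopologicalSpace P] [PolishSpace P] [MeasurableSpace P]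
    [BorelSpace P] [TopologicalSpace X] [T2Space X] {g : P → X} (hg : Continuous g)
    {A : Set P} (hA : AnalyticSet A) :
    AnalyticSet {q | ∃ p ∈ A, g p = g q ∧ p ≠ q} := by
  have hR : MeasurableSet {z : P × P | g z.1 = g z.2 ∧ z.1 ≠ z.2} := by
    refine (isClosed_eq (by fun_prop) (by fun_prop)).measurableSet.inter ?_
    exact (isClosed_eq continuous_fst continuous_snd).measurableSet.compl
  have h1 : AnalyticSet ((Prod.fst : P × P → P) ⁻¹' A) := hA.preimage continuous_fst
  have h2 : AnalyticSet (((Prod.fst : P × P → P) ⁻¹' A) ∩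
      {z : P × P | g z.1 = g z.2 ∧ z.1 ≠ z.2}) := by
    rw [inter_eq_iInter]
    refine AnalyticSet.iInter ?_
    rintro (_ | _)
    · exact hR.analyticSet
    · exact h1
  convert h2.image_of_continuous continuous_snd using 1
  ext q
  constructor
  · rintro ⟨p, hp, h⟩
    exact ⟨(p, q), ⟨hp, h⟩, rfl⟩
  · rintro ⟨⟨p, q'⟩, ⟨hp, h⟩, rfl⟩
    exact ⟨p, hp, h⟩

lemma ln_reflect {P X : Type*} [TopologicalSpace P] [PolishSpace P] [MeasurableSpace P]
    [BorelSpace P] [TopologicalSpace X] [T2Space X] {g : P → X} (hg : Continuous g)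
    {A : Set P} (hA : AnalyticSet A) (hinj : InjOn g A) :
    ∃ B, A ⊆ B ∧ MeasurableSet B ∧ InjOn g B := by
  obtain ⟨B0, hAB0, hd0, hB0⟩ := hA.measurablySeparable (ln_nbhd_analytic hg hA) (by
    rw [Set.disjoint_left]
    rintro q hq ⟨p, hp, h, hne⟩
    exact hne (hinj hp hq h))
  obtain ⟨B1, hAB1, hd1, hB1⟩ := hA.measurablySeparable (ln_nbhd_analytic hg hB0.analyticSet) (by
    rw [Set.disjoint_left]
    rintro q hq ⟨p, hp, h, hne⟩
    exact Set.disjoint_left.1 hd0 ⟨q, hq, h.symm, hne.symm⟩ hp)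
  refine ⟨B0 ∩ B1, subset_inter hAB0 hAB1, hB0.inter hB1, ?_⟩
  intro p hp q hq h
  by_contra hne
  exact Set.disjoint_left.1 hd1 ⟨p, hp.1, h, hne⟩ hq.2

/-- Configurations: sequences whose first `m+1` terms lie in one fibre, in `U`, outside `C`. -/
def LNConf {P X : Type*} (g : P → X) (m : ℕ) (U : ℕ → Set P) (C : Set P) : Set (ℕ → P) :=
  {γ | ∀ i ≤ m, γ i ∈ U i ∧ γ i ∉ C ∧ g (γ i) = g (γ 0)}

lemma ln_conf_meas {P X : Type*} [TopologicalSpace P] [PolishSpace P] [MeasurableSpace P]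
    [BorelSpace P] [TopologicalSpace X] [T2Space X] {g : P → X} (hg : Continuous g)
    (m : ℕ) {U : ℕ → Set P} (hU : ∀ i, IsClosed (U i)) {C : Set P} (hC : MeasurableSet C) :
    MeasurableSet (LNConf g m U C) := by
  have : LNConf g m U C = ⋂ i, ⋂ (_ : i ≤ m), ((fun γ : ℕ → P => γ i) ⁻¹' (U i)) ∩
      (((fun γ : ℕ → P => γ i) ⁻¹' Cᶜ) ∩ {γ | g (γ i) = g (γ 0)}) := by
    ext γ; simp [LNConf]
  rw [this]
  refine MeasurableSet.iInter fun i => MeasurableSet.iInter fun _ => ?_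
  refine ((hU i).measurableSet.preimage (measurable_pi_apply i)).inter
    ((hC.compl.preimage (measurable_pi_apply i)).inter ?_)
  exact (isClosed_eq (by fun_prop) (by fun_prop)).measurableSet

def LNBig {P X : Type*} [MeasurableSpace P] (g : P → X) (m : ℕ) (U : ℕ → Set P) : Prop :=
  ∀ C, LNSmall g C → (LNConf g m U C).Nonempty

lemma ln_step {P X : Type*} [MetricSpace P] [SecondCountableTopology P] [CompleteSpace P]
    [MeasurableSpace P]
    [BorelSpace P] [TopologicalSpace X] [T2Space X] {g : P → X} (hg : Continuous g)
    (m j : ℕ) (hj : j ≤ m) {U : ℕ → Set P} (hU : ∀ i, IsClosed (U i)) (hB : LNBig g m U)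
    (ε : ℝ) (hε : 0 < ε) :
    ∃ V : ℕ → Set P, (∀ i, IsClosed (V i)) ∧ LNBig g (m+1) V ∧
      (∀ i, ∀ x ∈ V i, ∀ y ∈ V i, dist x y ≤ ε) ∧ (∀ i ≤ m, V i ⊆ U i) ∧ V (m+1) ⊆ U j ∧
      Disjoint (V j) (V (m+1)) := by
  by_contra hcon
  have hne : Nonempty P := by
    obtain ⟨γ, _⟩ := hB ∅ ⟨∅, by simp⟩
    exact ⟨γ 0⟩
  let D := TopologicalSpace.denseSeq P
  have hD : DenseRange D := TopologicalSpace.denseRange_denseSeq P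
  let I := {e : (ℕ →₀ ℕ) × ℕ // 2 * (1 / ((e.2 : ℝ) + 1)) ≤ ε ∧
      2 * (1 / ((e.2 : ℝ) + 1)) < dist (D (e.1 j)) (D (e.1 (m+1)))}
  let V : I → ℕ → Set P := fun e i => (if i ≤ m then U i else U j) ∩
    Metric.closedBall (D (e.1.1 i)) (1 / ((e.1.2 : ℝ) + 1))
  have hsm : ∀ e : I, ∃ C, LNSmall g C ∧ ¬ (LNConf g (m+1) (V e) C).Nonempty := by
    intro e
    by_contra hc
    push Not at hc
    apply hcon
    refine ⟨V e, ?_, hc, ?_, ?_, ?_, ?_⟩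
    · intro i
      refine IsClosed.inter ?_ Metric.isClosed_closedBall
      split_ifs
      exacts [hU _, hU _]
    · intro i x hx y hy
      have h1 := Metric.mem_closedBall.1 hx.2
      have h2 := Metric.mem_closedBall.1 hy.2
      have h3 := dist_triangle_right x y (D (e.1.1 i))
      have := e.2.1
      linarith
    · intro i hi x hx
      have := hx.1
      rwa [if_pos hi] at this
    · intro x hx
      have := hx.1
      rwa [if_neg (by omega)] at this
    · rw [Set.disjoint_left]
      intro x hx hy
      have h1 := Metric.mem_closedBall.1 hx.2
      have h2 := Metric.mem_closedBall.1 hy.2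
      have h3 := dist_triangle_left (D (e.1.1 j)) (D (e.1.1 (m+1))) x
      have := e.2.2
      linarith
  choose C hC hCe using hsm
  have hCs : LNSmall g (⋃ e, C e) := LNSmall.iUnion hC
  set C0 := ⋃ e, C e with hC0
  -- key fact
  have key : ∀ γ ∈ LNConf g m U C0, ∀ q ∈ U j, q ∉ C0 → g q = g (γ 0) → γ j = q := by
    intro γ hγ q hq hqC hgq
    by_contra hne'
    have hdist : 0 < dist (γ j) q := dist_pos.2 hne'
    obtain ⟨N, hN⟩ := exists_nat_one_div_lt (lt_min (half_pos hε) (div_pos hdist four_pos))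
    have hN1 := lt_of_lt_of_le hN (min_le_left _ _)
    have hN2 := lt_of_lt_of_le hN (min_le_right _ _)
    let γ' : ℕ → P := fun i => if i ≤ m then γ i else q
    have hap : ∀ i, ∃ k, dist (γ' i) (D k) < 1 / ((N : ℝ) + 1) := fun i =>
      hD.exists_dist_lt _ (by positivity)
    choose k hk using hap
    let e1 : ℕ →₀ ℕ := Finsupp.onFinset (Finset.range (m+2))
      (fun i => if i < m + 2 then k i else 0) (by intro i; simp; tauto)
    have he1 : ∀ i ≤ m + 1, e1 i = k i := by
      intro i hi
      simp [e1]; omega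
    have hj1 := hk j
    have hm1 := hk (m+1)
    simp only [γ', if_pos hj] at hj1
    simp only [γ', if_neg (show ¬ (m + 1 ≤ m) by omega)] at hm1
    let e : I := ⟨(e1, N), by linarith, by
      simp only [he1 j (by omega), he1 (m+1) le_rfl]
      have h1 := dist_triangle4 (γ j) (D (k j)) (D (k (m+1))) q
      rw [dist_comm q] at hm1
      linarith⟩
    apply hCe e
    refine ⟨γ', ?_⟩
    have hC' : ∀ x, x ∉ C0 → x ∉ C e := fun x hx hx' => hx (mem_iUnion.2 ⟨e, hx'⟩)
    intro i hi
    have hb : γ' i ∈ Metric.closedBall (D (e.1.1 i)) (1 / ((e.1.2 : ℝ) + 1)) := by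
      simp only [e, he1 i hi]
      exact (hk i).le
    by_cases him : i ≤ m
    · have h := hγ i him
      refine ⟨⟨?_, hb⟩, ?_, ?_⟩
      · simp only [γ', if_pos him]; exact h.1
      · simp only [γ', if_pos him]; exact hC' _ h.2.1
      · simp only [γ', if_pos him, if_pos (Nat.zero_le m)]; exact h.2.2
    · refine ⟨⟨?_, hb⟩, ?_, ?_⟩
      · simp only [γ', if_neg him]; exact hq
      · simp only [γ', if_neg him]; exact hC' _ hqC
      · simp only [γ', if_neg him, if_pos (Nat.zero_le m)]; exact hgq
  have hA : AnalyticSet ((fun γ : ℕ → P => γ j) '' LNConf g m U C0) :=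
    (ln_conf_meas hg m hU hCs.measurableSet).analyticSet.image_of_continuous (continuous_apply j)
  obtain ⟨B, hAB, hBm, hBi⟩ := ln_reflect hg hA (by
    rintro _ ⟨γ, hγ, rfl⟩ _ ⟨γ', hγ', rfl⟩ h
    have h' := hγ' j hj
    exact key γ hγ (γ' j) h'.1 h'.2.1 (h.symm.trans (hγ j hj).2.2))
  obtain ⟨γ, hγ⟩ := hB (C0 ∪ B) (hCs.union (LNSmall.of_injOn hBm hBi))
  refine (hγ j hj).2.1 (Or.inr (hAB ⟨γ, ?_, rfl⟩))
  intro i hi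
  exact ⟨(hγ i hi).1, fun h => (hγ i hi).2.1 (Or.inl h), (hγ i hi).2.2⟩

lemma ln_cont {P X : Type*} [MetricSpace P] [SecondCountableTopology P] [CompleteSpace P]
    [MeasurableSpace P]
    [BorelSpace P] [TopologicalSpace X] [T2Space X] {g : P → X} (hg : Continuous g)
    (hcount : ∀ x, (g ⁻¹' {x}).Countable) : LNSmall g univ := by
  by_contra hns
  have h0 : LNBig g 0 (fun _ => univ) := by
    intro C hC
    have : C ≠ univ := by rintro rfl; exact hns hC
    obtain ⟨p, hp⟩ := (ne_univ_iff_exists_notMem C).1 this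
    refine ⟨fun _ => p, ?_⟩
    intro i hi
    exact ⟨trivial, hp, rfl⟩
  let T : ℕ → Type _ := fun m => {U : ℕ → Set P // (∀ i, IsClosed (U i)) ∧ LNBig g m U}
  have hst : ∀ m (U : T m), ∃ V : T (m+1),
      (∀ i, ∀ x ∈ V.1 i, ∀ y ∈ V.1 i, dist x y ≤ 1 / ((m : ℝ) + 1)) ∧
      (∀ i ≤ m, V.1 i ⊆ U.1 i) ∧ V.1 (m+1) ⊆ U.1 (Nat.unpair m).1 ∧
      Disjoint (V.1 (Nat.unpair m).1) (V.1 (m+1)) := by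
    intro m U
    obtain ⟨V, h1, h2, h3⟩ := ln_step hg m (Nat.unpair m).1 (Nat.unpair_left_le m) U.2.1 U.2.2
      (1 / ((m : ℝ) + 1)) (by positivity)
    exact ⟨⟨V, h1, h2⟩, h3⟩
  choose nxt hnxt using hst
  let W : ∀ m, T m := fun m => Nat.rec (motive := T) ⟨fun _ => univ, fun _ => isClosed_univ, h0⟩
    (fun m U => nxt m U) m
  have hW : ∀ m, W (m+1) = nxt m (W m) := fun m => rfl
  let U : ℕ → ℕ → Set P := fun m => (W m).1
  have hUc : ∀ m i, IsClosed (U m i) := fun m => (W m).2.1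
  have hUd : ∀ m i, ∀ x ∈ U (m+1) i, ∀ y ∈ U (m+1) i, dist x y ≤ 1 / ((m : ℝ) + 1) := fun m =>
    (hnxt m (W m)).1
  have hUs : ∀ m, ∀ i ≤ m, U (m+1) i ⊆ U m i := fun m => (hnxt m (W m)).2.1
  have hUj : ∀ m, U (m+1) (m+1) ⊆ U m (Nat.unpair m).1 := fun m => (hnxt m (W m)).2.2.1
  have hUdj : ∀ m, Disjoint (U (m+1) (Nat.unpair m).1) (U (m+1) (m+1)) := fun m =>
    (hnxt m (W m)).2.2.2
  have hUm : ∀ i m m', i ≤ m → m ≤ m' → U m' i ⊆ U m i := by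
    intro i m m' him hmm
    induction m', hmm using Nat.le_induction with
    | base => exact le_rfl
    | succ n hn ih => exact (hUs n i (him.trans hn)).trans ih
  have hγ : ∀ m, (LNConf g m (U m) ∅).Nonempty := fun m => (W m).2.2 ∅ ⟨∅, by simp⟩
  choose γ hγ using hγ
  have hmem : ∀ i m m', i ≤ m → m ≤ m' → γ m' i ∈ U m i := fun i m m' h h' =>
    hUm i m m' h h' (hγ m' i (h.trans h')).1
  have hlim : ∀ i, ∃ p, Tendsto (fun m => γ m i) atTop (𝓝 p) := by
    intro i
    apply cauchySeq_tendsto_of_complete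
    rw [Metric.cauchySeq_iff']
    intro ε hε
    obtain ⟨N, hN⟩ := exists_nat_one_div_lt hε
    refine ⟨N + i + 1, fun n hn => ?_⟩
    have h1 := hUd (N+i) i _ (hmem i (N+i+1) n (by omega) hn) _
      (hmem i (N+i+1) (N+i+1) (by omega) le_rfl)
    refine h1.trans_lt (lt_of_le_of_lt ?_ hN)
    apply one_div_le_one_div_of_le (by positivity)
    push_cast; linarith [(Nat.cast_nonneg i : (0:ℝ) ≤ i)]
  choose p hp using hlim
  have hpm : ∀ i m, i ≤ m → p i ∈ U m i := by
    intro i m him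
    refine (hUc m i).mem_of_tendsto (hp i) ?_
    filter_upwards [eventually_ge_atTop m] with m' hm'
    exact hmem i m m' him hm'
  have hfib : ∀ i, g (p i) = g (p 0) := by
    intro i
    refine tendsto_nhds_unique ((hg.tendsto _).comp (hp i))
      (((hg.tendsto _).comp (hp 0)).congr' ?_)
    filter_upwards [eventually_ge_atTop i] with m hm
    exact ((hγ m i hm).2.2).symm
  have hpre : Preperfect (range p) := by
    rw [preperfect_iff_nhds]
    rintro _ ⟨j, rfl⟩ N hN
    obtain ⟨ε, hε, hball⟩ := Metric.mem_nhds_iff.1 hN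
    obtain ⟨b, hb⟩ := exists_nat_one_div_lt hε
    let m := Nat.pair j (b + j + 1)
    have hmb : b + j + 1 ≤ m := Nat.right_le_pair _ _
    have hmj : (Nat.unpair m).1 = j := by simp [m]
    refine ⟨p (m+1), ⟨hball ?_, mem_range_self _⟩, ?_⟩
    · obtain ⟨m', hm'⟩ : ∃ m', m = m' + 1 := ⟨m - 1, by omega⟩
      have h1 : p (m+1) ∈ U m j := by
        have := hUj m (hpm (m+1) (m+1) le_rfl)
        rwa [hmj] at this
      have h2 : p j ∈ U m j := hpm j m (by omega)
      rw [hm'] at h1 h2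
      have h3 := hUd m' j _ h1 _ h2
      rw [← hm'] at h3
      refine Metric.mem_ball.2 (h3.trans_lt (lt_of_le_of_lt ?_ hb))
      apply one_div_le_one_div_of_le (by positivity)
      have : b ≤ m' := by omega
      have : (b : ℝ) ≤ m' := by exact_mod_cast this
      linarith
    · intro heq
      have h1 := hUdj m
      rw [hmj] at h1
      exact Set.disjoint_left.1 h1 (hpm j (m+1) (by omega)) (heq ▸ hpm (m+1) (m+1) le_rfl)
  obtain ⟨h, hr, -, hinj⟩ := hpre.perfect_closure.exists_nat_bool_injection
    ((range_nonempty p).closure)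
  have hsub : closure (range p) ⊆ g ⁻¹' {g (p 0)} := by
    refine closure_minimal ?_ (isClosed_singleton.preimage hg)
    rintro _ ⟨i, rfl⟩
    exact hfib i
  have hc : (range h).Countable := (hcount (g (p 0))).mono (hr.trans hsub)
  have : Countable (ℕ → Bool) := by
    have := hc.to_subtype
    exact (Equiv.ofInjective h hinj).injective.countable
  obtain ⟨d, hd⟩ := exists_surjective_nat (ℕ → Bool)
  obtain ⟨i, hi⟩ := hd (fun n => !(d n n))
  have := congrFun hi i
  simp at this

/-- Lusin–Novikov, countable-to-one form. -/
theorem ln_main {P X : Type*} [MeasurableSpace P] [StandardBorelSpace P] [MeasurableSpace X]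
    [StandardBorelSpace X] {g : P → X} (hg : Measurable g)
    (hcount : ∀ x, (g ⁻¹' {x}).Countable) :
    ∃ B : ℕ → Set P, (∀ n, MeasurableSet (B n)) ∧ (∀ n, InjOn g (B n)) ∧ (⋃ n, B n) = univ := by
  have hS : LNSmall g univ := by
    let := upgradeStandardBorel X
    let := upgradeStandardBorel P
    have hP0 : PolishSpace P := inferInstance
    obtain ⟨t', ht, hc, hp⟩ := hg.exists_continuous
    have hb : @BorelSpace P t' _ := by
      refine @BorelSpace.mk P t' _ ?_
      rw [MeasureTheory.borel_eq_borel_of_le hp hP0 ht]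
      exact BorelSpace.measurable_eq
    let : TopologicalSpace P := t'
    let := TopologicalSpace.upgradeIsCompletelyMetrizable P
    exact ln_cont hc hcount
  obtain ⟨S, hS, h1, h2⟩ := hS
  rcases S.eq_empty_or_nonempty with rfl | hne
  · refine ⟨fun _ => ∅, by simp, by simp, ?_⟩
    rw [h2]; simp
  · obtain ⟨B, rfl⟩ := hS.exists_eq_range hne
    refine ⟨B, fun n => (h1 _ ⟨n, rfl⟩).1, fun n => (h1 _ ⟨n, rfl⟩).2, ?_⟩
    rw [h2, sUnion_range]

/-- A countable Borel equivalence relation is enumerated by countably many Borel functions. -/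
theorem ln_enum {X : Type*} [MeasurableSpace X] [StandardBorelSpace X]
    (E : X → X → Prop) (hE : Equivalence E)
    (hEBorel : MeasurableSet {p : X × X | E p.1 p.2})
    (hEcount : ∀ x : X, {y | E x y}.Countable) :
    ∃ φ : ℕ → X → X, (∀ i, Measurable (φ i)) ∧ ∀ x y, E x y ↔ ∃ i, φ i x = y := by
  classical
  let R : Set (X × X) := {p : X × X | E p.1 p.2}
  have : StandardBorelSpace R := hEBorel.standardBorel
  let g : R → X := fun p => p.1.1
  let s : R → X := fun p => p.1.2
  have hg : Measurable g := measurable_fst.comp measurable_subtype_coe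
  have hs : Measurable s := measurable_snd.comp measurable_subtype_coe
  obtain ⟨B, hB, hBi, hBu⟩ := ln_main hg (by
    intro x
    have : MapsTo s (g ⁻¹' {x}) {y | E x y} := by
      rintro ⟨⟨a, b⟩, hab⟩ rfl
      exact hab
    refine MapsTo.countable_of_injOn this ?_ (hEcount x)
    rintro ⟨⟨a, b⟩, hab⟩ rfl ⟨⟨a', b'⟩, hab'⟩ h h'
    simp only [g, s, mem_preimage, mem_singleton_iff] at h h'
    subst h; subst h'; rfl)
  let φ : ℕ → X → X := fun i x => if h : ∃ p ∈ B i, g p = x then s h.choose else x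
  have hφ : ∀ i, ∀ p ∈ B i, φ i (g p) = s p := by
    intro i p hp
    have h : ∃ q ∈ B i, g q = g p := ⟨p, hp, rfl⟩
    simp only [φ, dif_pos h]
    rw [hBi i h.choose_spec.1 hp h.choose_spec.2]
  have hφn : ∀ i x, x ∉ g '' B i → φ i x = x := by
    intro i x hx
    exact dif_neg (fun h => hx h)
  refine ⟨φ, ?_, ?_⟩
  · intro i S hS
    have : φ i ⁻¹' S = g '' (B i ∩ s ⁻¹' S) ∪ (S \ g '' B i) := by
      ext x
      by_cases hx : x ∈ g '' B i
      · obtain ⟨p, hp, rfl⟩ := hx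
        simp only [mem_preimage, hφ i p hp, mem_union, Set.mem_sdiff]
        constructor
        · intro h; exact Or.inl ⟨p, ⟨hp, h⟩, rfl⟩
        · rintro (⟨q, ⟨hq, hqs⟩, hqp⟩ | h)
          · rwa [← hBi i hq hp hqp]
          · exact absurd ⟨p, hp, rfl⟩ h.2
      · simp only [mem_preimage, hφn i x hx, mem_union, Set.mem_sdiff]
        constructor
        · intro h; exact Or.inr ⟨h, hx⟩
        · rintro (⟨q, ⟨hq, hqs⟩, rfl⟩ | h)
          · exact absurd ⟨q, hq, rfl⟩ hx
          · exact h.1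
    rw [this]
    refine MeasurableSet.union ?_ (hS.diff ?_)
    · exact ((hB i).inter (hs hS)).image_of_measurable_injOn hg ((hBi i).mono inter_subset_left)
    · exact (hB i).image_of_measurable_injOn hg (hBi i)
  · intro x y
    constructor
    · intro h
      have : (⟨(x, y), h⟩ : R) ∈ ⋃ n, B n := by rw [hBu]; trivial
      obtain ⟨i, hi⟩ := mem_iUnion.1 this
      exact ⟨i, hφ i _ hi⟩
    · rintro ⟨i, rfl⟩
      by_cases hx : x ∈ g '' B i
      · obtain ⟨p, hp, rfl⟩ := hx
        rw [hφ i p hp]; exact p.2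
      · rw [hφn i x hx]; exact hE.refl x

lemma ramsey_transfer {X : Type*} [MeasurableSpace X] [StandardBorelSpace X]
    {Y : Type*} [MeasurableSpace Y] 
    (E : X → X → Prop) (F : Y → Y → Prop) (hF : Equivalence F)
    (φ : ℕ → Y → Y) (hφ : ∀ i, Measurable (φ i)) (hφF : ∀ x y, F x y ↔ ∃ i, φ i x = y)
    (n k : ℕ) (f : X → Y) (hfmeas : Measurable f)
    (hfred : ∀ x₁ x₂ : X, E x₁ x₂ ↔ F (f x₁) (f x₂))
    (hRamsey : StrongBorelRamsey F n k) (c : Finset X → Fin k) (hc : IsBorelColoring n c)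
    (r : Y → X) (hr : Measurable r) (S : Set Y) (hS : MeasurableSet S)
    (hrS : ∀ y ∈ S, F (f (r y)) y) :
    ∃ Z : Set Y, IsInfiniteCompleteSection F Z ∧ MeasurableSet (r '' (Z ∩ S)) ∧
      IsMonochromatic E n c (r '' (Z ∩ S)) := by
  classical
  obtain ⟨Z, hZm, hZi, hZc⟩ := hRamsey (fun A => c (A.image r)) (by
    have h1 : Measurable fun v : Fin n → Y => (fun i => r (v i)) := by fun_prop
    have h2 := hc.comp h1
    unfold IsBorelColoring
    convert h2 using 2 with v
    simp only [Function.comp]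
    congr 1
    ext x
    simp)
  refine ⟨Z, hZi, ?_, ?_⟩
  · have : r '' (Z ∩ S) = ⋃ i, {x | φ i (f x) ∈ Z ∩ S ∧ r (φ i (f x)) = x} := by
      ext x
      simp only [mem_iUnion]
      constructor
      · rintro ⟨y, hy, rfl⟩
        obtain ⟨i, hi⟩ := (hφF _ _).1 (hrS y hy.2)
        refine ⟨i, ?_⟩
        simp only [mem_ofPred_eq, hi]
        exact ⟨hy, trivial⟩
      · rintro ⟨i, hi⟩
        exact ⟨_, hi.1, hi.2⟩
    rw [this]
    refine MeasurableSet.iUnion fun i => ?_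
    have h1 : Measurable fun x => φ i (f x) := (hφ i).comp hfmeas
    exact (h1 (hZm.inter hS)).inter (measurableSet_eq_fun (hr.comp h1) measurable_id)
  · intro x
    obtain ⟨a, ha⟩ := hZc (f x)
    refine ⟨a, fun A hA hAW hAE => ?_⟩
    have : ∀ w, ∃ y, w ∈ A → y ∈ Z ∩ S ∧ r y = w := by
      intro w
      by_cases hw : w ∈ A
      · obtain ⟨y, hy, h⟩ := hAW hw
        exact ⟨y, fun _ => ⟨hy, h⟩⟩
      · exact ⟨f x, fun h => absurd h hw⟩
    choose l hl using this
    have him : (A.image l).image r = A := by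
      ext w
      simp only [Finset.mem_image]
      constructor
      · rintro ⟨_, ⟨u, hu, rfl⟩, rfl⟩
        rwa [(hl u hu).2]
      · intro hw
        exact ⟨_, ⟨w, hw, rfl⟩, (hl w hw).2⟩
    have := ha (A.image l) ?_ ?_ ?_
    · simpa [him] using this
    · rw [Finset.card_image_of_injOn, hA]
      intro u hu v hv huv
      rw [← (hl u hu).2, ← (hl v hv).2, huv]
    · intro y hy
      obtain ⟨u, hu, rfl⟩ := Finset.mem_image.1 (Finset.mem_coe.1 hy)
      exact (hl u hu).1.1
    · intro y hy
      obtain ⟨u, hu, rfl⟩ := Finset.mem_image.1 hy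
      have h1 := hrS _ (hl u hu).1.2
      rw [(hl u hu).2] at h1
      exact hF.trans ((hfred _ _).1 (hAE u hu)) h1

/-- Measurable choice of the first index satisfying a Borel property. -/
lemma exists_measurable_first {A B : Type*} [MeasurableSpace A] [MeasurableSpace B]
    (h : ℕ → A → B) (hh : ∀ i, Measurable (h i)) (d : A → B) (hd : Measurable d)
    (p : ℕ → A → Prop) (hp : ∀ i, MeasurableSet {a | p i a}) :
    ∃ s : A → B, Measurable s ∧ ∀ a, (∃ i, p i a) → ∃ i, p i a ∧ s a = h i a := by
  classical
  obtain ⟨q, hq0, hqs⟩ : ∃ q : ℕ → A → Prop, (∀ a, q 0 a ↔ ¬ ∃ i, p i a) ∧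
      ∀ j a, q (j+1) a ↔ p j a :=
    ⟨fun i a => Nat.casesOn i (¬ ∃ i, p i a) (fun j => p j a), fun _ => Iff.rfl,
      fun _ _ => Iff.rfl⟩
  let h' : ℕ → A → B := fun i => Nat.casesOn i d (fun j => h j)
  have hex : ∀ a, ∃ i, q i a := by
    intro a
    by_cases ha : ∃ i, p i a
    · obtain ⟨i, hi⟩ := ha
      exact ⟨i+1, (hqs i a).2 hi⟩
    · exact ⟨0, (hq0 a).2 ha⟩
  have hq : ∀ i, MeasurableSet {a | q i a} := by
    rintro (_ | i)
    · have : {a | q 0 a} = (⋃ i, {a | p i a})ᶜ := by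
        ext a; simp [hq0]
      rw [this]
      exact (MeasurableSet.iUnion hp).compl
    · simp only [hqs]; exact hp i
  have hm : Measurable fun a => h' (Nat.find (hex a)) a := by
    refine Measurable.find ?_ hq hex
    rintro (_ | i)
    · exact hd
    · exact hh i
  refine ⟨_, hm, fun a ha => ?_⟩
  have hs := Nat.find_spec (hex a)
  revert hs
  generalize Nat.find (hex a) = N
  intro hs
  cases N with
  | zero => exact absurd ha ((hq0 a).1 hs)
  | succ j => exact ⟨j, (hqs j a).1 hs, rfl⟩

/-- An aperiodic enumerated relation is injectively enumerated by Borel functions. -/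
lemma exists_injective_enum {X : Type*} [MeasurableSpace X] [StandardBorelSpace X]
    (E : X → X → Prop) (hEaper : ∀ x : X, {y | E x y}.Infinite)
    (ψ : ℕ → X → X) (hψ : ∀ i, Measurable (ψ i)) (hψE : ∀ x y, E x y ↔ ∃ i, ψ i x = y) :
    ∃ θ : ℕ → X → X, (∀ i, Measurable (θ i)) ∧ (∀ i x, E x (θ i x)) ∧
      ∀ x, Function.Injective fun i => θ i x := by
  classical
  -- new index `i` is a first occurrence
  let p : X → ℕ → Prop := fun x j => ∀ l < j, ψ l x ≠ ψ j x
  have hpm : ∀ j, MeasurableSet {x | p x j} := by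
    intro j
    have : {x | p x j} = ⋂ l, ⋂ (_ : l < j), {x | ψ l x = ψ j x}ᶜ := by
      ext x; simp [p]
    rw [this]
    exact MeasurableSet.iInter fun l => MeasurableSet.iInter fun _ =>
      (measurableSet_eq_fun (hψ l) (hψ j)).compl
  have hcm : ∀ j, Measurable fun x => Nat.count (p x) j := by
    intro j
    induction j with
    | zero => simp
    | succ j ih =>
      simp only [Nat.count_succ]
      exact ih.add (Measurable.ite (hpm j) measurable_const measurable_const)
  have hinf : ∀ x, (Set.ofPred (p x)).Infinite := by
    intro x hfin
    apply hEaper x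
    refine (hfin.image fun j => ψ j x).subset ?_
    intro y hy
    have hex := (hψE x y).1 hy
    refine ⟨Nat.find hex, ?_, Nat.find_spec hex⟩
    intro l hl h
    exact Nat.find_min hex hl (h.trans (Nat.find_spec hex))
  have hth : ∀ i, ∃ s : X → X, Measurable s ∧ ∀ x, ∃ j, (p x j ∧ Nat.count (p x) j = i) ∧
      s x = ψ j x := by
    intro i
    obtain ⟨s, hs, h⟩ := exists_measurable_first ψ hψ id measurable_id
      (fun j x => p x j ∧ Nat.count (p x) j = i)
      (fun j => (hpm j).inter (hcm j (measurableSet_singleton i)))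
    exact ⟨s, hs, fun x => h x ⟨Nat.nth (p x) i, Nat.nth_mem_of_infinite (hinf x) i,
      Nat.count_nth_of_infinite (hinf x) i⟩⟩
  choose θ hθ hθs using hth
  refine ⟨θ, hθ, ?_, ?_⟩
  · intro i x
    obtain ⟨j, -, h⟩ := hθs i x
    rw [h]; exact (hψE _ _).2 ⟨j, rfl⟩
  · intro x i i' h
    obtain ⟨j, ⟨h1, rfl⟩, h3⟩ := hθs i x
    obtain ⟨j', ⟨h1', rfl⟩, h3'⟩ := hθs i' x
    simp only [h3, h3'] at h
    rcases lt_trichotomy j j' with hlt | rfl | hlt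
    · exact absurd h (h1' j hlt)
    · rfl
    · exact absurd h.symm (h1 j' hlt)

theorem ramsey_main
    {X : Type*} [MeasurableSpace X] [StandardBorelSpace X]
    {Y : Type*} [MeasurableSpace Y] [StandardBorelSpace Y]
    (E : X → X → Prop) (hE : Equivalence E)
    (hEBorel : MeasurableSet {p : X × X | E p.1 p.2})
    (hEcount : ∀ x : X, {y | E x y}.Countable)
    (hEaper : ∀ x : X, {y | E x y}.Infinite)
    (F : Y → Y → Prop) (hF : Equivalence F)
    (hFBorel : MeasurableSet {p : Y × Y | F p.1 p.2})
    (hFcount : ∀ y : Y, {z | F y z}.Countable)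
    (n k : ℕ)
    (f : X → Y) (hfinj : Function.Injective f) (hfmeas : Measurable f)
    (hfred : ∀ x₁ x₂ : X, E x₁ x₂ ↔ F (f x₁) (f x₂))
    (hRamsey : StrongBorelRamsey F n k) :
    StrongBorelRamsey E n k := by
  intro c hc
  rcases isEmpty_or_nonempty X with hX | ⟨⟨x0⟩⟩
  · exact ⟨∅, MeasurableSet.empty, fun x => hX.elim x, fun x => hX.elim x⟩
  obtain ⟨φ, hφ, hφF⟩ := ln_enum F hF hFBorel hFcount
  obtain ⟨ψ, hψ, hψE⟩ := ln_enum E hE hEBorel hEcount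
  obtain ⟨θ, hθ, hθE, hθi⟩ := exists_injective_enum E hEaper ψ hψ hψE
  have hfe : MeasurableEmbedding f := hfmeas.measurableEmbedding hfinj
  obtain ⟨v, hv, hvf⟩ := hfe.exists_measurable_extend measurable_id (fun _ => ⟨x0⟩)
  have hvf : ∀ x, v (f x) = x := fun x => congrFun hvf x
  -- the retraction `r` from the saturation `S` of the range of `f`
  have hpm : ∀ i, MeasurableSet {y | φ i y ∈ range f} := fun i => hφ i hfe.measurableSet_range
  obtain ⟨r, hr, hrp⟩ := exists_measurable_first (fun i y => v (φ i y))
    (fun i => hv.comp (hφ i)) v hv (fun i y => φ i y ∈ range f) hpm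
  let S : Set Y := ⋃ i, {y | φ i y ∈ range f}
  have hS : MeasurableSet S := MeasurableSet.iUnion hpm
  have hSmem : ∀ x y, F (f x) y → y ∈ S := by
    intro x y h
    obtain ⟨i, hi⟩ := (hφF _ _).1 (hF.symm h)
    exact mem_iUnion.2 ⟨i, x, hi.symm⟩
  have hrS : ∀ y ∈ S, F (f (r y)) y := by
    intro y hy
    obtain ⟨i, ⟨x, hx⟩, h⟩ := hrp y (mem_iUnion.1 hy)
    rw [h, ← hx, hvf]
    rw [hx]
    exact hF.symm ((hφF _ _).2 ⟨i, rfl⟩)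
  obtain ⟨Z, hZ, hWm, hWc⟩ := ramsey_transfer E F hF φ hφ hφF n k f hfmeas hfred hRamsey c hc
    r hr S hS hrS
  set W := r '' (Z ∩ S) with hW
  have hWne : ∀ x, ∃ w ∈ W, E x w := by
    intro x
    obtain ⟨y, hy, hxy⟩ := (hZ (f x)).nonempty
    have hyS := hSmem x y hxy
    exact ⟨r y, ⟨y, ⟨hy, hyS⟩, rfl⟩, (hfred _ _).2 (hF.trans hxy (hF.symm (hrS y hyS)))⟩
  -- the part where `W` is finite
  let T : Set X := {x | {w | w ∈ W ∧ E x w}.Finite}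
  have hTinv : ∀ x x', E x x' → x ∈ T → x' ∈ T := by
    intro x x' h hx
    refine Set.Finite.subset hx ?_
    rintro w ⟨hw, hw'⟩
    exact ⟨hw, hE.trans h hw'⟩
  have hTm : MeasurableSet T := by
    have : T = ⋃ N : ℕ, ⋂ i : ℕ, ({x | ψ i x ∈ W}ᶜ ∪ ⋃ j : ℕ, ⋃ (_ : j < N),
        {x | ψ j x = ψ i x}) := by
      ext x
      simp only [mem_iUnion, mem_iInter, mem_union, mem_compl_iff, mem_ofPred_eq, exists_prop, T]
      constructor
      · intro hx
        have hx' : ∀ w, ∃ j, w ∈ {w | w ∈ W ∧ E x w} → ψ j x = w := by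
          intro w
          by_cases hw : w ∈ W ∧ E x w
          · obtain ⟨j, hj⟩ := (hψE _ _).1 hw.2
            exact ⟨j, fun _ => hj⟩
          · exact ⟨0, fun h => absurd h hw⟩
        choose J hJ using hx'
        obtain ⟨N, hN⟩ := (hx.image J).bddAbove
        refine ⟨N + 1, fun i => ?_⟩
        by_cases hi : ψ i x ∈ W
        · have hm : ψ i x ∈ {w | w ∈ W ∧ E x w} := ⟨hi, (hψE _ _).2 ⟨i, rfl⟩⟩
          exact Or.inr ⟨J (ψ i x), Nat.lt_succ_of_le (hN ⟨_, hm, rfl⟩), hJ _ hm⟩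
        · exact Or.inl hi
      · rintro ⟨N, hN⟩
        refine ((Set.finite_lt_nat N).image fun j => ψ j x).subset ?_
        rintro w ⟨hw, hxw⟩
        obtain ⟨i, rfl⟩ := (hψE _ _).1 hxw
        rcases hN i with h | ⟨j, hj, h⟩
        · exact absurd hw h
        · exact ⟨j, hj, h⟩
    rw [this]
    refine MeasurableSet.iUnion fun N => MeasurableSet.iInter fun i => MeasurableSet.union ?_ ?_
    · exact (hψ i hWm).compl
    · exact MeasurableSet.iUnion fun j => MeasurableSet.iUnion fun _ =>
        measurableSet_eq_fun (hψ j) (hψ i)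
  -- transversal on `T`
  let e := embeddingReal X
  have he : MeasurableEmbedding e := measurableEmbedding_embeddingReal X
  let Q : ℕ → X → Prop := fun i x => ψ i x ∈ W ∧ ∀ j, ψ j x ∈ W → e (ψ i x) ≤ e (ψ j x)
  have hQm : ∀ i, MeasurableSet {x | Q i x} := by
    intro i
    have : {x | Q i x} = {x | ψ i x ∈ W} ∩ ⋂ j, ({x | ψ j x ∈ W}ᶜ ∪
        {x | e (ψ i x) ≤ e (ψ j x)}) := by
      ext x
      simp only [Q, mem_inter_iff, mem_iInter, mem_union, mem_compl_iff, mem_ofPred_eq,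
        imp_iff_not_or]
    rw [this]
    refine (hψ i hWm).inter (MeasurableSet.iInter fun j => (hψ j hWm).compl.union ?_)
    exact measurableSet_le (he.measurable.comp (hψ i)) (he.measurable.comp (hψ j))
  obtain ⟨t, ht, htp⟩ := exists_measurable_first ψ hψ id measurable_id Q hQm
  have htT : ∀ x ∈ T, E x (t x) ∧ t x ∈ W ∧ ∀ w ∈ W, E x w → e (t x) ≤ e w := by
    intro x hx
    obtain ⟨w, ⟨hw, hxw⟩, hmin⟩ := Set.exists_min_image {w | w ∈ W ∧ E x w} e hx (hWne x)
    obtain ⟨i, hi⟩ := (hψE _ _).1 hxw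
    obtain ⟨i', hQ, h⟩ := htp x ⟨i, by rw [hi]; exact hw, fun j hj => by
      rw [hi]; exact hmin _ ⟨hj, (hψE _ _).2 ⟨j, rfl⟩⟩⟩
    rw [h]
    refine ⟨(hψE _ _).2 ⟨i', rfl⟩, hQ.1, fun w hw hxw => ?_⟩
    obtain ⟨j, rfl⟩ := (hψE _ _).1 hxw
    exact hQ.2 j hw
  have htinv : ∀ x ∈ T, ∀ x', E x x' → t x = t x' := by
    intro x hx x' h
    have h1 := htT x hx
    have h2 := htT x' (hTinv _ _ h hx)
    apply he.injective
    exact le_antisymm (h1.2.2 _ h2.2.1 (hE.trans h h2.1))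
      (h2.2.2 _ h1.2.1 (hE.trans (hE.symm h) h1.1))
  -- injective retraction over `T`
  let S' : Set Y := S ∩ r ⁻¹' T
  have hS' : MeasurableSet S' := hS.inter (hr hTm)
  have htr : Measurable fun y => t (r y) := ht.comp hr
  obtain ⟨r', hr', hrp'⟩ := exists_measurable_first (fun i y => θ i (t (r y)))
    (fun i => (hθ i).comp htr) r hr (fun i y => φ i (f (t (r y))) = y)
    (fun i => measurableSet_eq_fun ((hφ i).comp (hfmeas.comp htr)) measurable_id)
  have hr'S : ∀ y ∈ S', ∃ i, φ i (f (t (r y))) = y ∧ r' y = θ i (t (r y)) := by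
    intro y hy
    apply hrp'
    rw [← hφF]
    exact hF.trans ((hfred _ _).1 (hE.symm (htT _ hy.2).1)) (hrS y hy.1)
  have hrE : ∀ y ∈ S', E (r' y) (r y) := by
    intro y hy
    obtain ⟨i, -, h⟩ := hr'S y hy
    rw [h]
    exact hE.symm (hE.trans (htT _ hy.2).1 (hθE i _))
  have hr'inj : InjOn r' S' := by
    intro y hy y' hy' h
    obtain ⟨i, h1, h2⟩ := hr'S y hy
    obtain ⟨i', h1', h2'⟩ := hr'S y' hy'
    have hEr : E (r y) (r y') := hE.trans (hE.symm (hrE y hy)) (h ▸ hrE y' hy')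
    have htt := htinv _ hy.2 _ hEr
    rw [h2, h2', ← htt] at h
    have : i = i' := hθi _ h
    rw [← h1, ← h1', this, htt]
  obtain ⟨Z', hZ', hWm', hWc'⟩ := ramsey_transfer E F hF φ hφ hφF n k f hfmeas hfred hRamsey c hc
    r' hr' S' hS' (fun y hy => hF.trans ((hfred _ _).1 (hrE y hy)) (hrS y hy.1))
  refine ⟨(W \ T) ∪ (r' '' (Z' ∩ S') ∩ T), (hWm.diff hTm).union (hWm'.inter hTm), ?_, ?_⟩
  · intro x
    by_cases hx : x ∈ T
    · have hsub : {y | y ∈ Z' ∧ F (f x) y} ⊆ Z' ∩ S' := by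
        rintro y ⟨hy, hxy⟩
        have hyS := hSmem x y hxy
        refine ⟨hy, hyS, hTinv x _ ?_ hx⟩
        exact (hfred _ _).2 (hF.trans hxy (hF.symm (hrS y hyS)))
      have hinf := (hZ' (f x)).image (f := r') (hr'inj.mono (hsub.trans inter_subset_right))
      refine hinf.mono ?_
      rintro _ ⟨y, hy, rfl⟩
      have hy' := hsub hy
      have hxr : E x (r' y) := hE.trans
        ((hfred _ _).2 (hF.trans hy.2 (hF.symm (hrS y hy'.2.1)))) (hE.symm (hrE y hy'.2))
      exact ⟨Or.inr ⟨⟨y, hy', rfl⟩, hTinv _ _ hxr hx⟩, hxr⟩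
    · have hinf : {w | w ∈ W ∧ E x w}.Infinite := hx
      refine hinf.mono ?_
      rintro w ⟨hw, hxw⟩
      exact ⟨Or.inl ⟨hw, fun h => hx (hTinv _ _ (hE.symm hxw) h)⟩, hxw⟩
  · intro x
    by_cases hx : x ∈ T
    · obtain ⟨a, ha⟩ := hWc' x
      refine ⟨a, fun A hA hAs hAE => ha A hA (fun y hy => ?_) hAE⟩
      rcases hAs hy with h | h
      · exact absurd (hTinv _ _ (hAE y hy) hx) h.2
      · exact h.1
    · obtain ⟨a, ha⟩ := hWc x
      refine ⟨a, fun A hA hAs hAE => ha A hA (fun y hy => ?_) hAE⟩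
      rcases hAs hy with h | h
      · exact h.1
      · exact absurd (hTinv _ _ (hE.symm (hAE y hy)) h.2) hx


end Helpers

/-- If `E` is Borel embeddable into `F` and `F →_B (F)^n_k` holds, then `E →_B (E)^n_k`
holds. -/
theorem strong_borel_ramsey_of_borel_embedding
    {X : Type*} [MeasurableSpace X] [StandardBorelSpace X]
    {Y : Type*} [MeasurableSpace Y] [StandardBorelSpace Y]
    (E : X → X → Prop) (hE : Equivalence E)
    (hEBorel : MeasurableSet {p : X × X | E p.1 p.2})
    (hEcount : ∀ x : X, {y | E x y}.Countable)
    (hEaper : ∀ x : X, {y | E x y}.Infinite)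
    (F : Y → Y → Prop) (hF : Equivalence F)
    (hFBorel : MeasurableSet {p : Y × Y | F p.1 p.2})
    (hFcount : ∀ y : Y, {z | F y z}.Countable)
    (hFaper : ∀ y : Y, {z | F y z}.Infinite)
    (n k : ℕ) (hn : 1 < n) (hk : 1 < k)
    (f : X → Y) (hfinj : Function.Injective f) (hfmeas : Measurable f)
    (hfred : ∀ x₁ x₂ : X, E x₁ x₂ ↔ F (f x₁) (f x₂))
    (hRamsey : StrongBorelRamsey F n k) :
    StrongBorelRamsey E n k := by
  exact ramsey_main E hE hEBorel hEcount hEaper F hF hFBorel hFcount n k f hfinj hfmeas hfred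
    hRamsey
end
end

section
/- Let X be a standard Borel space and let E be an aperiodic, countable Borel equivalence relation on X. If the strong Borel Ramsey property E →_B (E)^n_k holds for some integers n, k > 1, then E is smooth. -/
open Classical

noncomputable section

section RamseyHelpers

open Set TopologicalSpace MeasureTheory Filter Topology

/-- A finite family of sets is robust if the images of its members share a point even after
removing countably many Borel sets on which `q` is injective. -/
def LNRobust {P X : Type*} [MeasurableSpace P] (q : P → X) (T : Finset (Set P)) : Prop :=
  ∀ B : Set (Set P), B.Countable → (∀ b ∈ B, MeasurableSet b ∧ InjOn q b) →
    ∃ x, ∀ v ∈ T, ∃ y ∈ v, y ∉ ⋃₀ B ∧ q y = x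

/-- The two sets are disjoint small open sets well inside `u`. -/
def LNGood {P : Type*} [MetricSpace P] (u : Set P) (r : ENNReal) (t t' : Set P) : Prop :=
  IsOpen t ∧ IsOpen t' ∧ closure t ⊆ u ∧ closure t' ⊆ u ∧ Disjoint t t' ∧
    Metric.ediam t ≤ r ∧ Metric.ediam t' ≤ r

lemma ln_small {P : Type*} [MetricSpace P] {b : Set (Set P)} (hb : IsTopologicalBasis b)
    {u : Set P} (hu : IsOpen u) {y : P} (hy : y ∈ u) {r : ENNReal} (hr : 0 < r) :
    ∃ t ∈ b, y ∈ t ∧ closure t ⊆ u ∧ Metric.ediam t ≤ r := by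
  have h1 : u ∩ Metric.eball y (r / 2) ∈ 𝓝 y :=
    inter_mem (hu.mem_nhds hy) (Metric.eball_mem_nhds y (ENNReal.half_pos hr.ne'))
  obtain ⟨s, hs, hsc, hsu⟩ := exists_mem_nhds_isClosed_subset h1
  obtain ⟨t, ht, hyt, hts⟩ := hb.mem_nhds_iff.1 hs
  refine ⟨t, ht, hyt, ?_, ?_⟩
  · exact (closure_minimal hts hsc).trans (hsu.trans inter_subset_left)
  · refine (Metric.ediam_mono (hts.trans (hsu.trans inter_subset_right))).trans ?_
    refine Metric.ediam_eball_le.trans ?_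
    rw [ENNReal.mul_div_cancel (by simp) (by simp)]

lemma ln_split {P X : Type*} [MetricSpace P] [CompleteSpace P] [SecondCountableTopology P]
    [MeasurableSpace P] [BorelSpace P] [TopologicalSpace X] [PolishSpace X] [MeasurableSpace X]
    [BorelSpace X] {q : P → X} (hq : Continuous q) (T : Finset (Set P)) 
    (hT : ∀ v ∈ T, IsOpen v) {u : Set P} (hu : IsOpen u)
    (h : LNRobust q (insert u T)) {r : ENNReal} (hr : 0 < r) :
    ∃ t t', LNGood u r t t' ∧ LNRobust q (insert t (insert t' T)) := by
  by_contra hcon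
  push Not at hcon
  obtain ⟨b, bc, -, hb⟩ := exists_countable_basis P
  let G : Set (Set P × Set P) := {p | (p.1 ∈ b ∧ p.2 ∈ b) ∧ LNGood u r p.1 p.2}
  have Gc : G.Countable := (bc.prod bc).mono fun p hp => hp.1
  have key : ∀ p : G, ∃ B : Set (Set P), B.Countable ∧ (∀ b ∈ B, MeasurableSet b ∧ InjOn q b) ∧
      ∀ x, ¬ ∀ v ∈ insert p.1.1 (insert p.1.2 T), ∃ y ∈ v, y ∉ ⋃₀ B ∧ q y = x := by
    intro p
    have := hcon _ _ p.2.2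
    unfold LNRobust at this
    push Not at this
    obtain ⟨B, h1, h2, h3⟩ := this
    refine ⟨B, h1, h2, ?_⟩
    push Not
    exact h3
  choose B Bc Bi hB using key
  have : Countable G := Gc.to_subtype
  let BB : Set (Set P) := ⋃ p, B p
  have BBc : BB.Countable := countable_iUnion Bc
  have BBi : ∀ b ∈ BB, MeasurableSet b ∧ InjOn q b := by
    intro b hb
    obtain ⟨p, hp⟩ := mem_iUnion.1 hb
    exact Bi p b hp
  set N := ⋃₀ BB with hN
  have Nm : MeasurableSet N := MeasurableSet.sUnion BBc fun b hb => (BBi b hb).1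
  have BN : ∀ p, ⋃₀ B p ⊆ N := fun p => sUnion_subset_sUnion (subset_iUnion B p)
  let C : Set X := ⋂ o : Option T, o.elim univ fun v => q '' (v.1 \ N)
  let M : Set X := ⋃ p : G, (q '' (p.1.1 \ N) ∩ q '' (p.1.2 \ N))
  have an : ∀ v : Set P, IsOpen v → AnalyticSet (q '' (v \ N)) := fun v hv =>
    (hv.measurableSet.diff Nm).analyticSet_image hq.measurable
  have hC : AnalyticSet C := by
    refine AnalyticSet.iInter ?_
    rintro (_ | v)
    · exact MeasurableSet.univ.analyticSet
    · exact an _ (hT _ v.2)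
  have hM : AnalyticSet M := by
    refine AnalyticSet.iUnion fun p => ?_
    rw [inter_eq_iInter]
    refine AnalyticSet.iInter ?_
    rintro (_ | _)
    · exact an _ p.2.2.2.1
    · exact an _ p.2.2.1
  have hCm : ∀ x, x ∈ C ↔ ∀ v ∈ T, ∃ y ∈ v, y ∉ N ∧ q y = x := by
    intro x
    simp only [C, mem_iInter, Option.forall, Option.elim]
    constructor
    · rintro ⟨-, h⟩ v hv
      obtain ⟨y, ⟨h1, h2⟩, h3⟩ := h ⟨v, hv⟩
      exact ⟨y, h1, h2, h3⟩
    · intro h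
      refine ⟨trivial, fun v => ?_⟩
      obtain ⟨y, h1, h2, h3⟩ := h v.1 v.2
      exact ⟨y, ⟨h1, h2⟩, h3⟩
  have hdis : Disjoint C M := by
    rw [Set.disjoint_left]
    intro x hx hxM
    obtain ⟨p, ⟨y, ⟨hy, hyN⟩, hyx⟩, ⟨y', ⟨hy', hyN'⟩, hyx'⟩⟩ := mem_iUnion.1 hxM
    apply hB p x
    intro v hv
    rw [Finset.mem_insert, Finset.mem_insert] at hv
    rcases hv with rfl | rfl | hv
    · exact ⟨y, hy, fun hh => hyN (BN p hh), hyx⟩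
    · exact ⟨y', hy', fun hh => hyN' (BN p hh), hyx'⟩
    · obtain ⟨z, h1, h2, h3⟩ := (hCm x).1 hx v hv
      exact ⟨z, h1, fun hh => h2 (BN p hh), h3⟩
  obtain ⟨S, hCS, hMS, hS⟩ := hC.measurablySeparable hM hdis
  obtain ⟨x, hx⟩ := h (insert ((u \ N) ∩ q ⁻¹' S) BB) (BBc.insert _) (by
    intro c hc
    rcases hc with rfl | hc
    · refine ⟨(hu.measurableSet.diff Nm).inter (hq.measurable hS), ?_⟩
      rintro y ⟨⟨hyu, hyN⟩, hyS⟩ y' ⟨⟨hyu', hyN'⟩, hyS'⟩ hyy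
      by_contra hne
      obtain ⟨w, w', hw, hw', hyw, hyw', hww⟩ := t2_separation hne
      obtain ⟨t, htb, hyt, htc, htd⟩ := ln_small hb (hu.inter hw) ⟨hyu, hyw⟩ hr
      obtain ⟨t', htb', hyt', htc', htd'⟩ := ln_small hb (hu.inter hw') ⟨hyu', hyw'⟩ hr
      have hg : (t, t') ∈ G := ⟨⟨htb, htb'⟩, hb.isOpen htb, hb.isOpen htb',
        htc.trans inter_subset_left, htc'.trans inter_subset_left,
        hww.mono (subset_closure.trans (htc.trans inter_subset_right))
          (subset_closure.trans (htc'.trans inter_subset_right)), htd, htd'⟩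
      refine Set.disjoint_left.1 hMS (mem_iUnion.2 ⟨⟨(t, t'), hg⟩, ?_, ?_⟩) hyS
      · exact ⟨y, ⟨hyt, hyN⟩, rfl⟩
      · exact ⟨y', ⟨hyt', hyN'⟩, hyy.symm⟩
    · exact BBi c hc)
  have hxC : x ∈ C := by
    rw [hCm]
    intro v hv
    obtain ⟨y, h1, h2, h3⟩ := hx v (Finset.mem_insert_of_mem hv)
    exact ⟨y, h1, fun hh => h2 (sUnion_subset_sUnion (subset_insert _ _) hh), h3⟩
  obtain ⟨y, h1, h2, h3⟩ := hx u (Finset.mem_insert_self _ _)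
  apply h2
  rw [sUnion_insert]
  by_cases hy : y ∈ N
  · exact Or.inr hy
  · exact Or.inl ⟨⟨h1, hy⟩, by rw [mem_preimage, h3]; exact hCS hxC⟩

lemma ln_split_all {P X : Type*} [MetricSpace P] [CompleteSpace P] [SecondCountableTopology P]
    [MeasurableSpace P] [BorelSpace P] [TopologicalSpace X] [PolishSpace X] [MeasurableSpace X]
    [BorelSpace X] {q : P → X} (hq : Continuous q) {r : ENNReal} (hr : 0 < r)
    (S : Finset (Set P)) : ∀ (T : Finset (Set P)), 
    (∀ v ∈ S, IsOpen v) → (∀ v ∈ T, IsOpen v) → LNRobust q (S ∪ T) →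
    ∃ c : Bool → Set P → Set P, (∀ u ∈ S, LNGood u r (c true u) (c false u)) ∧
      LNRobust q (S.image (c true) ∪ S.image (c false) ∪ T) := by
  induction S using Finset.induction_on with
  | empty => 
    intro T _ _ h
    exact ⟨fun _ => id, by simp, by simpa using h⟩
  | insert a S ha ih =>
    intro T hS hT h
    have hT' : ∀ v ∈ insert a T, IsOpen v := by
      intro v hv
      rcases Finset.mem_insert.1 hv with rfl | hv
      · exact hS _ (Finset.mem_insert_self _ _)
      · exact hT _ hv
    obtain ⟨c, hc, hR⟩ := ih (insert a T) (fun v hv => hS v (Finset.mem_insert_of_mem hv)) hT'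
      (by rwa [Finset.union_insert, ← Finset.insert_union])
    rw [Finset.union_insert] at hR
    obtain ⟨t, t', hg, hR'⟩ := ln_split hq _ (by
      intro v hv
      simp only [Finset.mem_union, Finset.mem_image] at hv
      rcases hv with (⟨w, hw, rfl⟩ | ⟨w, hw, rfl⟩) | hv
      · exact (hc w hw).1
      · exact (hc w hw).2.1
      · exact hT v hv) (hS a (Finset.mem_insert_self _ _)) hR hr
    have e1 : ∀ (β : Bool) (s : Set P), S.image (Function.update (c β) a s) = S.image (c β) := by
      intro β s
      refine Finset.image_congr ?_
      intro w hw
      refine Function.update_of_ne ?_ _ _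
      rintro rfl
      exact ha hw
    refine ⟨fun β => Function.update (c β) a (if β then t else t'), ?_, ?_⟩
    · intro u hu
      rcases Finset.mem_insert.1 hu with rfl | hu
      · simpa using hg
      · have : u ≠ a := fun h => ha (h ▸ hu)
        simpa [Function.update_of_ne this] using hc u hu
    · convert hR' using 1
      simp only [Finset.image_insert, e1]
      ext v
      simp only [Function.update_self, Finset.mem_union, Finset.mem_insert]
      simp only [if_true, Bool.false_eq_true, if_false, or_assoc, or_left_comm]


theorem ln_main_s8 {P X : Type*} [MetricSpace P] [CompleteSpace P] [SecondCountableTopology P]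
    [MeasurableSpace P] [BorelSpace P] [TopologicalSpace X] [PolishSpace X] [MeasurableSpace X]
    [BorelSpace X] {q : P → X} (hq : Continuous q) (hfib : ∀ x, (q ⁻¹' {x}).Countable) :
    ∃ B : Set (Set P), B.Countable ∧ (∀ b ∈ B, MeasurableSet b ∧ InjOn q b) ∧ ⋃₀ B = univ := by
  by_contra hcon
  push Not at hcon
  have h0 : LNRobust q {univ} := by
    intro B h1 h2
    obtain ⟨y, hy⟩ := (ne_univ_iff_exists_notMem _).1 (hcon B h1 h2)
    refine ⟨q y, ?_⟩
    simp only [Finset.mem_singleton, forall_eq]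
    exact ⟨y, trivial, hy, rfl⟩
  let St := {T : Finset (Set P) // (∀ v ∈ T, IsOpen v) ∧ LNRobust q T}
  have step : ∀ (k : ℕ) (T : St), ∃ c : Bool → Set P → Set P,
      (∀ u ∈ T.1, LNGood u ((2⁻¹ : ENNReal) ^ k) (c true u) (c false u)) ∧
      LNRobust q (T.1.image (c true) ∪ T.1.image (c false)) := by
    intro k T
    have := ln_split_all hq (r := (2⁻¹ : ENNReal) ^ k) (ENNReal.pow_pos (by simp) k) T.1 ∅ T.2.1
      (by simp) (by simpa using T.2.2)
    simpa using this
  choose c hc hcR using step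
  let nxt : ℕ → St → St := fun k T => ⟨T.1.image (c k T true) ∪ T.1.image (c k T false), by
    intro v hv
    simp only [Finset.mem_union, Finset.mem_image] at hv
    rcases hv with ⟨w, hw, rfl⟩ | ⟨w, hw, rfl⟩
    · exact (hc k T w hw).1
    · exact (hc k T w hw).2.1, hcR k T⟩
  let T : ℕ → St := fun k => Nat.rec ⟨{univ}, by simp, h0⟩ nxt k
  have hT : ∀ k, T (k + 1) = nxt k (T k) := fun k => rfl
  let A : List Bool → Set P := fun l =>
    List.rec univ (fun β l s => c l.length (T l.length) β s) l
  have hA : ∀ β l, A (β :: l) = c l.length (T l.length) β (A l) := fun β l => rfl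
  have hmem : ∀ l, A l ∈ (T l.length).1 := by
    intro l
    induction l with
    | nil => exact Finset.mem_singleton_self _
    | cons β l ih =>
      rw [hA, List.length_cons, hT]
      simp only [nxt, Finset.mem_union, Finset.mem_image]
      cases β
      · exact Or.inr ⟨_, ih, rfl⟩
      · exact Or.inl ⟨_, ih, rfl⟩
  have hgood : ∀ l, LNGood (A l) ((2⁻¹ : ENNReal) ^ l.length) (A (true :: l)) (A (false :: l)) :=
    fun l => hc _ _ _ (hmem l)
  have hx : ∀ k, ∃ x, ∀ l : List Bool, l.length = k → ∃ y ∈ A l, q y = x := by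
    intro k
    obtain ⟨x, hx⟩ := (T k).2.2 ∅ countable_empty (by simp)
    refine ⟨x, ?_⟩
    rintro l rfl
    obtain ⟨y, h1, -, h2⟩ := hx _ (hmem l)
    exact ⟨y, h1, h2⟩
  choose x hx using hx
  have hclo : CantorScheme.ClosureAntitone A := by
    intro l β
    cases β
    · exact (hgood l).2.2.2.1
    · exact (hgood l).2.2.1
  have hdisj : CantorScheme.Disjoint A := by
    intro l β β' hne
    have := (hgood l).2.2.2.2.1
    cases β <;> cases β'
    · exact absurd rfl hne
    · exact this.symm
    · exact this
    · exact absurd rfl hne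
  have hdiam : CantorScheme.VanishingDiam A := by
    intro z
    rw [← tendsto_add_atTop_iff_nat 1]
    refine tendsto_of_tendsto_of_tendsto_of_le_of_le tendsto_const_nhds
      (ENNReal.tendsto_pow_atTop_nhds_zero_of_lt_one (r := 2⁻¹) (by simp)) (fun _ => zero_le) ?_
    intro n
    have h := hgood (PiNat.res z n)
    rw [PiNat.res_length] at h
    show Metric.ediam (A (PiNat.res z (n+1))) ≤ _
    rw [PiNat.res_succ]
    cases z n
    · exact h.2.2.2.2.2.2
    · exact h.2.2.2.2.2.1
  have hne : ∀ l, (A l).Nonempty := by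
    intro l
    obtain ⟨y, hy, -⟩ := hx _ l rfl
    exact ⟨y, hy⟩
  have hdom := hclo.map_of_vanishingDiam hdiam hne
  have hinj := hdisj.map_injective
  let g : (ℕ → Bool) → P := fun z => (CantorScheme.inducedMap A).2 ⟨z, by rw [hdom]; trivial⟩
  have hginj : Function.Injective g := by
    intro z z' h
    have := hinj h
    simpa using this
  have hgA : ∀ z n, g z ∈ A (PiNat.res z n) := fun z n => CantorScheme.map_mem _ n
  have hlim : ∀ z, Tendsto x atTop (𝓝 (q (g z))) := by
    intro z
    choose y hy hyx using fun k => hx k (PiNat.res z k) (PiNat.res_length z k)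
    have h1 : Tendsto y atTop (𝓝 (g z)) := by
      rw [tendsto_iff_edist_tendsto_0]
      refine tendsto_of_tendsto_of_tendsto_of_le_of_le tendsto_const_nhds (hdiam z)
        (fun _ => zero_le) ?_
      intro n
      exact Metric.edist_le_ediam_of_mem (hy n) (hgA z n)
    have h2 := (hq.tendsto (g z)).comp h1
    refine h2.congr ?_
    intro k
    exact hyx k
  have hall : ∀ z, g z ∈ q ⁻¹' {q (g fun _ => true)} := fun z =>
    tendsto_nhds_unique (hlim z) (hlim _)
  have hcc : (univ : Set (ℕ → Bool)).Countable := by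
    refine ((hfib (q (g fun _ => true))).preimage_of_injOn (f := g) hginj.injOn).mono ?_
    intro z _
    exact hall z
  have : Countable (ℕ → Bool) := countable_univ_iff.1 hcc
  obtain ⟨e, he⟩ := exists_surjective_nat (ℕ → Bool)
  obtain ⟨n, hn⟩ := he fun n => !(e n n)
  have := congrFun hn n
  simp at this

theorem ln_general {R X : Type*} [MeasurableSpace R] [StandardBorelSpace R]
    [MeasurableSpace X] [StandardBorelSpace X] {q : R → X} (hq : Measurable q)
    (hfib : ∀ x, (q ⁻¹' {x}).Countable) :
    ∃ B : Set (Set R), B.Countable ∧ (∀ b ∈ B, MeasurableSet b ∧ InjOn q b) ∧ ⋃₀ B = univ := by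
  let := upgradeStandardBorel X
  obtain ⟨tR, hbR, hpR⟩ := StandardBorelSpace.polish (α := R)
  obtain ⟨t', hle, hcont, hpol⟩ := hq.exists_continuous
  have hbor : (inferInstance : MeasurableSpace R) = @borel R t' := by
    rw [borel_eq_borel_of_le hpol hpR hle]
    exact BorelSpace.measurable_eq
  clear hle hpR hbR
  clear tR
  have : BorelSpace R := ⟨hbor⟩
  let := upgradeIsCompletelyMetrizable R
  exact ln_main_s8 hcont hfib

/-- Lusin-Novikov for countable Borel equivalence relations. -/
theorem ln_functions {X : Type*} [MeasurableSpace X] [StandardBorelSpace X]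
    (E : X → X → Prop) (hE : Equivalence E)
    (hEBorel : MeasurableSet {p : X × X | E p.1 p.2})
    (hcount : ∀ x : X, {y | E x y}.Countable) :
    ∃ f : ℕ → X → X, (∀ i, Measurable (f i)) ∧ ∀ x y, E x y ↔ ∃ i, f i x = y := by
  let R : Set (X × X) := {p : X × X | E p.1 p.2}
  have : StandardBorelSpace R := hEBorel.standardBorel
  let q : R → X := fun p => p.1.1
  have hq : Measurable q := measurable_fst.comp measurable_subtype_coe
  have hs : Measurable (fun p : R => p.1.2) := measurable_snd.comp measurable_subtype_coe
  obtain ⟨B, Bc, hB, hBu⟩ := ln_general hq (by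
    intro x
    have hinj : InjOn (fun p : R => p.1.2) (q ⁻¹' {x}) := by
      rintro ⟨⟨a, b⟩, hp⟩ h1 ⟨⟨a', b'⟩, hp'⟩ h2 h3
      simp only [q, mem_preimage, mem_singleton_iff] at h1 h2 h3
      subst h1 h2 h3
      rfl
    refine Set.countable_of_injective_of_countable_image hinj ((hcount x).mono ?_)
    rintro _ ⟨⟨⟨a, b⟩, hp⟩, h1, rfl⟩
    simp only [q, mem_preimage, mem_singleton_iff] at h1
    subst h1
    exact hp)
  obtain ⟨b, hb⟩ := (Bc.insert ∅).exists_eq_range (insert_nonempty _ _)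
  have hb' : ∀ i, MeasurableSet (b i) ∧ InjOn q (b i) := by
    intro i
    have : b i ∈ insert ∅ B := hb ▸ mem_range_self i
    rcases this with h | h
    · rw [h]; exact ⟨MeasurableSet.empty, injOn_empty _⟩
    · exact hB _ h
  let f : ℕ → X → X := fun i x =>
    if h : ∃ p ∈ b i, q p = x then (Classical.choose h).1.2 else x
  have f1 : ∀ i p, p ∈ b i → f i (q p) = p.1.2 := by
    intro i p hp
    have h : ∃ p' ∈ b i, q p' = q p := ⟨p, hp, rfl⟩
    have h2 := Classical.choose_spec h
    have h3 : Classical.choose h = p := (hb' i).2 h2.1 hp h2.2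
    simp only [f, dif_pos h, h3]
  have f2 : ∀ i x, x ∉ q '' (b i) → f i x = x := by
    intro i x hx
    exact dif_neg hx
  refine ⟨f, ?_, ?_⟩
  · intro i S hS
    have h1 : MeasurableSet (q '' (b i ∩ (fun p : R => p.1.2) ⁻¹' S)) :=
      ((hb' i).1.inter (hs hS)).image_of_measurable_injOn hq ((hb' i).2.mono inter_subset_left)
    have h2 : MeasurableSet (q '' (b i)) := (hb' i).1.image_of_measurable_injOn hq (hb' i).2
    convert h1.union (h2.compl.inter hS) using 1
    ext x
    by_cases hx : x ∈ q '' (b i)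
    · obtain ⟨p, hp, rfl⟩ := hx
      rw [mem_preimage, f1 i p hp]
      constructor
      · intro h
        exact Or.inl ⟨p, ⟨hp, h⟩, rfl⟩
      · rintro (⟨p', ⟨hp', hS'⟩, h⟩ | ⟨h, -⟩)
        · rw [(hb' i).2 hp' hp h] at hS'
          exact hS'
        · exact absurd ⟨p, hp, rfl⟩ h
    · rw [mem_preimage, f2 i x hx]
      constructor
      · intro h
        exact Or.inr ⟨hx, h⟩
      · rintro (⟨p', ⟨hp', hS'⟩, h⟩ | ⟨-, h⟩)
        · exact absurd ⟨p', hp', h⟩ hx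
        · exact h
  · intro x y
    constructor
    · intro h
      have : (⟨(x, y), h⟩ : R) ∈ ⋃₀ B := by rw [hBu]; trivial
      obtain ⟨s, hs, hm⟩ := this
      have : s ∈ range b := hb ▸ mem_insert_of_mem _ hs
      obtain ⟨i, rfl⟩ := this
      exact ⟨i, f1 i _ hm⟩
    · rintro ⟨i, rfl⟩
      by_cases hx : x ∈ q '' (b i)
      · obtain ⟨p, hp, rfl⟩ := hx
        rw [f1 i p hp]
        exact p.2
      · rw [f2 i x hx]
        exact hE.refl x

/-- One refinement step. -/
lemma topo_step {X : Type*} [mX : MeasurableSpace X] (f : ℕ → X → X) (hf : ∀ i, Measurable (f i))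
    (A : ℕ → Set X) (hA : ∀ i, MeasurableSet (A i))
    (t : TopologicalSpace X) (hp : @PolishSpace X t) (hb : mX = @borel X t) :
    ∃ t' : TopologicalSpace X, t' ≤ t ∧ @PolishSpace X t' ∧ mX = @borel X t' ∧
      (∀ i, @Continuous X X t' t (f i)) ∧ ∀ i, IsOpen[t'] (A i) := by
  have : BorelSpace X := ⟨hb⟩
  choose m1 h1 h1' h1'' using fun i => (hf i).exists_continuous
  choose m2 h2 h2' _ h2'' using fun i => (hA i).isClopenable
  obtain ⟨t', ht, htt, hpt⟩ := PolishSpace.exists_polishSpace_forall_le (t := t)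
    (fun o : ℕ ⊕ ℕ => o.elim m1 m2) (by rintro (i | i); exacts [h1 i, h2 i])
      (by rintro (i | i); exacts [h1'' i, h2' i])
  refine ⟨t', htt, hpt, ?_, ?_, ?_⟩
  · rw [borel_eq_borel_of_le hpt hp htt, hb]
  · intro i
    exact continuous_le_dom (ht (Sum.inl i)) (h1' i)
  · intro i
    exact ht (Sum.inr i) _ (h2'' i)

theorem topo_refine {X : Type*} [mX : MeasurableSpace X] [StandardBorelSpace X]
    (f : ℕ → X → X) (hf : ∀ i, Measurable (f i))
    (A : ℕ → Set X) (hA : ∀ i, MeasurableSet (A i)) :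
    ∃ t : TopologicalSpace X, @PolishSpace X t ∧ mX = @borel X t ∧
      (∀ i, @Continuous X X t t (f i)) ∧ ∀ i, IsOpen[t] (A i) := by
  obtain ⟨t0, hb0, hp0⟩ := StandardBorelSpace.polish (α := X)
  let St := {t : TopologicalSpace X // @PolishSpace X t ∧ mX = @borel X t}
  choose nx n1 n2 n3 n4 n5 using
    fun s : St => topo_step f hf A hA s.1 s.2.1 s.2.2
  let T : ℕ → St := fun k => Nat.rec ⟨t0, hp0, hb0.measurable_eq⟩ (fun _ s => ⟨nx s, n2 s, n3 s⟩) k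
  have hT : ∀ k, (T (k + 1)).1 = nx (T k) := fun k => rfl
  have h0 : ∀ k, (T k).1 ≤ (T 0).1 := by
    intro k
    induction k with
    | zero => exact le_rfl
    | succ k ih => exact (n1 (T k)).trans ih
  have hpol : @PolishSpace X (⨅ k, (T k).1) := PolishSpace.iInf ⟨0, h0⟩ fun k => (T k).2.1
  refine ⟨⨅ k, (T k).1, hpol, ?_, ?_, ?_⟩
  · rw [borel_eq_borel_of_le hpol (T 0).2.1 (iInf_le _ 0)]
    exact (T 0).2.2
  · intro i
    refine continuous_iInf_rng.2 fun k => ?_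
    exact continuous_iInf_dom (i := k + 1) (n4 (T k) i)
  · intro i
    exact (iInf_le (fun k => (T k).1) 1) _ (n5 (T 0) i)


/-- In a space with countably many continuous maps generating `E` via local homeomorphisms, the
set of points whose whole class lies in a given residual set is residual. -/
lemma residual_saturate {K : Type*} [TopologicalSpace K]
    (f : ℕ → K → K) (hf : ∀ i, Continuous (f i)) (E : K → K → Prop) (hE : Equivalence E)
    (hEf : ∀ x y, E x y ↔ ∃ i, f i x = y) [T2Space K]
    (hA : ∀ i j, IsOpen {x | f j (f i x) = x}) {S : Set K} (hS : S ∈ residual K) :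
    {x | ∀ y, E x y → y ∈ S} ∈ residual K := by
  obtain ⟨O, hO1, hO2, hO3, hO4⟩ := mem_residual_iff.1 hS
  have key : ∀ o ∈ O, ∀ p : ℕ × ℕ,
      {x | f p.2 (f p.1 x) = x → f p.1 x ∈ o} ∈ residual K := by
    rintro o ho ⟨i, j⟩
    have hcl : IsClosed {x | f j (f i x) = x} :=
      isClosed_eq ((hf j).comp (hf i)) continuous_id
    refine residual_of_dense_open ?_ ?_
    · have : {x | f j (f i x) = x → f i x ∈ o} = {x | f j (f i x) = x}ᶜ ∪ f i ⁻¹' o := by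
        ext x; simp only [mem_ofPred_eq, mem_union, mem_compl_iff, mem_preimage]; tauto
      simp only [this]
      exact hcl.isOpen_compl.union ((hO1 o ho).preimage (hf i))
    · rw [dense_iff_inter_open]
      rintro U hU ⟨x, hx⟩
      by_cases hxA : f j (f i x) = x
      · let W : Set K := {y | f i (f j y) = y} ∩ f j ⁻¹' U
        have hW : IsOpen W := (hA j i).inter (hU.preimage (hf j))
        have hfx : f i x ∈ W := by
          refine ⟨?_, ?_⟩
          · show f i (f j (f i x)) = f i x
            rw [hxA]
          · show f j (f i x) ∈ U
            rwa [hxA]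
        obtain ⟨y, ⟨hy1, hy2⟩, hyo⟩ := (dense_iff_inter_open.1 (hO2 o ho)) W hW ⟨_, hfx⟩
        refine ⟨f j y, hy2, fun _ => ?_⟩
        have : f i (f j y) = y := hy1
        show f i (f j y) ∈ o
        rwa [this]
      · exact ⟨x, hx, fun h => absurd h hxA⟩
  have h1 : (⋂ o ∈ O, ⋂ p : ℕ × ℕ, {x | f p.2 (f p.1 x) = x → f p.1 x ∈ o}) ∈ residual K := by
    refine (countable_bInter_mem hO3).2 fun o ho => ?_
    exact countable_iInter_mem.2 fun p => key o ho p
  refine mem_of_superset h1 ?_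
  intro x hx y hxy
  apply hO4
  intro o ho
  obtain ⟨i, rfl⟩ := (hEf x y).1 hxy
  obtain ⟨j, hj⟩ := (hEf _ _).1 (hE.symm hxy)
  simp only [mem_iInter] at hx
  exact hx o ho (i, j) hj

theorem baire_core {K : Type*} [TopologicalSpace K] [PolishSpace K] [MeasurableSpace K]
    [BorelSpace K] [Nonempty K]
    (f : ℕ → K → K) (hf : ∀ i, Continuous (f i)) (E : K → K → Prop) (hE : Equivalence E)
    (hEf : ∀ x y, E x y ↔ ∃ i, f i x = y)
    (hA : ∀ i j, IsOpen {x | f j (f i x) = x}) (x0 : K) (hd : Dense {y | E x0 y})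
    (Y : Set K) (hY : MeasurableSet Y) (hYc : ∀ x, ∃ y ∈ Y, E x y) :
    ∃ U : Set K, IsOpen U ∧ U.Nonempty ∧ ∃ x, Dense {y | E x y} ∧ ∀ y, E x y → y ∈ U → y ∈ Y := by
  obtain ⟨U, hU, hYU⟩ := hY.residualEq_isOpen
  have hS : {x | x ∈ Y ↔ x ∈ U} ∈ residual K := by
    filter_upwards [hYU] with x hx
    exact iff_of_eq hx
  have hS' := residual_saturate f hf E hE hEf hA hS
  obtain ⟨b, bc, hbe, hb⟩ := exists_countable_basis K
  have hD : (⋂ w ∈ b, {x | ∃ i, f i x ∈ w}) ∈ residual K := by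
    refine (countable_bInter_mem bc).2 fun w hw => ?_
    refine residual_of_dense_open ?_ ?_
    · have : {x | ∃ i, f i x ∈ w} = ⋃ i, f i ⁻¹' w := by ext x; simp
      rw [this]
      exact isOpen_iUnion fun i => (hb.isOpen hw).preimage (hf i)
    · refine hd.mono ?_
      intro y hy
      obtain ⟨z, hz, hzE⟩ := dense_iff_inter_open.1 hd w (hb.isOpen hw)
        (nonempty_iff_ne_empty.2 fun h => hbe (h ▸ hw))
      obtain ⟨i, rfl⟩ := (hEf y z).1 (hE.trans (hE.symm hy) hzE)
      exact ⟨i, hz⟩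
  obtain ⟨x, hx1, hx2⟩ := (dense_of_mem_residual (inter_mem hS' hD)).nonempty
  refine ⟨U, hU, ?_, x, ?_, fun y hy hyU => (hx1 y hy).2 hyU⟩
  · obtain ⟨y, hy, hxy⟩ := hYc x
    exact ⟨y, (hx1 y hxy).1 hy⟩
  · rw [dense_iff_inter_open]
    rintro W hW ⟨z, hz⟩
    obtain ⟨w, hw, hzw, hwW⟩ := hb.exists_subset_of_mem_open hz hW
    simp only [mem_iInter] at hx2
    obtain ⟨i, hi⟩ := hx2 w hw
    exact ⟨f i x, hwW hi, (hEf _ _).2 ⟨i, rfl⟩⟩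

/-- If every class has an isolated point, then there is a Borel selector. -/
theorem smooth_of_isolated {X : Type*} [TopologicalSpace X] [PolishSpace X] [MeasurableSpace X]
    [BorelSpace X]
    (f : ℕ → X → X) (hf : ∀ i, Measurable (f i)) (E : X → X → Prop) (hE : Equivalence E)
    (hEf : ∀ x y, E x y ↔ ∃ i, f i x = y)
    (hiso : ∀ x, ∃ y, E x y ∧ ∃ U, IsOpen U ∧ y ∈ U ∧ ∀ z ∈ U, E x z → z = y) :
    IsSmooth E := by
  obtain ⟨b, bc, hbe, hb⟩ := exists_countable_basis X
  obtain ⟨V, hV⟩ := (bc.insert ∅).exists_eq_range (insert_nonempty _ _)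
  have hVm : ∀ j, MeasurableSet (V j) := by
    intro j
    have : V j ∈ insert ∅ b := hV ▸ mem_range_self j
    rcases this with h | h
    · rw [h]; exact MeasurableSet.empty
    · exact (hb.isOpen h).measurableSet
  have hex : ∀ x, ∃ j, ∃ i, f i x ∈ V j ∧ ∀ i', f i' x ∈ V j → f i' x = f i x := by
    intro x
    obtain ⟨y, hxy, U, hU, hyU, hz⟩ := hiso x
    obtain ⟨w, hw, hyw, hwU⟩ := hb.exists_subset_of_mem_open hyU hU
    have : w ∈ range V := hV ▸ mem_insert_of_mem _ hw
    obtain ⟨j, rfl⟩ := this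
    obtain ⟨i, rfl⟩ := (hEf x y).1 hxy
    exact ⟨j, i, hyw, fun i' hi' => hz _ (hwU hi') ((hEf _ _).2 ⟨i', rfl⟩)⟩
  let Q : ℕ → X → X → Prop := fun j x y => E x y ∧ y ∈ V j ∧ ∀ z, E x z → z ∈ V j → z = y
  let D : ℕ → Set X := fun j => {x | ∃ y, Q j x y}
  have hQ : ∀ x, ∃ j, x ∈ D j := by
    intro x
    obtain ⟨j, i, h1, h2⟩ := hex x
    refine ⟨j, f i x, (hEf _ _).2 ⟨i, rfl⟩, h1, ?_⟩
    intro z hz hzV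
    obtain ⟨i', rfl⟩ := (hEf x z).1 hz
    exact h2 i' hzV
  have hDI : ∀ j, D j = ⋃ i, {x | f i x ∈ V j ∧ ∀ i', f i' x ∈ V j → f i' x = f i x} := by
    intro j
    ext x
    simp only [D, Q, mem_ofPred_eq, mem_iUnion]
    constructor
    · rintro ⟨y, h1, h2, h3⟩
      obtain ⟨i, rfl⟩ := (hEf x y).1 h1
      exact ⟨i, h2, fun i' hi' => h3 _ ((hEf _ _).2 ⟨i', rfl⟩) hi'⟩
    · rintro ⟨i, h1, h2⟩
      refine ⟨f i x, (hEf _ _).2 ⟨i, rfl⟩, h1, ?_⟩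
      intro z hz hzV
      obtain ⟨i', rfl⟩ := (hEf x z).1 hz
      exact h2 i' hzV
  have hDm : ∀ j, MeasurableSet (D j) := by
    intro j
    rw [hDI]
    refine MeasurableSet.iUnion fun i => ?_
    have : {x | f i x ∈ V j ∧ ∀ i', f i' x ∈ V j → f i' x = f i x} =
        f i ⁻¹' V j ∩ ⋂ i', ((f i' ⁻¹' V j)ᶜ ∪ {x | f i' x = f i x}) := by
      ext x
      simp only [mem_ofPred_eq, mem_inter_iff, mem_preimage, mem_iInter, mem_union, mem_compl_iff,
        imp_iff_not_or]
    rw [this]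
    exact (hf i (hVm j)).inter (MeasurableSet.iInter fun i' =>
      (hf i' (hVm j)).compl.union (measurableSet_eq_fun (hf i') (hf i)))
  let J : X → ℕ := fun x => Nat.find (hQ x)
  have hJ : ∀ x, ∃ y, Q (J x) x y := fun x => Nat.find_spec (hQ x)
  choose s hs using hJ
  have hQinv : ∀ {x x'}, E x x' → ∀ j y, Q j x y → Q j x' y := by
    rintro x x' h j y ⟨h1, h2, h3⟩
    exact ⟨hE.trans (hE.symm h) h1, h2, fun z hz => h3 z (hE.trans h hz)⟩
  have hDinv : ∀ {x x'}, E x x' → ∀ j, x ∈ D j → x' ∈ D j := by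
    rintro x x' h j ⟨y, hy⟩
    exact ⟨y, hQinv h j y hy⟩
  have hJinv : ∀ {x x'}, E x x' → J x = J x' := by
    intro x x' h
    refine le_antisymm ?_ ?_
    · exact Nat.find_min' _ (hDinv (hE.symm h) _ (Nat.find_spec (hQ x')))
    · exact Nat.find_min' _ (hDinv h _ (Nat.find_spec (hQ x)))
  have hsE : ∀ x x', E x x' ↔ s x = s x' := by
    intro x x'
    constructor
    · intro h
      have h1 := hQinv h _ _ (hs x)
      rw [hJinv h] at h1
      exact (hs x').2.2 _ h1.1 h1.2.1
    · intro h
      have h1 := (hs x).1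
      rw [h] at h1
      exact hE.trans h1 (hE.symm (hs x').1)
  have hJm : Measurable J := measurable_find hQ hDm
  have hsm : Measurable s := by
    intro S hS
    have : s ⁻¹' S = ⋃ j, (J ⁻¹' {j} ∩ ⋃ i, f i ⁻¹' (V j ∩ S)) := by
      ext x
      simp only [mem_preimage, mem_iUnion, mem_inter_iff, mem_singleton_iff]
      constructor
      · intro h
        obtain ⟨i, hi⟩ := (hEf _ _).1 (hs x).1
        exact ⟨J x, rfl, i, hi ▸ (hs x).2.1, hi ▸ h⟩
      · rintro ⟨_, rfl, i, h1, h2⟩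
        rwa [← (hs x).2.2 _ ((hEf _ _).2 ⟨i, rfl⟩) h1]
    rw [this]
    exact MeasurableSet.iUnion fun j => (hJm (measurableSet_singleton j)).inter
      (MeasurableSet.iUnion fun i => hf i ((hVm j).inter hS))
  obtain ⟨e, he⟩ := exists_measurableEmbedding_real X
  refine ⟨ℝ, inferInstance, inferInstance, e ∘ s, he.measurable.comp hsm, ?_⟩
  intro x y
  rw [hsE, Function.comp, Function.comp, he.injective.eq_iff]


lemma continuous_ediam_range {X : Type*} [MetricSpace X] (n : ℕ) :
    Continuous fun v : Fin n → X => Metric.ediam (range v) := by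
  have : (fun v : Fin n → X => Metric.ediam (range v)) =
      fun v => Finset.univ.sup fun i : Fin n => Finset.univ.sup fun j : Fin n =>
        edist (v i) (v j) := by
    funext v
    simp only [Metric.ediam, iSup_range, Finset.sup_univ_eq_iSup]
  rw [this]
  refine Continuous.finset_sup_apply fun i _ => Continuous.finset_sup_apply fun j _ => ?_
  exact (continuous_apply i).edist (continuous_apply j)

/-- The dyadic scale. -/
def dyad (k : ℕ) : ENNReal := (2⁻¹ : ENNReal) ^ k

lemma dyad_lt {a b : ℕ} (h : a < b) : dyad b < dyad a := by
  unfold dyad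
  rw [← ENNReal.inv_pow, ← ENNReal.inv_pow, ENNReal.inv_lt_inv]
  exact_mod_cast Nat.pow_lt_pow_right one_lt_two h

lemma dyad_le {a b : ℕ} (h : a ≤ b) : dyad b ≤ dyad a := by
  rcases h.eq_or_lt with rfl | h
  · exact le_rfl
  · exact (dyad_lt h).le

lemma exists_dyad {d : ENNReal} (hd : 0 < d) {N : ℕ} (hN : d < dyad N) :
    ∃ k, N ≤ k ∧ d ∈ Ioo (dyad (k + 2)) (dyad k) := by
  have hex : ∃ m, dyad m ≤ d := by
    obtain ⟨m, hm⟩ := ENNReal.exists_inv_two_pow_lt hd.ne'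
    exact ⟨m, hm.le⟩
  have h1 := Nat.find_spec hex
  have h2 : N < Nat.find hex := by
    by_contra h
    exact absurd (lt_of_le_of_lt h1 hN) (not_lt.2 (dyad_le (not_lt.1 h)))
  obtain ⟨k, hk⟩ : ∃ k, Nat.find hex = k + 1 := ⟨Nat.find hex - 1, by omega⟩
  rw [hk] at h1
  refine ⟨k, by omega, (dyad_lt (by omega)).trans_le h1, ?_⟩
  exact not_le.1 (Nat.find_min hex (by omega))

lemma tuple_small {X : Type*} [MetricSpace X] (K : Set X)
    (hK : ∀ y ∈ K, ∀ U, IsOpen U → y ∈ U → (K ∩ U).Infinite) {n : ℕ} (hn : 1 < n)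
    {U : Set X} (hU : IsOpen U) (hne : (K ∩ U).Nonempty) :
    ∃ᶠ k in atTop, ∃ v : Fin n → X, Function.Injective v ∧ (∀ i, v i ∈ K ∩ U) ∧
      Metric.ediam (range v) ∈ Ioo (dyad (k + 2)) (dyad k) := by
  rw [frequently_atTop]
  intro N
  obtain ⟨y, hyK, hyU⟩ := hne
  have hpos : 0 < dyad (N + 2) := ENNReal.pow_pos (by simp) _
  have hinf := hK y hyK (U ∩ Metric.eball y (dyad (N + 2)))
    (hU.inter Metric.isOpen_eball) ⟨hyU, Metric.mem_eball_self hpos⟩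
  let g := hinf.natEmbedding
  let v : Fin n → X := fun i => (g i.1).1
  have hv : ∀ i, v i ∈ K ∩ (U ∩ Metric.eball y (dyad (N + 2))) := fun i => (g i.1).2
  have hvi : Function.Injective v := by
    intro i j h
    exact Fin.ext (g.injective (Subtype.ext h))
  have h1 : 0 < Metric.ediam (range v) := by
    rw [Metric.ediam_pos_iff]
    refine ⟨v ⟨0, by omega⟩, mem_range_self _, v ⟨1, hn⟩, mem_range_self _, fun h => ?_⟩
    have := hvi h
    simp at this
  have h2 : Metric.ediam (range v) < dyad N := by
    calc Metric.ediam (range v) ≤ Metric.ediam (Metric.eball y (dyad (N + 2))) :=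
          Metric.ediam_mono (by rintro _ ⟨i, rfl⟩; exact (hv i).2.2)
      _ ≤ 2 * dyad (N + 2) := Metric.ediam_eball_le
      _ = dyad (N + 1) := by
          unfold dyad
          rw [pow_succ' _ (N + 1), ← mul_assoc, ENNReal.mul_inv_cancel (by simp) (by simp), one_mul]
      _ < dyad N := dyad_lt (by omega)
  obtain ⟨k, hk, hk2⟩ := exists_dyad h1 h2
  exact ⟨k, hk, v, hvi, fun i => ⟨(hv i).1, (hv i).2.1⟩, hk2⟩

lemma tuple_perturb {X : Type*} [MetricSpace X] {K D U : Set X} (hU : IsOpen U)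
    (hD : K ⊆ closure D) {n : ℕ} {a b : ENNReal} {v : Fin n → X} (hv : Function.Injective v)
    (hvU : ∀ i, v i ∈ K ∩ U) (hd : Metric.ediam (range v) ∈ Ioo a b) :
    ∃ A : Finset X, A.card = n ∧ ↑A ⊆ D ∩ U ∧ Metric.ediam (A : Set X) ∈ Ioo a b := by
  have ho : IsOpen ({w : Fin n → X | ∀ i j, i ≠ j → w i ≠ w j} ∩ ({w | ∀ i, w i ∈ U} ∩
      {w | Metric.ediam (range w) ∈ Ioo a b})) := by
    refine IsOpen.inter ?_ (IsOpen.inter ?_ (isOpen_Ioo.preimage (continuous_ediam_range n)))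
    · have : {w : Fin n → X | ∀ i j, i ≠ j → w i ≠ w j} =
          ⋂ i, ⋂ j, {w | i ≠ j → w i ≠ w j} := by ext w; simp
      rw [this]
      refine isOpen_iInter_of_finite fun i => isOpen_iInter_of_finite fun j => ?_
      by_cases h : i = j
      · simp [h]
      · simp only [ne_eq, h, not_false_eq_true, forall_true_left]
        exact isOpen_ne_fun (continuous_apply i) (continuous_apply j)
    · have : {w : Fin n → X | ∀ i, w i ∈ U} = ⋂ i, (fun w => w i) ⁻¹' U := by ext w; simp
      rw [this]
      exact isOpen_iInter_of_finite fun i => hU.preimage (continuous_apply i)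
  have hcl : v ∈ closure (Set.pi univ fun _ : Fin n => D) := by
    rw [closure_pi_set]
    exact fun i _ => hD (hvU i).1
  obtain ⟨w, ⟨hw1, hw2, hw3⟩, hwD⟩ := mem_closure_iff.1 hcl _ ho
    ⟨fun i j h => hv.ne h, fun i => (hvU i).2, hd⟩
  have hwi : Function.Injective w := fun i j h => by
    by_contra hij
    exact hw1 i j hij h
  refine ⟨Finset.univ.image w, ?_, ?_, ?_⟩
  · rw [Finset.card_image_of_injective _ hwi]; simp
  · intro x hx
    simp only [Finset.coe_image, Finset.coe_univ, image_univ] at hx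
    obtain ⟨i, rfl⟩ := hx
    exact ⟨hwD i (mem_univ i), hw2 i⟩
  · have h3 : Metric.ediam (range w) ∈ Ioo a b := hw3
    simpa only [Finset.coe_image, Finset.coe_univ, image_univ] using h3

theorem exists_coloring {X : Type*} [MetricSpace X] [SecondCountableTopology X]
    [MeasurableSpace X] [BorelSpace X] (K : Set X)
    (hK : ∀ y ∈ K, ∀ U, IsOpen U → y ∈ U → (K ∩ U).Infinite) {n k : ℕ} (hn : 1 < n) (hk : 1 < k) :
    ∃ c : Finset X → Fin k, IsBorelColoring n c ∧ ∀ U, IsOpen U → (K ∩ U).Nonempty →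
      ∀ D, K ⊆ closure D → ∃ A B : Finset X, A.card = n ∧ B.card = n ∧ ↑A ⊆ D ∩ U ∧ ↑B ⊆ D ∩ U ∧
        c A ≠ c B := by
  obtain ⟨b, bc, hbe, hb⟩ := exists_countable_basis X
  obtain ⟨V, hV⟩ := (bc.insert ∅).exists_eq_range (insert_nonempty _ _)
  have hVo : ∀ j, IsOpen (V j) := by
    intro j
    have : V j ∈ insert ∅ b := hV ▸ mem_range_self j
    rcases this with h | h
    · rw [h]; exact isOpen_empty
    · exact hb.isOpen h
  let P : ℕ → ℕ → Prop := fun j k => (K ∩ V (j / 4)).Nonempty → ∃ v : Fin n → X,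
    Function.Injective v ∧ (∀ i, v i ∈ K ∩ V (j / 4)) ∧
      Metric.ediam (range v) ∈ Ioo (dyad (k + 2)) (dyad k)
  have hP : ∀ j, ∃ᶠ k in atTop, P j k := by
    intro j
    by_cases h : (K ∩ V (j / 4)).Nonempty
    · exact (tuple_small K hK hn (hVo _) h).mono fun k hk _ => hk
    · exact Frequently.of_forall fun k h' => absurd h' h
  obtain ⟨φ, hφ, hφP⟩ := extraction_forall_of_frequently hP
  let I : ℕ → Set ENNReal := fun m => Ioo (dyad (φ (2 * m) + 2)) (dyad (φ (2 * m)))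
  have hI' : ∀ m m', m < m' → ∀ d, d ∈ I m → d ∈ I m' → False := by
    intro m m' h d h1 h2
    have ha : φ (2 * m) < φ (2 * m + 1) := hφ (by omega)
    have hb : φ (2 * m + 1) < φ (2 * m') := hφ (by omega)
    exact absurd (h2.2.trans_le (dyad_le (by omega))) (not_lt.2 h1.1.le)
  have hI : ∀ m m' d, d ∈ I m → d ∈ I m' → m = m' := by
    intro m m' d h1 h2
    rcases lt_trichotomy m m' with h | h | h
    · exact (hI' _ _ h d h1 h2).elim
    · exact h
    · exact (hI' _ _ h d h2 h1).elim
  let R : Set ENNReal := ⋃ j, I (2 * j)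
  have hR : IsOpen R := isOpen_iUnion fun j => isOpen_Ioo
  let c : Finset X → Fin k := fun A =>
    if Metric.ediam (A : Set X) ∈ R then ⟨1, hk⟩ else ⟨0, by omega⟩
  refine ⟨c, ?_, ?_⟩
  · unfold IsBorelColoring
    simp only [c, Set.Finite.coe_toFinset]
    exact Measurable.ite ((continuous_ediam_range n).measurable hR.measurableSet)
      measurable_const measurable_const
  · rintro U hU ⟨y, hyK, hyU⟩ D hD
    obtain ⟨w, hw, hyw, hwU⟩ := hb.exists_subset_of_mem_open hyU hU
    have : w ∈ range V := hV ▸ mem_insert_of_mem _ hw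
    obtain ⟨j, rfl⟩ := this
    have get : ∀ m, m / 2 = j → ∃ A : Finset X, A.card = n ∧ ↑A ⊆ D ∩ U ∧
        Metric.ediam (A : Set X) ∈ I m := by
      intro m hm
      have hm' : 2 * m / 4 = j := by omega
      have := hφP (2 * m)
      simp only [P, hm'] at this
      obtain ⟨v, h1, h2, h3⟩ := this ⟨y, hyK, hyw⟩
      obtain ⟨A, hA1, hA2, hA3⟩ := tuple_perturb (hVo j) hD h1 h2 h3
      exact ⟨A, hA1, hA2.trans (inter_subset_inter_right _ hwU), hA3⟩
    obtain ⟨A, hA1, hA2, hA3⟩ := get (2 * j) (by omega)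
    obtain ⟨B, hB1, hB2, hB3⟩ := get (2 * j + 1) (by omega)
    refine ⟨A, B, hA1, hB1, hA2, hB2, ?_⟩
    have hAR : Metric.ediam (A : Set X) ∈ R := mem_iUnion.2 ⟨j, hA3⟩
    have hBR : Metric.ediam (B : Set X) ∉ R := by
      intro h
      obtain ⟨j', hj'⟩ := mem_iUnion.1 h
      have := hI _ _ _ hB3 hj'
      omega
    simp only [c, if_pos hAR, if_neg hBR]
    simp

theorem ramsey_smooth_core {X : Type*} [mX : MeasurableSpace X] [StandardBorelSpace X]
    (E : X → X → Prop) (hE : Equivalence E)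
    (hEBorel : MeasurableSet {p : X × X | E p.1 p.2})
    (hcount : ∀ x : X, {y | E x y}.Countable)
    {n k : ℕ} (hn : 1 < n) (hk : 1 < k) (hR : StrongBorelRamsey E n k) :
    IsSmooth E := by
  obtain ⟨f, hf, hEf⟩ := ln_functions E hE hEBorel hcount
  obtain ⟨t, ht, hbo, hfc, hfo⟩ := topo_refine f hf
    (fun m => {x | f m.unpair.2 (f m.unpair.1 x) = x})
    (fun m => measurableSet_eq_fun ((hf _).comp (hf _)) measurable_id)
  have hA : ∀ i j, IsOpen {x | f j (f i x) = x} := by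
    intro i j
    have := hfo (Nat.pair i j)
    simpa only [Nat.unpair_pair] using this
  haveI : BorelSpace X := ⟨hbo⟩
  by_cases hiso : ∀ x, ∃ y, E x y ∧ ∃ U, IsOpen U ∧ y ∈ U ∧ ∀ z ∈ U, E x z → z = y
  · exact smooth_of_isolated f hf E hE hEf hiso
  exfalso
  push Not at hiso
  obtain ⟨x0, hx0⟩ := hiso
  letI := upgradeIsCompletelyMetrizable X
  let K : Set X := closure {y | E x0 y}
  have hx0K : x0 ∈ K := subset_closure (hE.refl x0)
  have hKf : ∀ i, ∀ x ∈ K, f i x ∈ K := by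
    intro i x hx
    refine map_mem_closure (hfc i) hx ?_
    intro y hy
    exact hE.trans hy ((hEf _ _).2 ⟨i, rfl⟩)
  have hKE : ∀ x ∈ K, ∀ y, E x y → y ∈ K := by
    intro x hx y hxy
    obtain ⟨i, rfl⟩ := (hEf _ _).1 hxy
    exact hKf i x hx
  have hKp : ∀ y ∈ K, ∀ U, IsOpen U → y ∈ U → (K ∩ U).Infinite := by
    intro y hy U hU hyU hfin
    obtain ⟨z, hzU, hz⟩ := mem_closure_iff.1 hy U hU hyU
    have hO : IsOpen (U \ ((K ∩ U) \ {z})) := hU.sdiff (hfin.sdiff).isClosed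
    obtain ⟨w, hw, hxw, hwz⟩ := hx0 z hz _ hO ⟨hzU, fun h => h.2 rfl⟩
    exact hw.2 ⟨⟨subset_closure hxw, hw.1⟩, hwz⟩
  obtain ⟨c, hc, hcol⟩ := exists_coloring K hKp hn hk
  obtain ⟨Y, hY, hYi, hYm⟩ := hR c hc
  have hKc : IsClosed K := isClosed_closure
  haveI : PolishSpace K := hKc.polishSpace
  haveI : Nonempty K := ⟨⟨x0, hx0K⟩⟩
  obtain ⟨U, hU, hUne, x, hxd, hxY⟩ := baire_core (K := K)
    (fun i x => ⟨f i x.1, hKf i x.1 x.2⟩)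
    (fun i => ((hfc i).comp continuous_subtype_val).subtype_mk _)
    (fun x y => E x.1 y.1)
    ⟨fun x => hE.refl _, fun h => hE.symm h, fun h h' => hE.trans h h'⟩
    (fun x y => by simp only [hEf, Subtype.ext_iff])
    (fun i j => by
      have := (hA i j).preimage (continuous_subtype_val (p := fun x => x ∈ K))
      simp only [Subtype.ext_iff]
      exact this)
    ⟨x0, hx0K⟩
    (by
      intro z
      rw [closure_subtype]
      refine closure_mono ?_ z.2
      intro y hy
      exact ⟨⟨y, subset_closure hy⟩, hy, rfl⟩)
    (Subtype.val ⁻¹' Y) (measurable_subtype_coe hY)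
    (by
      rintro ⟨x, hx⟩
      obtain ⟨y, hy, hxy⟩ := (hYi x).nonempty
      exact ⟨⟨y, hKE x hx y hxy⟩, hy, hxy⟩)
  obtain ⟨U', hU', rfl⟩ := isOpen_induced_iff.1 hU
  obtain ⟨u, hu⟩ := hUne
  have hD : K ⊆ closure {y | E x.1 y} := by
    intro z hz
    have := hxd ⟨z, hz⟩
    rw [closure_subtype] at this
    refine closure_mono ?_ this
    rintro _ ⟨y, hy, rfl⟩
    exact hy
  obtain ⟨A, B, hA1, hB1, hA2, hB2, hne⟩ := hcol U' hU' ⟨u.1, u.2, hu⟩ _ hD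
  obtain ⟨a, ha⟩ := hYm x.1
  have sub : ∀ S : Finset X, ↑S ⊆ {y | E x.1 y} ∩ U' → (S : Set X) ⊆ Y := by
    intro S hS y hy
    have h := hS hy
    exact hxY ⟨y, hKE x.1 x.2 y h.1⟩ h.1 h.2
  refine hne ?_
  rw [ha A hA1 (sub A hA2) (fun y hy => (hA2 hy).1), ha B hB1 (sub B hB2) (fun y hy => (hB2 hy).1)]


end RamseyHelpers

/-- If the strong Borel Ramsey property `E →_B (E)^n_k` holds for some integers
`n, k > 1`, then `E` is smooth. -/
theorem smooth_of_strong_borel_ramsey {X : Type*} [MeasurableSpace X] [StandardBorelSpace X]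
    (E : X → X → Prop) (hE : Equivalence E)
    (hEBorel : MeasurableSet {p : X × X | E p.1 p.2})
    (hcount : ∀ x : X, {y | E x y}.Countable)
    (haper : ∀ x : X, {y | E x y}.Infinite)
    (hex : ∃ n k : ℕ, 1 < n ∧ 1 < k ∧ StrongBorelRamsey E n k) :
    IsSmooth E := by
  obtain ⟨n, k, hn, hk, hR⟩ := hex
  exact ramsey_smooth_core E hE hEBorel hcount hn hk hR
end
end

section
/- Let X be a standard Borel space and let E be an aperiodic, countable Borel equivalence relation on X. The following are equivalent: (i) the strong Borel Ramsey property E →_B (E)^n_k holds for some integers n, k > 1; (ii) E →_B (E)^n_k holds for all integers n, k > 1; (iii) the weak Borel Ramsey property E →*_B (E)^n_k holds for some integers n, k > 1; (iv) E →*_B (E)^n_k holds for all integers n, k > 1; (v) E is smooth. -/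
open Classical

noncomputable section

namespace BR
open MeasureTheory Set

/-- `A` is covered by countably many Borel sets on which `f` is injective. -/
def Sig {X Y : Type*} [MeasurableSpace X] (f : X → Y) (A : Set X) : Prop :=
  ∃ C : ℕ → Set X, (∀ i, MeasurableSet (C i) ∧ InjOn f (C i)) ∧ A ⊆ ⋃ i, C i

theorem Sig.mono {X Y : Type*} [MeasurableSpace X] {f : X → Y} {A B : Set X}
    (h : Sig f B) (hAB : A ⊆ B) : Sig f A := by
  obtain ⟨C, hC, hB⟩ := h
  exact ⟨C, hC, hAB.trans hB⟩

theorem Sig.iUnion {X Y ι : Type*} [Countable ι] [MeasurableSpace X] {f : X → Y} {A : ι → Set X}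
    (h : ∀ i, Sig f (A i)) : Sig f (⋃ i, A i) := by
  choose C hC hA using h
  rcases isEmpty_or_nonempty ι with hι | hι
  · exact ⟨fun _ => ∅, fun _ => ⟨MeasurableSet.empty, by simp⟩, by simp⟩
  obtain ⟨e, he⟩ := exists_surjective_nat (ι × ℕ)
  refine ⟨fun n => C (e n).1 (e n).2, fun n => hC _ _, ?_⟩
  intro x hx
  obtain ⟨i, hi⟩ := mem_iUnion.1 hx
  obtain ⟨j, hj⟩ := mem_iUnion.1 (hA i hi)
  obtain ⟨n, hn⟩ := he (i, j)
  exact mem_iUnion.2 ⟨n, by rw [hn]; exact hj⟩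

theorem Sig.of_injOn {X Y : Type*} [MeasurableSpace X] {f : X → Y} {A : Set X}
    (h : MeasurableSet A) (h' : InjOn f A) : Sig f A :=
  ⟨fun _ => A, fun _ => ⟨h, h'⟩, fun _ hx => mem_iUnion.2 ⟨0, hx⟩⟩

theorem Sig.union {X Y : Type*} [MeasurableSpace X] {f : X → Y} {A B : Set X}
    (hA : Sig f A) (hB : Sig f B) : Sig f (A ∪ B) := by
  rw [union_eq_iUnion]
  exact Sig.iUnion (fun b => by cases b <;> assumption)

theorem Sig.hull {X Y : Type*} [MeasurableSpace X] {f : X → Y} {A : Set X}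
    (h : Sig f A) : ∃ B, MeasurableSet B ∧ A ⊆ B ∧ Sig f B := by
  obtain ⟨C, hC, hA⟩ := h
  exact ⟨⋃ i, C i, MeasurableSet.iUnion fun i => (hC i).1, hA, C, hC, Subset.rfl⟩

/-- Smallness of a finite family of sets. -/
def Small {X Y : Type*} [MeasurableSpace X] [MeasurableSpace Y] (f : X → Y)
    (S : Set (Set X)) : Prop :=
  ∃ B : Set X → Set Y, (∀ u ∈ S, MeasurableSet (B u) ∧ Sig f (u ∩ f ⁻¹' (B u))) ∧
    (⋂ u ∈ S, f '' u) ⊆ ⋃ u ∈ S, B u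

theorem Small.mono {X Y : Type*} [MeasurableSpace X] [MeasurableSpace Y] {f : X → Y}
    {S T : Set (Set X)} (h : Small f S) (hST : S ⊆ T) : Small f T := by
  obtain ⟨B, hB, hK⟩ := h
  refine ⟨fun u => if u ∈ S then B u else ∅, fun u _ => ?_, ?_⟩
  · by_cases hu : u ∈ S
    · simpa [hu] using hB u hu
    · simp only [hu, if_false, preimage_empty, inter_empty]
      exact ⟨MeasurableSet.empty, Sig.of_injOn MeasurableSet.empty (by simp)⟩
  · intro y hy
    have : y ∈ ⋂ u ∈ S, f '' u := by
      simp only [mem_iInter] at hy ⊢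
      exact fun u hu => hy u (hST hu)
    obtain ⟨u, hu, hyu⟩ := mem_iUnion₂.1 (hK this)
    exact mem_iUnion₂.2 ⟨u, hST hu, by simpa [hu] using hyu⟩

theorem split {X Y : Type*} [MeasurableSpace X] [StandardBorelSpace X]
    [TopologicalSpace Y] [PolishSpace Y] [MeasurableSpace Y] [BorelSpace Y]
    {f : X → Y} (hf : Measurable f) (S : Set (Set X)) (hS : S.Countable)
    (hSm : ∀ u ∈ S, MeasurableSet u) (u : Set X) (hu : u ∈ S)
    (V : Set (Set X × Set X)) (hV : V.Countable)
    (hVm : ∀ p ∈ V, MeasurableSet p.1 ∧ MeasurableSet p.2)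
    (hsep : ∀ x ∈ u, ∀ x' ∈ u, x ≠ x' → ∃ p ∈ V, x ∈ p.1 ∧ x' ∈ p.2)
    (hlarge : ¬ Small f S) : ∃ p ∈ V, ¬ Small f (S ∪ {p.1, p.2}) := by
  by_contra hcon
  push Not at hcon
  apply hlarge
  have hcon' : ∀ p : V, Small f (S ∪ {p.1.1, p.1.2}) := fun p => hcon p.1 p.2
  choose B hB hK using hcon'
  have : Countable V := hV
  have : Countable S := hS
  set K : Set Y := ⋂ s : S, f '' s.1 with hKdef
  have hKan : AnalyticSet K := by
    have : Nonempty S := ⟨⟨u, hu⟩⟩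
    exact AnalyticSet.iInter fun s => (hSm _ s.2).analyticSet_image hf
  set D : Set Y := ⋃ (p : V), ⋃ j : {j : S // j.1 ≠ u}, B p j.1.1 with hD
  have hDm : MeasurableSet D := MeasurableSet.iUnion fun p => MeasurableSet.iUnion fun j =>
    (hB p _ (Or.inl j.1.2)).1
  set N0 : Set X := ⋃ p : V, ((p.1.1 ∩ f ⁻¹' (B p p.1.1)) ∪ (p.1.2 ∩ f ⁻¹' (B p p.1.2))) ∪
    (u ∩ f ⁻¹' (B p u)) with hN0
  have hN0s : Sig f N0 := Sig.iUnion fun p =>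
    ((hB p _ (by simp)).2.union (hB p _ (by simp)).2).union (hB p _ (Or.inl hu)).2
  obtain ⟨N, hNm, hN0N, hNs⟩ := hN0s.hull
  -- the analytic sets to separate
  have hK' : AnalyticSet (K ∩ Dᶜ) := by
    rw [inter_eq_iInter]
    refine AnalyticSet.iInter fun b => ?_
    cases b
    · exact hDm.compl.analyticSet
    · exact hKan
  have hA : ∀ v : Set X, MeasurableSet v → AnalyticSet (K ∩ Dᶜ ∩ f '' ((u ∩ v) \ N)) := by
    intro v hv
    rw [inter_eq_iInter]
    refine AnalyticSet.iInter fun b => ?_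
    cases b
    · exact (((hSm u hu).inter hv).diff hNm).analyticSet_image hf
    · exact hK'
  have hdisj : ∀ p : V, ∀ x ∈ u \ N, ∀ x' ∈ u \ N, x ∈ p.1.1 → x' ∈ p.1.2 → f x = f x' →
      f x ∈ K ∩ Dᶜ → False := by
    intro p x hx x' hx' hxp hxp' hff hfK
    have h1 : f x ∈ ⋂ s ∈ S ∪ {p.1.1, p.1.2}, f '' s := by
      simp only [mem_iInter]
      rintro s (hs | rfl | rfl)
      · exact mem_iInter.1 hfK.1 ⟨s, hs⟩
      · exact ⟨x, hxp, rfl⟩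
      · exact ⟨x', hxp', hff.symm⟩
    obtain ⟨j, hj, hxj⟩ := mem_iUnion₂.1 (hK p h1)
    have key : ∀ z ∈ ((p.1.1 ∩ f ⁻¹' (B p p.1.1)) ∪ (p.1.2 ∩ f ⁻¹' (B p p.1.2))) ∪
      (u ∩ f ⁻¹' (B p u)), z ∈ N := fun z hz => hN0N (mem_iUnion.2 ⟨p, hz⟩)
    rcases hj with hj | rfl | rfl
    · by_cases hju : j = u
      · subst hju
        exact hx.2 (key x (Or.inr ⟨hx.1, hxj⟩))
      · exact hfK.2 (mem_iUnion.2 ⟨p, mem_iUnion.2 ⟨⟨⟨j, hj⟩, hju⟩, hxj⟩⟩)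
    · exact hx.2 (key x (Or.inl (Or.inl ⟨hxp, hxj⟩)))
    · exact hx'.2 (key x' (Or.inl (Or.inr ⟨hxp', by rw [mem_preimage, ← hff]; exact hxj⟩)))
  have hsepB : ∀ p : V, MeasurablySeparable (K ∩ Dᶜ ∩ f '' ((u ∩ p.1.1) \ N))
      (K ∩ Dᶜ ∩ f '' ((u ∩ p.1.2) \ N)) := by
    intro p
    refine (hA _ (hVm _ p.2).1).measurablySeparable (hA _ (hVm _ p.2).2) ?_
    rw [Set.disjoint_left]
    rintro y ⟨hy, x, hx, rfl⟩ ⟨-, x', hx', h⟩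
    exact hdisj p x ⟨hx.1.1, hx.2⟩ x' ⟨hx'.1.1, hx'.2⟩ hx.1.2 hx'.1.2 h.symm hy
  choose C hC1 hC2 hCm using hsepB
  set H : Set X := u ∩ ⋂ p : V, ((p.1.1ᶜ ∪ f ⁻¹' (C p)) ∩ (p.1.2ᶜ ∪ f ⁻¹' (C p)ᶜ)) with hH
  have hHm : MeasurableSet H := (hSm u hu).inter (MeasurableSet.iInter fun p =>
    ((hVm _ p.2).1.compl.union (hf (hCm p))).inter ((hVm _ p.2).2.compl.union (hf (hCm p).compl)))
  have hHinj : InjOn f H := by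
    intro x hx x' hx' hxx
    by_contra hne
    obtain ⟨p, hp, h1, h2⟩ := hsep x hx.1 x' hx'.1 hne
    have a := (mem_iInter.1 hx.2 ⟨p, hp⟩).1
    have b := (mem_iInter.1 hx'.2 ⟨p, hp⟩).2
    rcases a with a | a
    · exact a h1
    rcases b with b | b
    · exact b h2
    · exact b (by rw [← hxx]; exact a)
  have hRs : Sig f (N ∪ H) := hNs.union (Sig.of_injOn hHm hHinj)
  have hfin : MeasurablySeparable (K ∩ Dᶜ) (f '' (u \ (N ∪ H))) := by
    refine hK'.measurablySeparable
      (((hSm u hu).diff (hNm.union hHm)).analyticSet_image hf) ?_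
    rw [Set.disjoint_left]
    rintro y hy ⟨x, ⟨hxu, hx⟩, rfl⟩
    apply hx
    by_cases hxN : x ∈ N
    · exact Or.inl hxN
    refine Or.inr ⟨hxu, mem_iInter.2 fun p => ⟨?_, ?_⟩⟩
    · by_cases hxp : x ∈ p.1.1
      · exact Or.inr (hC1 p ⟨hy, x, ⟨⟨hxu, hxp⟩, hxN⟩, rfl⟩)
      · exact Or.inl hxp
    · by_cases hxp : x ∈ p.1.2
      · exact Or.inr (Set.disjoint_left.1 (hC2 p) ⟨hy, x, ⟨⟨hxu, hxp⟩, hxN⟩, rfl⟩)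
      · exact Or.inl hxp
  obtain ⟨Bu, hBu1, hBu2, hBum⟩ := hfin
  refine ⟨fun j => if j = u then Bu else ⋃ p : V, B p j, fun j hj => ?_, ?_⟩
  · by_cases hju : j = u
    · subst hju
      simp only [if_true]
      refine ⟨hBum, hRs.mono ?_⟩
      rintro x ⟨hx, hxB⟩
      by_contra hxR
      exact Set.disjoint_left.1 hBu2 ⟨x, ⟨hx, hxR⟩, rfl⟩ hxB
    · simp only [hju, if_false, preimage_iUnion, inter_iUnion]
      exact ⟨MeasurableSet.iUnion fun p => (hB p j (Or.inl hj)).1,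
        Sig.iUnion fun p => (hB p j (Or.inl hj)).2⟩
  · intro y hy
    by_cases hyD : y ∈ D
    · obtain ⟨p, hp⟩ := mem_iUnion.1 hyD
      obtain ⟨j, hj⟩ := mem_iUnion.1 hp
      refine mem_iUnion₂.2 ⟨j.1.1, j.1.2, ?_⟩
      simp only [j.2, if_false]
      exact mem_iUnion.2 ⟨p, hj⟩
    · refine mem_iUnion₂.2 ⟨u, hu, ?_⟩
      simp only [if_true]
      refine hBu1 ⟨?_, hyD⟩
      rw [hKdef]
      simp only [mem_iInter] at hy ⊢
      exact fun s => hy s.1 s.2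

end BR

namespace BR
open MeasureTheory Set TopologicalSpace

/-- Splitting step with small sets. -/
theorem split_metric {X Y : Type*} [MetricSpace X] [CompleteSpace X] [SecondCountableTopology X]
    [MeasurableSpace X] [BorelSpace X]
    [TopologicalSpace Y] [PolishSpace Y] [MeasurableSpace Y] [BorelSpace Y]
    {f : X → Y} (hf : Measurable f) (S : Set (Set X)) (hS : S.Finite)
    (hSo : ∀ u ∈ S, IsOpen u) (u : Set X) (hu : u ∈ S) (ε : ℝ) (hε : 0 < ε)
    (hlarge : ¬ Small f S) : ∃ v w : Set X, IsOpen v ∧ IsOpen w ∧ Disjoint v w ∧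
      closure v ⊆ u ∧ closure w ⊆ u ∧ (∀ a ∈ v, ∀ b ∈ v, dist a b < ε) ∧
      (∀ a ∈ w, ∀ b ∈ w, dist a b < ε) ∧ ¬ Small f (S ∪ {v, w}) := by
  set V : Set (Set X × Set X) := {p | (p.1 ∈ countableBasis X ∧ p.2 ∈ countableBasis X) ∧
    Disjoint p.1 p.2 ∧
      closure p.1 ⊆ u ∧ closure p.2 ⊆ u ∧ (∀ a ∈ p.1, ∀ b ∈ p.1, dist a b < ε) ∧
      (∀ a ∈ p.2, ∀ b ∈ p.2, dist a b < ε)} with hVdef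
  have hV : V.Countable := ((countable_countableBasis X).prod (countable_countableBasis X)).mono
    fun p hp => Set.mem_prod.2 ⟨hp.1.1, hp.1.2⟩
  have hVo : ∀ p ∈ V, IsOpen p.1 ∧ IsOpen p.2 := fun p hp =>
    ⟨isOpen_of_mem_countableBasis hp.1.1, isOpen_of_mem_countableBasis hp.1.2⟩
  have hsep : ∀ x ∈ u, ∀ x' ∈ u, x ≠ x' → ∃ p ∈ V, x ∈ p.1 ∧ x' ∈ p.2 := by
    intro x hx x' hx' hne
    have hd : 0 < dist x x' := dist_pos.2 hne
    have key : ∀ z ∈ u, ∃ v ∈ countableBasis X, z ∈ v ∧ closure v ⊆ u ∧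
        v ⊆ Metric.ball z (min (ε / 2) (dist x x' / 2)) := by
      intro z hz
      obtain ⟨r, hr, hru⟩ := Metric.isOpen_iff.1 (hSo u hu) z hz
      obtain ⟨v, hv, hzv, hvs⟩ := (isBasis_countableBasis X).exists_subset_of_mem_open
        (Metric.mem_ball_self (x := z) (ε := min (r / 2) (min (ε / 2) (dist x x' / 2)))
          (by positivity)) Metric.isOpen_ball
      refine ⟨v, hv, hzv, ?_, hvs.trans (Metric.ball_subset_ball (min_le_right _ _))⟩
      calc closure v ⊆ closure (Metric.ball z (r / 2)) :=
            closure_mono (hvs.trans (Metric.ball_subset_ball (min_le_left _ _)))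
        _ ⊆ Metric.closedBall z (r / 2) := Metric.closure_ball_subset_closedBall
        _ ⊆ Metric.ball z r := Metric.closedBall_subset_ball (by linarith)
        _ ⊆ u := hru
    have small : ∀ (z : X) (v : Set X), v ⊆ Metric.ball z (min (ε / 2) (dist x x' / 2)) →
        ∀ a ∈ v, ∀ b ∈ v, dist a b < ε := by
      intro z v hv a ha b hb
      have h1 := Metric.mem_ball.1 (hv ha)
      have h2 := Metric.mem_ball'.1 (hv hb)
      have := dist_triangle a z b
      have := min_le_left (ε / 2) (dist x x' / 2)
      linarith
    obtain ⟨v, hv, hxv, hvu, hvb⟩ := key x hx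
    obtain ⟨w, hw, hxw, hwu, hwb⟩ := key x' hx'
    refine ⟨(v, w), ⟨⟨hv, hw⟩, ?_, hvu, hwu, small _ _ hvb, small _ _ hwb⟩, hxv, hxw⟩
    rw [Set.disjoint_left]
    intro a ha hb
    have h1 := Metric.mem_ball'.1 (hvb ha)
    have h2 := Metric.mem_ball.1 (hwb hb)
    have := dist_triangle x a x'
    have := min_le_right (ε / 2) (dist x x' / 2)
    linarith
  have hVm : ∀ p ∈ V, MeasurableSet p.1 ∧ MeasurableSet p.2 :=
    fun p hp => ⟨(hVo p hp).1.measurableSet, (hVo p hp).2.measurableSet⟩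
  obtain ⟨p, hp, hps⟩ := split hf S hS.countable (fun u hu => (hSo u hu).measurableSet) u hu V hV
    hVm hsep hlarge
  exact ⟨p.1, p.2, (hVo p hp).1, (hVo p hp).2, hp.2.1, hp.2.2.1, hp.2.2.2.1, hp.2.2.2.2.1,
      hp.2.2.2.2.2, hps⟩

/-- The relation `T` splits `u` at scale `ε`. -/
def Splits {X : Type*} [MetricSpace X] (T : Set (Set X)) (ε : ℝ) (u : Set X) : Prop :=
  ∃ v ∈ T, ∃ w ∈ T, Disjoint v w ∧ closure v ⊆ u ∧ closure w ⊆ u ∧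
    (∀ a ∈ v, ∀ b ∈ v, dist a b < ε) ∧ (∀ a ∈ w, ∀ b ∈ w, dist a b < ε)

theorem split_all {X Y : Type*} [MetricSpace X] [CompleteSpace X] [SecondCountableTopology X]
    [MeasurableSpace X] [BorelSpace X]
    [TopologicalSpace Y] [PolishSpace Y] [MeasurableSpace Y] [BorelSpace Y]
    {f : X → Y} (hf : Measurable f) (S : Set (Set X)) (hS : S.Finite)
    (hSo : ∀ u ∈ S, IsOpen u) (ε : ℝ) (hε : 0 < ε)
    (hlarge : ¬ Small f S) : ∃ T : Set (Set X), S ⊆ T ∧ T.Finite ∧ (∀ u ∈ T, IsOpen u) ∧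
      ¬ Small f T ∧ ∀ u ∈ S, Splits T ε u := by
  suffices H : ∀ R : Set (Set X), R.Finite → R ⊆ S → ∃ T : Set (Set X), S ⊆ T ∧ T.Finite ∧
      (∀ u ∈ T, IsOpen u) ∧ ¬ Small f T ∧ ∀ u ∈ R, Splits T ε u from H S hS Subset.rfl
  intro R hR
  induction R, hR using Set.Finite.induction_on with
  | empty => exact fun _ => ⟨S, Subset.rfl, hS, hSo, hlarge, by simp⟩
  | @insert a R _ _ ih =>
    intro hRS
    obtain ⟨T, hST, hT, hTo, hTl, hTs⟩ := ih ((subset_insert _ _).trans hRS)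
    obtain ⟨v, w, hv, hw, h1, h2, h3, h4, h5, h6⟩ :=
      split_metric hf T hT hTo a (hST (hRS (mem_insert _ _))) ε hε hTl
    refine ⟨T ∪ {v, w}, hST.trans subset_union_left, hT.union (by simp), ?_, h6, ?_⟩
    · rintro u (hu | rfl | rfl)
      exacts [hTo u hu, hv, hw]
    · rintro u (rfl | hu)
      · exact ⟨v, by simp, w, by simp, h1, h2, h3, h4, h5⟩
      · obtain ⟨v', hv', w', hw', h⟩ := hTs u hu
        exact ⟨v', Or.inl hv', w', Or.inl hw', h⟩

theorem sig_univ_metric {X Y : Type*} [MetricSpace X] [CompleteSpace X] [SecondCountableTopology X]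
    [MeasurableSpace X] [BorelSpace X]
    [TopologicalSpace Y] [PolishSpace Y] [MeasurableSpace Y] [BorelSpace Y]
    {f : X → Y} (hf : Continuous f) (hc : ∀ y, (f ⁻¹' {y}).Countable) : Sig f univ := by
  by_contra hX
  have h0 : ¬ Small f ({univ} : Set (Set X)) := by
    rintro ⟨B, hB, hK⟩
    apply hX
    refine (hB univ rfl).2.mono ?_
    intro x _
    refine ⟨trivial, ?_⟩
    have : f x ∈ ⋂ u ∈ ({univ} : Set (Set X)), f '' u := by simp
    simpa using hK this
  let St := {S : Set (Set X) // S.Finite ∧ (∀ u ∈ S, IsOpen u) ∧ ¬ Small f S}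
  have hstep : ∀ (n : ℕ) (S : St), ∃ T : St, S.1 ⊆ T.1 ∧ ∀ u ∈ S.1, Splits T.1 ((1/2 : ℝ)^n) u := by
    intro n S
    obtain ⟨T, h1, h2, h3, h4, h5⟩ := split_all hf.measurable S.1 S.2.1 S.2.2.1 ((1/2 : ℝ)^n)
      (by positivity) S.2.2.2
    exact ⟨⟨T, h2, h3, h4⟩, h1, h5⟩
  choose F hF1 hF2 using hstep
  let q : ℕ → St := fun n => Nat.rec ⟨{univ}, by simp, by simp, h0⟩ (fun n S => F n S) n
  have hq : ∀ n, q (n+1) = F n (q n) := fun n => rfl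
  have hmono : Monotone (fun n => (q n).1) := monotone_nat_of_le_succ fun n => by
    rw [hq]; exact hF1 n (q n)
  set T : Set (Set X) := ⋃ n, (q n).1 with hT
  have hTo : ∀ u ∈ T, IsOpen u := by
    intro u hu
    obtain ⟨n, hn⟩ := mem_iUnion.1 hu
    exact (q n).2.2.1 u hn
  have hTs : ∀ u ∈ T, ∀ ε > 0, Splits T ε u := by
    intro u hu ε hε
    obtain ⟨n, hn⟩ := mem_iUnion.1 hu
    obtain ⟨m, hm⟩ := exists_pow_lt_of_lt_one hε (by norm_num : (1/2 : ℝ) < 1)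
    have hnm : u ∈ (q (max n m)).1 := hmono (le_max_left n m) hn
    obtain ⟨v, hv, w, hw, h1, h2, h3, h4, h5⟩ := hF2 (max n m) (q (max n m)) u hnm
    rw [← hq] at hv hw
    have hle : (1/2 : ℝ)^(max n m) < ε :=
      lt_of_le_of_lt (pow_le_pow_of_le_one (by norm_num) (by norm_num) (le_max_right n m)) hm
    exact ⟨v, mem_iUnion.2 ⟨max n m + 1, hv⟩, w, mem_iUnion.2 ⟨max n m + 1, hw⟩, h1, h2, h3,
      fun a ha b hb => (h4 a ha b hb).trans hle, fun a ha b hb => (h5 a ha b hb).trans hle⟩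
  have hTne : ∀ u ∈ T, ∀ v ∈ T, (f '' u ∩ f '' v).Nonempty := by
    intro u hu v hv
    obtain ⟨n, hn⟩ := mem_iUnion.1 hu
    obtain ⟨m, hm⟩ := mem_iUnion.1 hv
    have h1 : u ∈ (q (max n m)).1 := hmono (le_max_left n m) hn
    have h2 : v ∈ (q (max n m)).1 := hmono (le_max_right n m) hm
    by_contra hne
    rw [not_nonempty_iff_eq_empty] at hne
    apply (q (max n m)).2.2.2
    refine ⟨fun _ => ∅, fun w _ => ⟨MeasurableSet.empty, ?_⟩, ?_⟩
    · simp only [preimage_empty, inter_empty]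
      exact Sig.of_injOn MeasurableSet.empty (by simp)
    · intro y hy
      simp only [mem_iInter] at hy
      have : y ∈ f '' u ∩ f '' v := ⟨hy u h1, hy v h2⟩
      rw [hne] at this
      exact this.elim
  set P : Set X := {x | ∀ ε > 0, ∃ u ∈ T, u ⊆ Metric.ball x ε} with hP
  have hPex : ∀ u ∈ T, ∃ p ∈ P, p ∈ u := by
    intro u hu
    have hs : ∀ (n : ℕ) (u : T), ∃ v : T, closure v.1 ⊆ u.1 ∧
        ∀ a ∈ v.1, ∀ b ∈ v.1, dist a b < (1/2 : ℝ)^n := by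
      intro n u
      obtain ⟨v, hv, w, hw, h1, h2, h3, h4, h5⟩ := hTs u.1 u.2 ((1/2 : ℝ)^n) (by positivity)
      exact ⟨⟨v, hv⟩, h2, h4⟩
    choose G hG1 hG2 using hs
    let r : ℕ → T := fun n => Nat.rec ⟨u, hu⟩ (fun n S => G n S) n
    have hr : ∀ n, r (n+1) = G n (r n) := fun n => rfl
    have hrm : Antitone (fun n => (r n).1) := antitone_nat_of_succ_le fun n => by
      rw [hr]; exact subset_closure.trans (hG1 n (r n))
    have hne : ∀ n, (r n).1.Nonempty := fun n => by
      obtain ⟨y, ⟨x, hx, _⟩, _⟩ := hTne _ (r n).2 _ (r n).2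
      exact ⟨x, hx⟩
    choose x hx using hne
    have hcau : CauchySeq (fun n => x (n+1)) := by
      refine cauchySeq_of_le_geometric (1/2) 1 (by norm_num) fun n => ?_
      rw [one_mul]
      have h1 : x (n+1) ∈ (G n (r n)).1 := by rw [← hr]; exact hx (n+1)
      have h2 : x (n+2) ∈ (G n (r n)).1 := by
        rw [← hr]; exact hrm (Nat.le_succ (n+1)) (hx (n+2))
      exact (hG2 n (r n) _ h1 _ h2).le
    obtain ⟨p, hp⟩ := cauchySeq_tendsto_of_complete hcau
    have hpc : ∀ n, p ∈ closure (r n).1 := by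
      intro n
      refine mem_closure_of_tendsto hp ?_
      filter_upwards [Filter.eventually_ge_atTop n] with k hk
      exact hrm (show n ≤ k + 1 by omega) (hx (k+1))
    have hpr : ∀ n, p ∈ (r n).1 := fun n => by
      have := hpc (n+1)
      rw [hr] at this
      exact hG1 n (r n) this
    refine ⟨p, ?_, hpr 0⟩
    intro ε hε
    obtain ⟨m, hm⟩ := exists_pow_lt_of_lt_one hε (by norm_num : (1/2 : ℝ) < 1)
    refine ⟨(r (m+1)).1, (r (m+1)).2, fun a ha => ?_⟩
    have h1 := hpr (m+1)
    rw [hr] at ha h1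
    exact Metric.mem_ball.2 ((hG2 m (r m) a ha p h1).trans hm)
  have hPf : ∀ x ∈ P, ∀ y ∈ P, f x = f y := by
    intro x hx y hy
    by_contra hne
    obtain ⟨O, O', hO, hO', hxO, hyO, hd⟩ := t2_separation hne
    obtain ⟨a, ha, hau⟩ := Metric.isOpen_iff.1 (hO.preimage hf) x hxO
    obtain ⟨b, hb, hbu⟩ := Metric.isOpen_iff.1 (hO'.preimage hf) y hyO
    obtain ⟨u, hu, hua⟩ := hx a ha
    obtain ⟨v, hv, hvb⟩ := hy b hb
    obtain ⟨z, ⟨s, hs, rfl⟩, ⟨t, ht, hst⟩⟩ := hTne u hu v hv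
    refine Set.disjoint_left.1 hd (hau (hua hs)) ?_
    rw [← hst]
    exact hbu (hvb ht)
  have hPcl : IsClosed P := by
    refine isClosed_of_closure_subset fun x hx ε hε => ?_
    obtain ⟨y, hy, hxy⟩ := Metric.mem_closure_iff.1 hx (ε/2) (by positivity)
    obtain ⟨u, hu, hub⟩ := hy (ε/2) (by positivity)
    refine ⟨u, hu, hub.trans (Metric.ball_subset_ball' ?_)⟩
    rw [dist_comm]; linarith
  have hPp : Preperfect P := by
    intro x hx
    rw [accPt_iff_nhds]
    intro U hU
    obtain ⟨ε, hε, hεU⟩ := Metric.mem_nhds_iff.1 hU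
    obtain ⟨u, hu, hub⟩ := hx ε hε
    obtain ⟨v, hv, w, hw, h1, h2, h3, h4, h5⟩ := hTs u hu 1 one_pos
    obtain ⟨p, hp, hpv⟩ := hPex v hv
    obtain ⟨p', hp', hpw⟩ := hPex w hw
    by_cases hpx : p = x
    · refine ⟨p', ⟨hεU (hub (h3 (subset_closure hpw))), hp'⟩, ?_⟩
      rintro rfl
      subst hpx
      exact Set.disjoint_left.1 h1 hpv hpw
    · exact ⟨p, ⟨hεU (hub (h2 (subset_closure hpv))), hp⟩, hpx⟩
  have hPne : P.Nonempty := by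
    obtain ⟨p, hp, -⟩ := hPex univ (mem_iUnion.2 ⟨0, rfl⟩)
    exact ⟨p, hp⟩
  obtain ⟨g, hg, -, hginj⟩ := Perfect.exists_nat_bool_injection ⟨hPcl, hPp⟩ hPne
  obtain ⟨p, hp⟩ := hPne
  have hcount : (range g).Countable := (hc (f p)).mono fun x hx => hPf x (hg hx) p hp
  have : Countable (ℕ → Bool) := by
    have := hcount.to_subtype
    exact (Equiv.ofInjective g hginj).countable_iff.2 this
  obtain ⟨e, he⟩ := exists_surjective_nat (ℕ → Bool)
  obtain ⟨n, hn⟩ := he (fun i => !(e i i))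
  have := congrFun hn n
  cases h : e n n <;> simp [h] at this

theorem sig_univ_polish {X Y : Type*} [MeasurableSpace X] [tX : TopologicalSpace X]
    [hX : PolishSpace X] [hBX : BorelSpace X]
    [TopologicalSpace Y] [PolishSpace Y] [MeasurableSpace Y] [BorelSpace Y]
    {f : X → Y} (hf : Measurable f) (hc : ∀ y, (f ⁻¹' {y}).Countable) : Sig f univ := by
  obtain ⟨t', hle, hcont, hpol⟩ := hf.exists_continuous
  have hb : @borel X t' = @borel X tX := @borel_eq_borel_of_le X t' tX hpol inferInstance hle
  have hB : @BorelSpace X t' _ := by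
    refine @BorelSpace.mk X t' _ ?_
    rw [hb]
    exact hBX.measurable_eq
  let m := @TopologicalSpace.upgradeIsCompletelyMetrizable X t' _
  exact @sig_univ_metric X Y _ _ hpol.toSecondCountableTopology _ hB _ _ _ _ f hcont hc

/-- Lusin-Novikov for countable-to-one functions. -/
theorem sig_univ {X Y : Type*} [MeasurableSpace X] [StandardBorelSpace X]
    [MeasurableSpace Y] [StandardBorelSpace Y]
    {f : X → Y} (hf : Measurable f) (hc : ∀ y, (f ⁻¹' {y}).Countable) : Sig f univ := by
  let _ := upgradeStandardBorel X
  let _ := upgradeStandardBorel Y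
  exact sig_univ_polish hf hc

end BR

namespace BR
open MeasureTheory Set

theorem sel {Ω : Type*} [MeasurableSpace Ω] (R : ℕ → Set Ω) (hR : ∀ i, MeasurableSet (R i))
    (h : ∀ ω, ∃ i, ω ∈ R i) : ∃ u : Ω → ℕ, Measurable u ∧ ∀ ω, ω ∈ R (u ω) :=
  ⟨fun ω => Nat.find (h ω), measurable_find h hR, fun ω => Nat.find_spec (h ω)⟩

/-- uniformization of countable-to-one maps -/
theorem unif {X Z : Type*} [MeasurableSpace X] [StandardBorelSpace X]
    [MeasurableSpace Z] [StandardBorelSpace Z] {f : X → Z} (hf : Measurable f)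
    (hc : ∀ y, (f ⁻¹' {y}).Countable) :
    ∃ e : ℕ → range f → X, (∀ i, Measurable (e i)) ∧ (∀ i z, f (e i z) = z) ∧
      ∀ x, ∃ i, e i ⟨f x, mem_range_self x⟩ = x := by
  obtain ⟨C, hC, hCu⟩ := sig_univ hf hc
  have hm : ∀ i (B : Set X), MeasurableSet B →
      MeasurableSet ((Subtype.val : range f → Z) ⁻¹' (f '' (C i ∩ B))) := fun i B hB =>
    measurable_subtype_coe
      (((hC i).1.inter hB).image_of_measurable_injOn hf ((hC i).2.mono inter_subset_left))
  have hR : ∀ z : range f, ∃ i, z.1 ∈ f '' (C i) := by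
    rintro ⟨_, x, rfl⟩
    obtain ⟨i, hi⟩ := mem_iUnion.1 (hCu (mem_univ x))
    exact ⟨i, x, hi, rfl⟩
  have hRm : ∀ i, MeasurableSet ((Subtype.val : range f → Z) ⁻¹' (f '' (C i))) := fun i => by
    simpa using hm i univ MeasurableSet.univ
  obtain ⟨u, hu, huR⟩ := sel (fun i => (Subtype.val : range f → Z) ⁻¹' (f '' (C i))) hRm hR
  let v : ℕ → range f → ℕ := fun i z => if z.1 ∈ f '' (C i) then i else u z
  have hv : ∀ i, Measurable (v i) := fun i => Measurable.ite (hRm i) measurable_const hu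
  have hvR : ∀ i z, ∃ x ∈ C (v i z), f x = z := by
    intro i z
    by_cases h : z.1 ∈ f '' (C i)
    · have : v i z = i := if_pos h
      rw [this]; exact h
    · have : v i z = u z := if_neg h
      rw [this]; exact huR z
  choose e he1 he2 using hvR
  refine ⟨e, fun i B hB => ?_, he2, fun x => ?_⟩
  · have : e i ⁻¹' B = ⋃ j, (v i ⁻¹' {j} ∩ ((Subtype.val : range f → Z) ⁻¹' (f '' (C j ∩ B)))) := by
      ext z
      simp only [mem_preimage, mem_iUnion, mem_inter_iff, mem_singleton_iff, exists_eq_left']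
      constructor
      · intro h
        exact ⟨e i z, ⟨he1 i z, h⟩, he2 i z⟩
      · rintro ⟨x, ⟨hx, hxB⟩, hxz⟩
        have : e i z = x := (hC _).2 (he1 i z) hx (by rw [he2, hxz])
        rwa [this]
    rw [this]
    exact MeasurableSet.iUnion fun j => (hv i (measurableSet_singleton j)).inter (hm j B hB)
  · obtain ⟨i, hi⟩ := mem_iUnion.1 (hCu (mem_univ x))
    refine ⟨i, (hC i).2 ?_ hi (he2 i _)⟩
    have : v i ⟨f x, mem_range_self x⟩ = i := if_pos ⟨x, hi, rfl⟩
    have h := he1 i ⟨f x, mem_range_self x⟩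
    rwa [this] at h

/-- Countable sections of a countable Borel equivalence relation. -/
theorem sections {X : Type*} [MeasurableSpace X] [StandardBorelSpace X]
    (E : X → X → Prop) (hE : Equivalence E)
    (hEBorel : MeasurableSet {p : X × X | E p.1 p.2})
    (hcount : ∀ x : X, {y | E x y}.Countable) :
    ∃ g : ℕ → X → X, (∀ i, Measurable (g i)) ∧ ∀ x y, E x y ↔ ∃ i, g i x = y := by
  have : StandardBorelSpace {p : X × X | E p.1 p.2} := hEBorel.standardBorel
  let f : {p : X × X | E p.1 p.2} → X := fun p => p.1.1
  have hf : Measurable f := measurable_fst.comp measurable_subtype_coe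
  have hc : ∀ y, (f ⁻¹' {y}).Countable := by
    intro y
    refine Set.MapsTo.countable_of_injOn (f := fun p => p.1.2) (t := {z | E y z}) ?_ ?_ (hcount y)
    · rintro ⟨p, hp⟩ hpy
      have : p.1 = y := hpy
      subst this
      exact hp
    · rintro ⟨⟨a, b⟩, hp⟩ hpy ⟨⟨a', b'⟩, hp'⟩ hpy' h
      have h1 : a = y := hpy
      have h2 : a' = y := hpy'
      have h3 : b = b' := h
      subst h1 h2 h3
      rfl
  obtain ⟨e, he, hef, hes⟩ := unif hf hc
  have hr : ∀ x, x ∈ range f := fun x => ⟨⟨(x, x), hE.refl x⟩, rfl⟩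
  refine ⟨fun i x => (e i ⟨x, hr x⟩).1.2, fun i => ?_, fun x y => ⟨fun h => ?_, ?_⟩⟩
  · exact measurable_snd.comp (measurable_subtype_coe.comp
      ((he i).comp (measurable_id.subtype_mk)))
  · obtain ⟨i, hi⟩ := hes ⟨(x, y), h⟩
    refine ⟨i, ?_⟩
    have : e i ⟨x, hr x⟩ = ⟨(x, y), h⟩ := hi
    simp [this]
  · rintro ⟨i, rfl⟩
    have h1 : (e i ⟨x, hr x⟩).1.1 = x := hef i ⟨x, hr x⟩
    have h2 := (e i ⟨x, hr x⟩).2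
    simp only [mem_ofPred_eq, h1] at h2
    exact h2

/-- Feldman-Moore. -/
theorem feldman_moore {X : Type*} [MeasurableSpace X] [StandardBorelSpace X]
    (E : X → X → Prop) (hE : Equivalence E)
    (hEBorel : MeasurableSet {p : X × X | E p.1 p.2})
    (hcount : ∀ x : X, {y | E x y}.Countable) :
    ∃ T : ℕ → X → X, (∀ i, Measurable (T i)) ∧ (∀ i x, T i (T i x) = x) ∧
      ∀ x y, E x y ↔ ∃ i, T i x = y := by
  obtain ⟨g, hg, hgE⟩ := sections E hE hEBorel hcount
  obtain ⟨U, hUm, hUs⟩ : ∃ U : ℕ → Set X, (∀ k, MeasurableSet (U k)) ∧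
      ∀ x y, x ≠ y → ∃ k, x ∈ U k ∧ y ∉ U k := by
    obtain ⟨φ, hφ⟩ := exists_measurableEmbedding_real X
    obtain ⟨d, hd⟩ := exists_surjective_nat (ℚ × Bool)
    refine ⟨fun k => if (d k).2 then φ ⁻¹' (Iio ((d k).1 : ℝ)) else φ ⁻¹' (Ioi ((d k).1 : ℝ)),
      fun k => ?_, fun x y hne => ?_⟩
    · beta_reduce
      split_ifs
      · exact hφ.measurable measurableSet_Iio
      · exact hφ.measurable measurableSet_Ioi
    · rcases lt_or_gt_of_ne (hφ.injective.ne hne) with h | h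
      · obtain ⟨q, h1, h2⟩ := exists_rat_btwn h
        obtain ⟨k, hk⟩ := hd (q, true)
        exact ⟨k, by simp [hk, h1, h2.le]⟩
      · obtain ⟨q, h1, h2⟩ := exists_rat_btwn h
        obtain ⟨k, hk⟩ := hd (q, false)
        exact ⟨k, by simp [hk, h2, h1.le]⟩
  let D : ℕ → ℕ → ℕ → Set X := fun i j k => {x | g j (g i x) = x ∧ x ∈ U k ∧ g i x ∉ U k}
  have hD : ∀ i j k, MeasurableSet (D i j k) := fun i j k =>
    (measurableSet_eq_fun ((hg j).comp (hg i)) measurable_id).inter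
      ((hUm k).inter ((hg i) (hUm k).compl))
  let S : ℕ → ℕ → ℕ → X → X := fun i j k x => if x ∈ D i j k then g i x else
    if g j x ∈ D i j k ∧ g i (g j x) = x then g j x else x
  have hS : ∀ i j k, Measurable (S i j k) := fun i j k =>
    Measurable.ite (hD i j k) (hg i) (Measurable.ite ((hg j (hD i j k)).inter
      (measurableSet_eq_fun ((hg i).comp (hg j)) measurable_id)) (hg j) measurable_id)
  have hSE : ∀ i j k x, E x (S i j k x) := by
    intro i j k x
    simp only [S]
    split_ifs
    · exact (hgE _ _).2 ⟨i, rfl⟩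
    · exact (hgE _ _).2 ⟨j, rfl⟩
    · exact hE.refl x
  have hSS : ∀ i j k x, S i j k (S i j k x) = x := by
    intro i j k x
    by_cases h1 : x ∈ D i j k
    · have e1 : S i j k x = g i x := if_pos h1
      have h2 : g i x ∉ D i j k := fun h => h1.2.2 h.2.1
      have h3 : g j (g i x) ∈ D i j k ∧ g i (g j (g i x)) = g i x := by
        rw [h1.1]; exact ⟨h1, rfl⟩
      rw [e1]
      simp only [S]
      rw [if_neg h2, if_pos h3, h1.1]
    · by_cases h2 : g j x ∈ D i j k ∧ g i (g j x) = x
      · have e1 : S i j k x = g j x := by simp only [S]; rw [if_neg h1, if_pos h2]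
        rw [e1]
        simp only [S]
        rw [if_pos h2.1, h2.2]
      · have e1 : S i j k x = x := by simp only [S]; rw [if_neg h1, if_neg h2]
        rw [e1, e1]
  have : Nonempty (Option (ℕ × ℕ × ℕ)) := ⟨none⟩
  obtain ⟨d, hd⟩ := exists_surjective_nat (Option (ℕ × ℕ × ℕ))
  let T : Option (ℕ × ℕ × ℕ) → X → X := fun o => o.elim id (fun p => S p.1 p.2.1 p.2.2)
  refine ⟨fun n => T (d n), fun n => ?_, fun n x => ?_, fun x y => ⟨fun h => ?_, ?_⟩⟩
  · simp only [T]; rcases d n with _ | p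
    · exact measurable_id
    · exact hS _ _ _
  · simp only [T]; rcases d n with _ | p
    · rfl
    · exact hSS _ _ _ x
  · by_cases hxy : x = y
    · obtain ⟨n, hn⟩ := hd none
      exact ⟨n, by simp [T, hn, hxy]⟩
    · obtain ⟨i, hi⟩ := (hgE x y).1 h
      obtain ⟨j, hj⟩ := (hgE y x).1 (hE.symm h)
      obtain ⟨k, hk1, hk2⟩ := hUs x y hxy
      obtain ⟨n, hn⟩ := hd (some (i, j, k))
      refine ⟨n, ?_⟩
      have : x ∈ D i j k := ⟨by rw [hi, hj], hk1, by rw [hi]; exact hk2⟩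
      have e1 : S i j k x = g i x := if_pos this
      simp only [T, hn, Option.elim]
      rw [e1, hi]
  · rintro ⟨n, rfl⟩
    simp only [T]; rcases d n with _ | p
    · exact hE.refl x
    · exact hSE _ _ _ x

end BR

namespace BR
open MeasureTheory Set TopologicalSpace

theorem topo_step {X : Type*} [MeasurableSpace X] (T : ℕ → X → X) (hT : ∀ i, Measurable (T i))
    (t : TopologicalSpace X) (hp : @PolishSpace X t) (hb : @BorelSpace X t _) :
    ∃ t' : TopologicalSpace X, t' ≤ t ∧ @PolishSpace X t' ∧ @BorelSpace X t' _ ∧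
      ∀ i, @Continuous X X t' t (T i) := by
  have h : ∀ i, ∃ t' : TopologicalSpace X, t' ≤ t ∧ @Continuous X X t' t (T i) ∧
      @PolishSpace X t' := fun i => (hT i).exists_continuous
  choose m hm1 hm2 hm3 using h
  obtain ⟨t', h1, h2, h3⟩ := @PolishSpace.exists_polishSpace_forall_le X ℕ _ t hp m hm1 hm3
  refine ⟨t', h2, h3, ?_, fun i => continuous_le_dom (h1 i) (hm2 i)⟩
  refine @BorelSpace.mk X t' _ ?_
  rw [borel_eq_borel_of_le h3 hp h2]
  exact hb.measurable_eq

theorem topo {X : Type*} [MeasurableSpace X] [StandardBorelSpace X] (T : ℕ → X → X)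
    (hT : ∀ i, Measurable (T i)) :
    ∃ t : TopologicalSpace X, @PolishSpace X t ∧ @BorelSpace X t _ ∧
      ∀ i, @Continuous X X t t (T i) := by
  obtain ⟨t0, hb0, hp0⟩ := (inferInstance : StandardBorelSpace X).polish
  let St := {t : TopologicalSpace X // @PolishSpace X t ∧ @BorelSpace X t _}
  have hstep : ∀ t : St, ∃ t' : St, t'.1 ≤ t.1 ∧ ∀ i, @Continuous X X t'.1 t.1 (T i) := by
    intro t
    obtain ⟨t', h1, h2, h3, h4⟩ := topo_step T hT t.1 t.2.1 t.2.2
    exact ⟨⟨t', h2, h3⟩, h1, h4⟩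
  choose F hF1 hF2 using hstep
  let q : ℕ → St := fun n => Nat.rec ⟨t0, hp0, hb0⟩ (fun _ t => F t) n
  have hq : ∀ n, q (n+1) = F (q n) := fun n => rfl
  have hanti : Antitone (fun n => (q n).1) := antitone_nat_of_succ_le fun n => by
    rw [hq]; exact hF1 (q n)
  have hpol : @PolishSpace X (⨅ n, (q n).1) :=
    PolishSpace.iInf ⟨0, fun i => hanti (Nat.zero_le i)⟩ fun n => (q n).2.1
  refine ⟨⨅ n, (q n).1, hpol, ?_, fun i => ?_⟩
  · refine @BorelSpace.mk X (⨅ n, (q n).1) _ ?_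
    rw [borel_eq_borel_of_le hpol hp0 (iInf_le (fun n => (q n).1) 0)]
    exact hb0.measurable_eq
  · rw [continuous_iInf_rng]
    intro n
    refine continuous_le_dom (iInf_le (fun n => (q n).1) (n+1)) ?_
    rw [hq]
    exact hF2 (q n) i

theorem gdelta_baire {X : Type*} [TopologicalSpace X] [PolishSpace X] {W : Set X} (hW : IsGδ W) :
    BaireSpace W := by
  have hpol : PolishSpace (closure W) := isClosed_closure.polishSpace
  have hb : BaireSpace (closure W) := by
    let _ := TopologicalSpace.upgradeIsCompletelyMetrizable (closure W)
    infer_instance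
  have hd : Dense ((Subtype.val : closure W → X) ⁻¹' W) := by
    rw [Subtype.dense_iff]
    intro x hx
    convert hx using 1
    congr 1
    ext y
    simp only [mem_image, mem_preimage, Subtype.exists, exists_and_left, exists_prop,
      exists_eq_right_right]
    exact ⟨fun h => h.1, fun h => ⟨h, subset_closure h⟩⟩
  have := (hW.preimage continuous_subtype_val).baireSpace_of_dense hd
  let h_homeo : ((Subtype.val : closure W → X) ⁻¹' W) ≃ₜ W := {
    toFun := fun x => ⟨x.1.1, x.2⟩
    invFun := fun x => ⟨⟨x.1, subset_closure x.2⟩, x.2⟩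
    left_inv := fun x => rfl
    right_inv := fun x => rfl
    continuous_toFun := by fun_prop
    continuous_invFun := by fun_prop }
  exact h_homeo.baireSpace

theorem core {W : Type*} [TopologicalSpace W] [SecondCountableTopology W] [BaireSpace W]
    [MeasurableSpace W] [BorelSpace W] [Nonempty W]
    (T : ℕ → W → W) (hT : ∀ i, Continuous (T i)) (hTT : ∀ i x, T i (T i x) = x)
    (E : W → W → Prop) (hE : ∀ x y, E x y ↔ ∃ i, T i x = y) (hrefl : ∀ x, E x x)
    (N : W → W → ℕ) (hN : ∀ x y, E x y → T (N x y) x = y)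
    (hinf : ∀ x (U : Set W), IsOpen U → x ∈ U → {y | y ∈ U ∧ E x y}.Infinite)
    (n : ℕ) (hn : 1 < n) :
    ∃ p : ℕ → Bool, ∀ (k : ℕ) (Y : Fin k → Set W), (∀ a, MeasurableSet (Y a)) →
      (∀ x, ∃ a, ∃ y ∈ Y a, E x y) →
      ∃ a, ∀ b : Bool, ∃ x, ∃ A : Finset W, A.card = n ∧ (∀ y ∈ A, E x y) ∧ x ∈ A ∧ ↑A ⊆ Y a ∧
        p (A.sup fun x => A.sup fun y => N x y) = b := by
  let S : Set W → ℕ → Set W := fun U m => {x | x ∈ U ∧ ∃ A : Finset W, A.card = n ∧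
    (∀ y ∈ A, E x y) ∧ x ∈ A ∧ ↑A ⊆ U ∧ (A.sup fun x => A.sup fun y => N x y) = m}
  have hS : ∀ U : Set W, IsOpen U → U.Nonempty → ∀ M, ∃ m, M ≤ m ∧ ¬ IsMeagre (S U m) := by
    intro U hU hne M
    by_contra hcon
    push Not at hcon
    refine not_isMeagre_of_isOpen hU hne ?_
    refine (isMeagre_iUnion (f := fun m : {m // M ≤ m} => S U m.1)
      (fun m => hcon m.1 m.2)).mono ?_
    intro x hx
    have h1 := hinf x U hU hx
    have h2 : ((fun i => T i x) '' (Set.Iio M)).Finite := (Set.finite_Iio M).image _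
    obtain ⟨y, hy, hyM⟩ := (h1.sdiff h2).nonempty
    have h3 : ∃ A : Finset W, ({x, y} : Finset W) ⊆ A ∧ (↑A : Set W) ⊆ {y | y ∈ U ∧ E x y} ∧
        A.card = n := by
      have hxy : ((({x, y} : Finset W) : Set W)) ⊆ {y | y ∈ U ∧ E x y} := by
        intro z hz
        simp only [Finset.coe_insert, Finset.coe_singleton, mem_insert_iff, mem_singleton_iff] at hz
        rcases hz with rfl | rfl
        · exact ⟨hx, hrefl _⟩
        · exact hy
      obtain ⟨A, hA1, hA2, hA3⟩ := Set.Infinite.exists_superset_ncard_eq h1 hxy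
        (Finset.finite_toSet _) (k := n)
        (by rw [Set.ncard_coe_finset]; exact Finset.card_le_two.trans hn)
      have hAf : A.Finite := Set.finite_of_ncard_pos (by omega)
      refine ⟨hAf.toFinset, ?_, by simpa using hA2, ?_⟩
      · intro z hz; simpa using hA1 hz
      · rw [Set.ncard_eq_toFinset_card A hAf] at hA3; exact hA3
    obtain ⟨A, hA1, hA2, hA3⟩ := h3
    have hxA : x ∈ A := hA1 (by simp)
    have hyA : y ∈ A := hA1 (by simp)
    refine mem_iUnion.2 ⟨⟨A.sup fun x => A.sup fun y => N x y, ?_⟩, hx, A, hA3,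
      fun z hz => (hA2 hz).2, hxA, fun z hz => (hA2 hz).1, rfl⟩
    by_contra hlt
    apply hyM
    refine ⟨N x y, ?_, hN x y hy.2⟩
    have e1 : N x y ≤ A.sup fun y => N x y := Finset.le_sup (f := fun y => N x y) hyA
    have e2 : (A.sup fun y => N x y) ≤ A.sup fun x => A.sup fun y => N x y :=
      Finset.le_sup (f := fun x => A.sup fun y => N x y) hxA
    simp only [mem_Iio]
    omega
  let B := {U : Set W // U ∈ countableBasis W ∧ U.Nonempty}
  have hBc : Countable B := ((countable_countableBasis W).mono (fun U hU => hU.1) :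
    {U : Set W | U ∈ countableBasis W ∧ U.Nonempty}.Countable)
  have hBne : Nonempty B := by
    obtain ⟨x⟩ := ‹Nonempty W›
    obtain ⟨v, hv, hxv, -⟩ := (isBasis_countableBasis W).exists_subset_of_mem_open
      (mem_univ x) isOpen_univ
    exact ⟨v, hv, x, hxv⟩
  obtain ⟨d, hd⟩ := exists_surjective_nat (B × Bool)
  obtain ⟨φ, hφ, hφS⟩ := Filter.extraction_forall_of_frequently
    (P := fun j m => ¬ IsMeagre (S (d j).1.1 m)) (fun j => Filter.frequently_atTop.2 fun M =>
      hS _ (isOpen_of_mem_countableBasis (d j).1.2.1) (d j).1.2.2 M)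
  refine ⟨fun m => decide (∃ j, φ j = m ∧ (d j).2 = true), fun k Y hYm hYc => ?_⟩
  have hTo : ∀ i, IsOpenMap (T i) := fun i => by
    let h : W ≃ₜ W := ⟨⟨T i, T i, hTT i, hTT i⟩, hT i, hT i⟩
    exact h.isOpenMap
  have h1 : ∃ a, ¬ IsMeagre (Y a) := by
    by_contra hcon
    push Not at hcon
    refine not_isMeagre_of_isOpen (isOpen_univ (X := W)) univ_nonempty ?_
    refine (isMeagre_iUnion (f := fun q : Fin k × ℕ => T q.2 ⁻¹' (Y q.1))
      (fun q => (hcon q.1).preimage_of_isOpenMap (hT q.2) (hTo q.2))).mono ?_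
    intro x _
    obtain ⟨a, y, hy, hxy⟩ := hYc x
    obtain ⟨i, rfl⟩ := (hE _ _).1 hxy
    exact mem_iUnion.2 ⟨(a, i), hy⟩
  obtain ⟨a, ha⟩ := h1
  refine ⟨a, fun b => ?_⟩
  obtain ⟨O, hO, hYO⟩ := (hYm a).residualEq_isOpen
  have hOne : O.Nonempty := by
    by_contra hne
    rw [not_nonempty_iff_eq_empty] at hne
    subst hne
    apply ha
    change _ ∈ residual W
    filter_upwards [hYO] with x hx
    intro hxY
    have : x ∈ (∅ : Set W) := hx.mp hxY
    exact this
  obtain ⟨x0, hx0⟩ := hOne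
  obtain ⟨U, hU, hxU, hUO⟩ := (isBasis_countableBasis W).exists_subset_of_mem_open hx0 hO
  have hmeag : IsMeagre (U \ Y a) := by
    change _ ∈ residual W
    filter_upwards [hYO] with x hx
    intro hxY
    exact hxY.2 (hx.mpr (hUO hxY.1))
  obtain ⟨j, hj⟩ := hd (⟨U, hU, x0, hxU⟩, b)
  have hSj := hφS j
  rw [hj] at hSj
  simp only at hSj
  have h2 : IsMeagre (⋃ i, T i ⁻¹' (U \ Y a)) :=
    isMeagre_iUnion fun i => hmeag.preimage_of_isOpenMap (hT i) (hTo i)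
  have h3 : ∃ x ∈ S U (φ j), x ∉ ⋃ i, T i ⁻¹' (U \ Y a) := by
    by_contra hcon
    push Not at hcon
    exact hSj (h2.mono hcon)
  obtain ⟨x, ⟨-, A, hA1, hA2, hA3, hA4, hA5⟩, hx⟩ := h3
  refine ⟨x, A, hA1, hA2, hA3, fun y hy => ?_, ?_⟩
  · obtain ⟨i, rfl⟩ := (hE _ _).1 (hA2 y hy)
    by_contra hyY
    exact hx (mem_iUnion.2 ⟨i, hA4 hy, hyY⟩)
  · rw [hA5]
    cases b
    · rw [decide_eq_false_iff_not]
      rintro ⟨j', hj', h⟩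
      rw [hφ.injective hj', hj] at h
      cases h
    · rw [decide_eq_true_iff]
      exact ⟨j, rfl, by rw [hj]⟩

end BR

namespace BR
open MeasureTheory Set TopologicalSpace

theorem range_toFinset {X : Type*} {n : ℕ} (v : Fin n → X) :
    (Set.finite_range v).toFinset = Finset.univ.image v := by
  ext; simp

theorem measurable_finset_sup {Ω ι : Type*} [MeasurableSpace Ω] (s : Finset ι) (f : ι → Ω → ℕ)
    (hf : ∀ i, Measurable (f i)) : Measurable fun ω => s.sup fun i => f i ω := by
  induction s using Finset.induction_on with
  | empty => simp
  | insert a s _ ih =>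
    simp only [Finset.sup_insert]
    exact (hf a).sup ih

theorem weak_W_empty {X : Type*} [MeasurableSpace X] [StandardBorelSpace X]
    [TopologicalSpace X] [PolishSpace X] [BorelSpace X]
    (E : X → X → Prop) (hE : Equivalence E)
    (T : ℕ → X → X) (hT : ∀ i, Continuous (T i)) (hTT : ∀ i x, T i (T i x) = x)
    (hTE : ∀ x y, E x y ↔ ∃ i, T i x = y)
    (n k : ℕ) (hn : 1 < n) (hk : 1 < k) (hw : WeakBorelRamsey E n k)
    (W : Set X) (hWG : IsGδ W) (hWE : ∀ x y, E x y → x ∈ W → y ∈ W)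
    (hinf : ∀ x (U : Set X), x ∈ W → IsOpen U → x ∈ U → {y | y ∈ U ∧ E x y}.Infinite) :
    W = ∅ := by
  by_contra hne
  have hWne : Nonempty W := (nonempty_iff_ne_empty.2 hne).to_subtype
  have hBa : BaireSpace W := gdelta_baire hWG
  have hTm : ∀ i, Measurable (T i) := fun i => (hT i).measurable
  -- the index function
  have hEm : MeasurableSet {p : X × X | E p.1 p.2} := by
    have : {p : X × X | E p.1 p.2} = ⋃ i, {p : X × X | T i p.1 = p.2} := by
      ext p; simp [hTE]
    rw [this]
    exact MeasurableSet.iUnion fun i =>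
      measurableSet_eq_fun ((hTm i).comp measurable_fst) measurable_snd
  obtain ⟨N, hNm, hN⟩ := sel (Ω := X × X) (fun i => {p : X × X | T i p.1 = p.2} ∪
      {p : X × X | E p.1 p.2}ᶜ) (fun i => (measurableSet_eq_fun ((hTm i).comp measurable_fst)
        measurable_snd).union hEm.compl) (by
      intro p
      by_cases h : E p.1 p.2
      · obtain ⟨i, hi⟩ := (hTE _ _).1 h
        exact ⟨i, Or.inl hi⟩
      · exact ⟨0, Or.inr h⟩)
  have hN' : ∀ x y, E x y → T (N (x, y)) x = y := by
    intro x y h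
    rcases hN (x, y) with h' | h'
    · exact h'
    · exact absurd h h'
  have hWT : ∀ i (x : W), T i x.1 ∈ W := fun i x => hWE _ _ ((hTE _ _).2 ⟨i, rfl⟩) x.2
  obtain ⟨p, hp⟩ := core (W := W) (fun i x => ⟨T i x.1, hWT i x⟩)
    (fun i => ((hT i).comp continuous_subtype_val).subtype_mk _)
    (fun i x => Subtype.ext (hTT i x.1)) (fun x y => E x.1 y.1)
    (fun x y => by simp only [hTE, Subtype.ext_iff]) (fun x => hE.refl x.1)
    (fun x y => N (x.1, y.1)) (fun x y h => Subtype.ext (hN' _ _ h))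
    (fun x U hU hxU => by
      obtain ⟨V, hV, rfl⟩ := isOpen_induced_iff.1 hU
      intro hfin
      refine hinf x.1 V x.2 hV hxU ((hfin.image Subtype.val).subset ?_)
      rintro y ⟨hyV, hy⟩
      exact ⟨⟨y, hWE _ _ hy x.2⟩, ⟨hyV, hy⟩, rfl⟩) n hn
  let code : Finset X → ℕ := fun A => A.sup fun x => A.sup fun y => N (x, y)
  let c0 : Fin k := ⟨0, by omega⟩
  let c1 : Fin k := ⟨1, hk⟩
  let c : Finset X → Fin k := fun A => if p (code A) then c0 else c1
  have hc : IsBorelColoring n c := by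
    have h1 : Measurable fun v : Fin n → X => code (Set.finite_range v).toFinset := by
      have : ∀ v : Fin n → X, code (Set.finite_range v).toFinset =
          Finset.univ.sup fun i => Finset.univ.sup fun j => N (v i, v j) := by
        intro v
        simp only [code]
        rw [range_toFinset, Finset.sup_image]
        simp only [Finset.sup_image, Function.comp_def]
      simp only [this]
      refine measurable_finset_sup _ (fun i (v : Fin n → X) =>
        Finset.univ.sup fun j => N (v i, v j)) fun i => measurable_finset_sup _ _ fun j => ?_
      exact hNm.comp ((measurable_pi_apply i).prodMk (measurable_pi_apply j))
    exact (measurable_of_countable (fun m : ℕ => if p m then c0 else c1)).comp h1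
  obtain ⟨Y, hYm, hYc, hYmono⟩ := hw c hc
  let Ya : Fin k → Set X := fun a => {x | x ∈ Y ∧ ∀ s : Fin n → ℕ, (∀ i, T (s i) x ∈ Y) →
    (∀ i j, i ≠ j → T (s i) x ≠ T (s j) x) →
      c (Set.finite_range (fun i => T (s i) x)).toFinset = a}
  have hYa : ∀ a, MeasurableSet (Ya a) := by
    intro a
    have : Ya a = Y ∩ ⋂ s : Fin n → ℕ, ((⋂ i, T (s i) ⁻¹' Y)ᶜ ∪
        ((⋂ i, ⋂ j, ⋂ (_ : i ≠ j), {x | T (s i) x = T (s j) x}ᶜ)ᶜ ∪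
          (fun x => c (Set.finite_range (fun i => T (s i) x)).toFinset) ⁻¹' {a})) := by
      ext x
      simp only [Ya, mem_ofPred_eq, mem_inter_iff, mem_iInter, mem_union, mem_compl_iff,
        mem_preimage, mem_singleton_iff]
      refine and_congr_right fun _ => forall_congr' fun s => ?_
      tauto
    rw [this]
    refine hYm.inter (MeasurableSet.iInter fun s => ?_)
    refine (MeasurableSet.iInter fun i => hTm _ hYm).compl.union
      ((MeasurableSet.iInter fun i => MeasurableSet.iInter fun j => MeasurableSet.iInter fun _ =>
        (measurableSet_eq_fun (hTm _) (hTm _)).compl).compl.union ?_)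
    exact (hc.comp (measurable_pi_lambda (fun x i => T (s i) x) fun i => hTm _))
      (measurableSet_singleton a)
  have hYacol : ∀ a x, x ∈ Ya a → ∀ A : Finset X, A.card = n → ↑A ⊆ Y → (∀ y ∈ A, E x y) →
      c A = a := by
    intro a x hx A hA hAY hAE
    have e := (A.equivFinOfCardEq hA).symm
    have h1 : ∀ i, ∃ m, T m x = (e i).1 := fun i => (hTE _ _).1 (hAE _ (e i).2)
    choose s hs using h1
    have h2 := hx.2 s (fun i => by rw [hs]; exact hAY (e i).2) (fun i j hij h => by
      rw [hs, hs] at h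
      exact hij (e.injective (Subtype.ext h)))
    rw [← h2]
    congr 1
    ext y
    simp only [hs, Finite.mem_toFinset, mem_range]
    constructor
    · intro hy
      exact ⟨e.symm ⟨y, hy⟩, by simp⟩
    · rintro ⟨i, rfl⟩
      exact (e i).2
  obtain ⟨a, ha⟩ := hp k (fun a => Subtype.val ⁻¹' (Ya a))
    (fun a => measurable_subtype_coe (hYa a)) (by
      intro x
      obtain ⟨y, hy, hxy⟩ := hYc x.1
      obtain ⟨a, ha⟩ := hYmono y
      refine ⟨a, ⟨y, hWE _ _ hxy x.2⟩, ⟨hy, fun s hs1 hs2 => ha _ ?_ ?_ ?_⟩, hxy⟩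
      · rw [range_toFinset, Finset.card_image_of_injective, Finset.card_univ, Fintype.card_fin]
        intro i j hij
        by_contra hne
        exact hs2 i j hne hij
      · rw [Finite.coe_toFinset]
        rintro _ ⟨i, rfl⟩
        exact hs1 i
      · intro z hz
        simp only [Finite.mem_toFinset, mem_range] at hz
        obtain ⟨i, hi⟩ := hz
        exact (hTE _ _).2 ⟨s i, hi⟩)
  have hfin : ∀ b : Bool, (if b then c0 else c1) = a := by
    intro b
    obtain ⟨x, A, hA1, hA2, hA3, hA4, hA5⟩ := ha b
    have h := hYacol a x.1 (hA4 hA3) (A.map (Function.Embedding.subtype _))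
      (by rw [Finset.card_map, hA1]) (by
        intro y hy
        simp only [Finset.coe_map, mem_image] at hy
        obtain ⟨z, hz, rfl⟩ := hy
        exact (hA4 hz).1) (by
        intro y hy
        simp only [Finset.mem_map] at hy
        obtain ⟨z, hz, rfl⟩ := hy
        exact hA2 z hz)
    have h2 : code (A.map (Function.Embedding.subtype _)) =
        A.sup fun x => A.sup fun y => N (x.1, y.1) := by
      simp only [code, Finset.sup_map]
      rfl
    rw [← h]
    simp only [c, h2, hA5]
  have h0 := hfin true
  have h1 := hfin false
  rw [← h1] at h0
  simp [c0, c1] at h0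

end BR

namespace BR
open MeasureTheory Set TopologicalSpace

theorem weak_smooth {X : Type*} [MeasurableSpace X] [StandardBorelSpace X]
    (E : X → X → Prop) (hE : Equivalence E)
    (hEBorel : MeasurableSet {p : X × X | E p.1 p.2})
    (hcount : ∀ x : X, {y | E x y}.Countable)
    (n k : ℕ) (hn : 1 < n) (hk : 1 < k) (hw : WeakBorelRamsey E n k) : IsSmooth E := by
  rcases isEmpty_or_nonempty X with hXe | hXne
  · exact ⟨ℕ, inferInstance, inferInstance, fun _ => 0, measurable_const, fun x => hXe.elim x⟩
  obtain ⟨T, hTm, hTT, hTE⟩ := feldman_moore E hE hEBorel hcount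
  obtain ⟨t, hpol, hbor, hT⟩ := topo T hTm
  have hcl : ∀ x y, E x y → ∀ z, E x z ↔ E y z := fun x y h z =>
    ⟨fun h' => hE.trans (hE.symm h) h', fun h' => hE.trans h h'⟩
  have : Nonempty (countableBasis X) := by
    obtain ⟨x⟩ := hXne
    obtain ⟨v, hv, hxv, -⟩ := (isBasis_countableBasis X).exists_subset_of_mem_open
      (mem_univ x) isOpen_univ
    exact ⟨v, hv⟩
  have : Countable (countableBasis X) := countable_countableBasis X
  obtain ⟨d, hd⟩ := exists_surjective_nat (countableBasis X)
  have hUo : ∀ j, IsOpen (d j).1 := fun j => isOpen_of_mem_countableBasis (d j).2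
  let P : ℕ → Set X := fun j => ⋃ i, T i ⁻¹' (d j).1
  let I : ℕ → Set X := fun j => ⋂ M : ℕ, ⋃ i : ℕ, (T i ⁻¹' (d j).1 ∩
    ⋂ i' : Fin M, {x | T i x ≠ T i'.1 x})
  have hPo : ∀ j, IsOpen (P j) := fun j => isOpen_iUnion fun i => (hUo j).preimage (hT i)
  have hIG : ∀ j, IsGδ (I j) := fun j => IsGδ.iInter_of_isOpen fun M => isOpen_iUnion fun i =>
    ((hUo j).preimage (hT i)).inter (isOpen_iInter_of_finite fun i' =>
      isOpen_ne_fun (hT i) (hT i'.1))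
  have hP : ∀ j x, x ∈ P j ↔ {y | y ∈ (d j).1 ∧ E x y}.Nonempty := by
    intro j x
    simp only [P, mem_iUnion, mem_preimage]
    constructor
    · rintro ⟨i, hi⟩
      exact ⟨_, hi, (hTE _ _).2 ⟨i, rfl⟩⟩
    · rintro ⟨y, hy, hxy⟩
      obtain ⟨i, rfl⟩ := (hTE _ _).1 hxy
      exact ⟨i, hy⟩
  have hI : ∀ j x, x ∈ I j ↔ {y | y ∈ (d j).1 ∧ E x y}.Infinite := by
    intro j x
    simp only [I, mem_iInter, mem_iUnion, mem_inter_iff, mem_preimage, mem_ofPred_eq]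
    constructor
    · intro h hfin
      have h1 : ∃ M, ∀ y ∈ {y | y ∈ (d j).1 ∧ E x y}, ∃ i' < M, y = T i' x := by
        have h2 : ∀ y, ∃ i', y ∈ {y | y ∈ (d j).1 ∧ E x y} → y = T i' x := by
          intro y
          by_cases hy : E x y
          · obtain ⟨i, hi⟩ := (hTE _ _).1 hy
            exact ⟨i, fun _ => hi.symm⟩
          · exact ⟨0, fun h => absurd h.2 hy⟩
        choose f hf using h2
        refine ⟨hfin.toFinset.sup f + 1, fun y hy => ⟨f y, ?_, hf y hy⟩⟩
        exact Nat.lt_succ_of_le (Finset.le_sup (f := f) (hfin.mem_toFinset.2 hy))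
      obtain ⟨M, hM⟩ := h1
      obtain ⟨i, hi, hi'⟩ := h M
      obtain ⟨i', hlt, he⟩ := hM (T i x) ⟨hi, (hTE _ _).2 ⟨i, rfl⟩⟩
      exact hi' ⟨i', hlt⟩ he
    · intro h M
      have h2 : ((fun i => T i x) '' (Set.Iio M)).Finite := (Set.finite_Iio M).image _
      obtain ⟨y, ⟨hy, hxy⟩, hyM⟩ := (h.sdiff h2).nonempty
      obtain ⟨i, rfl⟩ := (hTE _ _).1 hxy
      exact ⟨i, hy, fun i' he => hyM ⟨i'.1, i'.2, he.symm⟩⟩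
  let W : Set X := ⋂ j, ((P j)ᶜ ∪ I j)
  have hinv : ∀ x y, E x y → ∀ j, {z | z ∈ (d j).1 ∧ E x z} = {z | z ∈ (d j).1 ∧ E y z} := by
    intro x y h j
    ext z
    simp only [mem_ofPred_eq, hcl x y h]
  have hW : W = ∅ := by
    refine weak_W_empty E hE T hT hTT hTE n k hn hk hw W ?_ ?_ ?_
    · let _ := TopologicalSpace.upgradeIsCompletelyMetrizable X
      exact IsGδ.iInter fun j => ((hPo j).isClosed_compl.isGδ).union (hIG j)
    · intro x y hxy hx
      simp only [W, mem_iInter, mem_union, mem_compl_iff, hP, hI] at hx ⊢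
      intro j
      rw [← hinv x y hxy j]
      exact hx j
    · intro x U hx hU hxU
      obtain ⟨v, hv, hxv, hvU⟩ := (isBasis_countableBasis X).exists_subset_of_mem_open hxU hU
      obtain ⟨j, hj⟩ := hd ⟨v, hv⟩
      simp only [W, mem_iInter, mem_union, mem_compl_iff, hP, hI] at hx
      rcases hx j with h | h
      · exact absurd ⟨x, by rw [hj]; exact hxv, hE.refl x⟩ h
      · rw [hj] at h
        exact h.mono fun y hy => ⟨hvU hy.1, hy.2⟩
  obtain ⟨φ, hφ⟩ := exists_measurableEmbedding_real X
  let h : ℕ → X → EReal := fun j z => if z ∈ (d j).1 then (φ z : EReal) else ⊤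
  have hh : ∀ j, Measurable (h j) := fun j => Measurable.ite (hUo j).measurableSet
    (measurable_coe_real_ereal.comp hφ.measurable) measurable_const
  let F : X → ℕ → EReal := fun x j => if x ∈ P j \ I j then ⨅ i, h j (T i x) else ⊤
  have hFe : ∀ j x, (⨅ i, h j (T i x)) = sInf (h j '' {z | E x z}) := by
    intro j x
    rw [← sInf_range]
    congr 1
    ext r
    simp only [mem_range, mem_image, mem_ofPred_eq, hTE]
    constructor
    · rintro ⟨i, rfl⟩; exact ⟨_, ⟨i, rfl⟩, rfl⟩
    · rintro ⟨_, ⟨i, rfl⟩, rfl⟩; exact ⟨i, rfl⟩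
  have hFatt : ∀ j x, x ∈ P j \ I j → ∃ z, E x z ∧ F x j = (φ z : EReal) := by
    intro j x hx
    have e1 : F x j = sInf (h j '' {z | E x z}) := by rw [← hFe]; exact if_pos hx
    have hfin : {y | y ∈ (d j).1 ∧ E x y}.Finite := by
      by_contra hinf
      exact hx.2 ((hI j x).2 hinf)
    have hfin2 : (h j '' {z | E x z}).Finite := by
      refine ((hfin.image (h j)).union (finite_singleton ⊤)).subset ?_
      rintro _ ⟨z, hz, rfl⟩
      by_cases hzU : z ∈ (d j).1
      · exact Or.inl ⟨z, ⟨hzU, hz⟩, rfl⟩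
      · exact Or.inr (if_neg hzU)
    have hmem := Set.Nonempty.csInf_mem (s := h j '' {z | E x z})
      ⟨_, x, hE.refl x, rfl⟩ hfin2
    obtain ⟨z, hz, hze⟩ := hmem
    obtain ⟨z0, hz0, hz0E⟩ := (hP j x).1 hx.1
    have hle : sInf (h j '' {z | E x z}) ≤ h j z0 := sInf_le ⟨z0, hz0E, rfl⟩
    have hz0' : h j z0 = (φ z0 : EReal) := if_pos hz0
    have hzU : z ∈ (d j).1 := by
      by_contra hzU
      have : h j z = ⊤ := if_neg hzU
      rw [← hze, this, hz0'] at hle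
      exact EReal.coe_ne_top _ (top_le_iff.1 hle)
    exact ⟨z, hz, by rw [e1, ← hze]; exact if_pos hzU⟩
  refine ⟨ℕ → EReal, inferInstance, inferInstance, F, ?_, fun x y => ⟨fun hxy => ?_, fun hxy => ?_⟩⟩
  · refine measurable_pi_lambda _ fun j => ?_
    have hIm : MeasurableSet (I j) := (hIG j).measurableSet
    exact Measurable.ite ((hPo j).measurableSet.diff hIm)
      (Measurable.iInf fun i => (hh j).comp (hTm i)) measurable_const
  · funext j
    have e1 : x ∈ P j \ I j ↔ y ∈ P j \ I j := by
      simp only [mem_sdiff, hP, hI, hinv x y hxy j]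
    have e2 : (⨅ i, h j (T i x)) = ⨅ i, h j (T i y) := by
      rw [hFe, hFe]
      congr 2
      ext z
      exact hcl x y hxy z
    simp only [F, e1, e2]
  · have hxW : x ∉ W := by rw [hW]; exact notMem_empty x
    simp only [W, mem_iInter, mem_union, mem_compl_iff, not_forall, not_or, not_not] at hxW
    obtain ⟨j, hj⟩ := hxW
    obtain ⟨z, hz, hze⟩ := hFatt j x hj
    have hy : y ∈ P j \ I j := by
      by_contra hy
      have : F y j = ⊤ := if_neg hy
      rw [← hxy, hze] at this
      exact EReal.coe_ne_top _ this
    obtain ⟨z', hz', hze'⟩ := hFatt j y hy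
    rw [← hxy, hze, EReal.coe_eq_coe_iff] at hze'
    have := hφ.injective hze'
    subst this
    exact hE.trans hz (hE.symm hz')

end BR

namespace BR
open MeasureTheory Set

theorem meas_select {Ω ι β : Type*} [MeasurableSpace Ω] [MeasurableSpace β] [Countable ι]
    (D : Ω → ι) (hD : ∀ s, MeasurableSet {ω | D ω = s}) (f : ι → Ω → β)
    (hf : ∀ s, Measurable (f s)) : Measurable fun ω => f (D ω) ω := by
  intro B hB
  have : (fun ω => f (D ω) ω) ⁻¹' B = ⋃ s, ({ω | D ω = s} ∩ f s ⁻¹' B) := by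
    ext ω
    simp only [mem_preimage, mem_iUnion, mem_inter_iff, mem_ofPred_eq, exists_eq_left']
  rw [this]
  exact MeasurableSet.iUnion fun s => (hD s).inter (hf s hB)

theorem meas_image {Ω : Type*} [MeasurableSpace Ω] (b : ℕ → Ω → ℕ) (hb : ∀ j, Measurable (b j))
    (t s : Finset ℕ) : MeasurableSet {ω | t.image (fun j => b j ω) = s} := by
  have h1 : Measurable fun ω => fun j : t => b j.1 ω := measurable_pi_lambda _ fun j => hb j.1
  have h2 : {ω | t.image (fun j => b j ω) = s} =
      (fun ω => fun j : t => b j.1 ω) ⁻¹' {v : t → ℕ | Finset.univ.image v = s} := by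
    ext ω
    simp only [mem_ofPred_eq, mem_preimage]
    have : t.image (fun j => b j ω) = Finset.univ.image (fun j : t => b j.1 ω) := by
      ext; simp
    rw [this]
  rw [h2]
  exact h1 (Set.to_countable _).measurableSet

theorem sel' {Ω ι : Type*} [MeasurableSpace Ω] [Countable ι] [Nonempty ι] [MeasurableSpace ι]
    (R : ι → Set Ω) (hR : ∀ i, MeasurableSet (R i))
    (h : ∀ ω, ∃ i, ω ∈ R i) : ∃ u : Ω → ι, Measurable u ∧ ∀ ω, ω ∈ R (u ω) := by
  obtain ⟨d, hd⟩ := exists_surjective_nat ι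
  obtain ⟨u, hu, huR⟩ := sel (fun n => R (d n)) (fun n => hR _) (fun ω => by
    obtain ⟨i, hi⟩ := h ω
    obtain ⟨n, rfl⟩ := hd i
    exact ⟨n, hi⟩)
  exact ⟨fun ω => d (u ω), (measurable_of_countable d).comp hu, huR⟩

theorem seq {Ω : Type*} [MeasurableSpace Ω] (R : ℕ → ℕ → Set Ω)
    (hR : ∀ m z, MeasurableSet (R m z)) (h : ∀ m ω, ∃ z, m ≤ z ∧ ω ∈ R m z) :
    ∃ b N : ℕ → Ω → ℕ, (∀ j, Measurable (b j)) ∧ (∀ j ω, N j ω ≤ b j ω ∧ ω ∈ R (N j ω) (b j ω)) ∧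
      ∀ j ω, N (j+1) ω = b j ω + 1 := by
  let St := {N : Ω → ℕ // Measurable N}
  have hstep : ∀ N : St, ∃ b : St, ∀ ω, N.1 ω ≤ b.1 ω ∧ ω ∈ R (N.1 ω) (b.1 ω) := by
    intro N
    obtain ⟨b, hb, hbR⟩ := sel (fun z => ⋃ m : {m // m ≤ z}, (N.1 ⁻¹' {m.1} ∩ R m.1 z))
      (fun z => MeasurableSet.iUnion fun m => (N.2 (measurableSet_singleton _)).inter (hR _ _))
      (fun ω => by
        obtain ⟨z, hz, hzR⟩ := h (N.1 ω) ω
        exact ⟨z, mem_iUnion.2 ⟨⟨N.1 ω, hz⟩, rfl, hzR⟩⟩)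
    refine ⟨⟨b, hb⟩, fun ω => ?_⟩
    obtain ⟨⟨m, hm⟩, hmN, hmR⟩ := mem_iUnion.1 (hbR ω)
    have : N.1 ω = m := hmN
    rw [this]
    exact ⟨hm, hmR⟩
  choose F hF using hstep
  let q : ℕ → St := fun n => Nat.rec ⟨fun _ => 0, measurable_const⟩
    (fun _ N => ⟨fun ω => (F N).1 ω + 1, (F N).2.add_const 1⟩) n
  exact ⟨fun j => (F (q j)).1, fun j => (q j).1, fun j => (F (q j)).2, fun j ω => hF (q j) ω,
    fun j ω => rfl⟩

theorem meas_infinite {Ω : Type*} [MeasurableSpace Ω] (B : ℕ → Set Ω)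
    (hB : ∀ z, MeasurableSet (B z)) : MeasurableSet {ω | {z | ω ∈ B z}.Infinite} := by
  have : {ω | {z | ω ∈ B z}.Infinite} = ⋂ M : ℕ, ⋃ z : {z // M < z}, B z.1 := by
    ext ω
    simp only [mem_ofPred_eq, mem_iInter, mem_iUnion]
    constructor
    · intro h M
      obtain ⟨z, hz, hM⟩ := h.exists_gt M
      exact ⟨⟨z, hM⟩, hz⟩
    · intro h
      refine Set.infinite_of_forall_exists_gt fun M => ?_
      obtain ⟨z, hz⟩ := h M
      exact ⟨z.1, hz, z.2⟩
  rw [this]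
  exact MeasurableSet.iInter fun M => MeasurableSet.iUnion fun z => hB _

theorem lemA {Ω : Type*} [MeasurableSpace Ω] {k : ℕ} [Nonempty (Fin k)]
    (q : ℕ → ℕ → Ω → Fin k) (hq : ∀ z i, Measurable (q z i)) :
    ∃ u : ℕ → Ω → Fin k, (∀ i, Measurable (u i)) ∧
      ∀ ω m, {z | ∀ i < m, q z i ω = u i ω}.Infinite := by
  let St := {B : ℕ → Set Ω // (∀ z, MeasurableSet (B z)) ∧ ∀ ω, {z | ω ∈ B z}.Infinite}
  have hstep : ∀ (i : ℕ) (B : St), ∃ v : Ω → Fin k, ∃ B' : St, Measurable v ∧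
      ∀ z ω, ω ∈ B'.1 z → ω ∈ B.1 z ∧ q z i ω = v ω := by
    intro i B
    have hm : ∀ a z, MeasurableSet (B.1 z ∩ q z i ⁻¹' {a}) := fun a z =>
      (B.2.1 z).inter (hq z i (measurableSet_singleton a))
    obtain ⟨v, hv, hvR⟩ := sel' (fun a : Fin k => {ω | {z | ω ∈ B.1 z ∩ q z i ⁻¹' {a}}.Infinite})
      (fun a => meas_infinite _ (hm a)) (fun ω => by
        by_contra hcon
        push Not at hcon
        refine B.2.2 ω ((Set.finite_iUnion (f := fun a : Fin k =>
          {z | ω ∈ B.1 z ∩ q z i ⁻¹' {a}}) fun a => ?_).subset ?_)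
        · exact Set.not_infinite.1 (hcon a)
        · intro z hz
          exact mem_iUnion.2 ⟨q z i ω, hz, rfl⟩)
    refine ⟨v, ⟨fun z => B.1 z ∩ {ω | q z i ω = v ω}, fun z => (B.2.1 z).inter
      (measurableSet_eq_fun (hq z i) hv), fun ω => hvR ω⟩, hv, fun z ω h => h⟩
  choose v F hv hF using hstep
  let s : ℕ → St := fun n => Nat.rec ⟨fun _ => univ, fun _ => MeasurableSet.univ,
    fun ω => by simpa using Set.infinite_univ⟩ (fun i B => F i B) n
  have hs : ∀ n, s (n+1) = F n (s n) := fun n => rfl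
  refine ⟨fun i => v i (s i), fun i => hv _ _, fun ω m => ((s m).2.2 ω).mono ?_⟩
  intro z hz
  induction m with
  | zero => intro i hi; omega
  | succ m ih =>
    have hz' : ω ∈ (F m (s m)).1 z := by rw [← hs]; exact hz
    have := hF m (s m) z ω hz'
    intro i hi
    rcases Nat.lt_succ_iff_lt_or_eq.1 hi with h | rfl
    · exact ih this.1 i h
    · exact this.2

theorem ramsey {Ω : Type*} [MeasurableSpace Ω] {k : ℕ} [Nonempty (Fin k)] (n : ℕ) :
    ∀ χ : Finset ℕ → Ω → Fin k, (∀ s, Measurable (χ s)) →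
    ∃ H : ℕ → Ω → ℕ, (∀ m, Measurable (H m)) ∧ ∀ ω, StrictMono (fun m => H m ω) ∧
      ∃ a, ∀ t : Finset ℕ, t.card = n → χ (t.image fun m => H m ω) ω = a := by
  induction n with
  | zero =>
    intro χ hχ
    refine ⟨fun m _ => m, fun m => measurable_const, fun ω => ⟨fun a b h => h, χ ∅ ω, ?_⟩⟩
    intro t ht
    rw [Finset.card_eq_zero.1 ht]
    simp
  | succ n ih =>
    intro χ hχ
    obtain ⟨d, hd⟩ := exists_surjective_nat (Finset ℕ)
    obtain ⟨u', hu', huinf'⟩ := lemA (fun z i => χ (insert z (d i))) (fun z i => hχ _)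
    choose r hr using hd
    let u : Finset ℕ → Ω → Fin k := fun s => u' (r s)
    obtain ⟨b, N, hbm, hbR, hN⟩ := seq (fun m z => ⋂ s ∈ (Finset.range m).powerset,
      {ω | χ (insert z s) ω = u s ω})
      (fun m z => Finset.measurableSet_biInter _ fun s _ => measurableSet_eq_fun (hχ _) (hu' _))
      (fun m ω => by
        obtain ⟨z, hz, hzm⟩ := (huinf' ω ((Finset.range m).powerset.sup r + 1)).exists_gt m
        refine ⟨z, hzm.le, mem_iInter₂.2 fun s hs => ?_⟩
        have := hz (r s) (Nat.lt_succ_of_le (Finset.le_sup (f := r) hs))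
        rw [hr] at this
        exact this)
    have hbN : ∀ ω i j, i < j → b i ω < N j ω := by
      intro ω i j hij
      induction j with
      | zero => omega
      | succ j ihj =>
        rw [hN]
        rcases Nat.lt_succ_iff_lt_or_eq.1 hij with h | rfl
        · have := ihj h
          have := (hbR j ω).1
          omega
        · omega
    have hbmono : ∀ ω, StrictMono fun j => b j ω := fun ω i j hij =>
      (hbN ω i j hij).trans_le (hbR j ω).1
    obtain ⟨H, hHm, hH⟩ := ih (fun t ω => u (t.image fun j => b j ω) ω)
      (fun t => meas_select _ (meas_image b hbm t) u (fun s => hu' _))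
    refine ⟨fun m ω => b (H m ω) ω, fun m => meas_select (H m)
      (fun s => hHm m (measurableSet_singleton s)) b hbm, fun ω => ?_⟩
    obtain ⟨hHs, a, ha⟩ := hH ω
    refine ⟨(hbmono ω).comp hHs, a, fun t ht => ?_⟩
    have htne : t.Nonempty := Finset.card_pos.1 (by omega)
    set j := t.max' htne with hj
    have hjt : j ∈ t := t.max'_mem htne
    set t' := t.erase j with ht'
    have hlt : ∀ i ∈ t', i < j := fun i hi =>
      lt_of_le_of_ne (t.le_max' i (Finset.mem_of_mem_erase hi)) (Finset.ne_of_mem_erase hi)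
    have htt : t = insert j t' := (Finset.insert_erase hjt).symm
    have hcard : t'.card = n := by rw [ht', Finset.card_erase_of_mem hjt, ht]; rfl
    rw [htt, Finset.image_insert, ← ha t' hcard]
    have := mem_iInter₂.1 (hbR (H j ω) ω).2 (t'.image fun m => b (H m ω) ω) (by
      rw [Finset.mem_powerset]
      intro y hy
      obtain ⟨i, hi, rfl⟩ := Finset.mem_image.1 hy
      exact Finset.mem_range.2 (hbN ω _ _ (hHs (hlt i hi))))
    have h2 : χ (insert (b (H j ω) ω) (t'.image fun m => b (H m ω) ω)) ω =
      u (t'.image fun m => b (H m ω) ω) ω := this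
    rw [h2, Finset.image_image]
    rfl

theorem smooth_strong {X : Type*} [MeasurableSpace X] [StandardBorelSpace X]
    (E : X → X → Prop)
    (hcount : ∀ x : X, {y | E x y}.Countable)
    (haper : ∀ x : X, {y | E x y}.Infinite) (hs : IsSmooth E)
    (n k : ℕ) (hk : 1 < k) : StrongBorelRamsey E n k := by
  obtain ⟨Z, mZ, hZ, f, hf, hfE⟩ := hs
  intro c hc
  have hne : Nonempty (Fin k) := ⟨⟨0, by omega⟩⟩
  obtain ⟨e, hem, hef, hes⟩ := unif hf (fun z => by
    by_cases hz : ∃ x, f x = z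
    · obtain ⟨x, rfl⟩ := hz
      refine (hcount x).mono fun y hy => (hfE x y).2 ?_
      exact (show f y = f x from hy).symm
    · have : f ⁻¹' {z} = ∅ := by
        ext y
        simp only [mem_preimage, mem_singleton_iff, mem_empty_iff_false, iff_false]
        exact fun h => hz ⟨y, h⟩
      rw [this]; exact countable_empty)
  obtain ⟨b, N, hbm, hbR, hN⟩ := seq (Ω := range f) (fun m i => ⋂ i' : Fin m,
    {z | e i z = e i'.1 z}ᶜ) (fun m i => MeasurableSet.iInter fun i' =>
      (measurableSet_eq_fun (hem _) (hem _)).compl) (fun m z => by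
        obtain ⟨z, x, rfl⟩ := z
        obtain ⟨y, hy, hyM⟩ := ((haper x).sdiff
          ((Set.finite_Iio m).image (fun i => e i ⟨f x, x, rfl⟩))).nonempty
        have hxy : f x = f y := (hfE x y).1 hy
        obtain ⟨i, hi⟩ := hes y
        have hi' : e i ⟨f x, x, rfl⟩ = y := by
          rw [← hi]; congr 1; exact Subtype.ext hxy
        have key : ∀ i' < m, e i' ⟨f x, x, rfl⟩ ≠ y := fun i' h' he => hyM ⟨i', h', he⟩
        refine ⟨i, ?_, mem_iInter.2 fun i' he => ?_⟩
        · by_contra hlt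
          exact key i (by omega) hi'
        · have he' : e i ⟨f x, x, rfl⟩ = e i'.1 ⟨f x, x, rfl⟩ := he
          exact key i'.1 i'.2 (by rw [← he', hi']))
  have hbN : ∀ ω i j, i < j → b i ω < N j ω := by
    intro ω i j hij
    induction j with
    | zero => omega
    | succ j ihj =>
      rw [hN]
      rcases Nat.lt_succ_iff_lt_or_eq.1 hij with h | rfl
      · have := ihj h
        have := (hbR j ω).1
        omega
      · omega
  let d : ℕ → range f → X := fun m z => e (b m z) z
  have hdm : ∀ m, Measurable (d m) := fun m => meas_select (b m)
    (fun s => hbm m (measurableSet_singleton s)) e hem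
  have hdf : ∀ m z, f (d m z) = z := fun m z => hef _ _
  have hdlt : ∀ z i j, i < j → d j z ≠ d i z := by
    intro z i j hij
    have := mem_iInter.1 (hbR j z).2 ⟨b i z, hbN z i j hij⟩
    exact this
  have hdinj : ∀ z, Function.Injective fun m => d m z := by
    intro z i j hij
    by_contra hne
    rcases lt_or_gt_of_ne hne with h | h
    · exact hdlt z i j h hij.symm
    · exact hdlt z j i h hij
  obtain ⟨H, hHm, hH⟩ := ramsey n (fun (s : Finset ℕ) (z : range f) =>
    if s.card = n then c (s.image fun m => d m z) else Classical.arbitrary (Fin k)) (fun s => by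
      by_cases h : s.card = n
      · simp only [h, if_true]
        have h1 : ∀ z : range f, s.image (fun m => d m z) =
            (Set.finite_range (fun i : Fin n => d (s.orderEmbOfFin h i) z)).toFinset := by
          intro z
          rw [range_toFinset]
          ext y
          simp only [Finset.mem_image, Finset.mem_univ, true_and]
          constructor
          · rintro ⟨m, hm, rfl⟩
            have : m ∈ range (s.orderEmbOfFin h) := by
              rw [Finset.range_orderEmbOfFin]; exact hm
            obtain ⟨i, rfl⟩ := this
            exact ⟨i, rfl⟩
          · rintro ⟨i, rfl⟩
            exact ⟨_, Finset.orderEmbOfFin_mem s h i, rfl⟩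
        simp only [h1]
        exact hc.comp (measurable_pi_lambda (fun (z : range f) (i : Fin n) =>
          d (s.orderEmbOfFin h i) z) fun i => hdm _)
      · simp only [h, if_false]
        exact measurable_const)
  let F : X → range f := fun x => ⟨f x, x, rfl⟩
  have hFm : Measurable F := hf.subtype_mk
  have hFE : ∀ x y, E x y → F x = F y := fun x y h => Subtype.ext ((hfE x y).1 h)
  let g : ℕ → range f → X := fun m z => d (H m z) z
  have hgm : ∀ m, Measurable (g m) := fun m => meas_select (H m)
    (fun s => hHm m (measurableSet_singleton s)) d hdm
  have hginj : ∀ z, Function.Injective fun m => g m z := fun z =>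
    (hdinj z).comp (hH z).1.injective
  have hgF : ∀ m x, F (g m (F x)) = F x := fun m x => Subtype.ext (hdf _ _)
  refine ⟨⋃ m, {x | g m (F x) = x}, MeasurableSet.iUnion fun m =>
    measurableSet_eq_fun ((hgm m).comp hFm) measurable_id, fun x => ?_, fun x => ?_⟩
  · refine (Set.infinite_range_of_injective (hginj (F x))).mono ?_
    rintro _ ⟨m, rfl⟩
    refine ⟨mem_iUnion.2 ⟨m, ?_⟩, (hfE _ _).2 (hdf _ (F x)).symm⟩
    change g m (F (g m (F x))) = g m (F x)
    rw [hgF]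
  · obtain ⟨a, ha⟩ := (hH (F x)).2
    refine ⟨a, fun A hA hAY hAE => ?_⟩
    have hsub : (A : Set X) ⊆ range fun m => g m (F x) := by
      intro y hy
      obtain ⟨m, hm⟩ := mem_iUnion.1 (hAY hy)
      refine ⟨m, ?_⟩
      change g m (F x) = y
      rw [hFE x y (hAE y hy)]
      exact hm
    let t := A.preimage (fun m => g m (F x)) (hginj (F x)).injOn
    have hAt : t.image (fun m => g m (F x)) = A := by
      ext y
      simp only [t, Finset.mem_image, Finset.mem_preimage]
      constructor
      · rintro ⟨m, hm, rfl⟩; exact hm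
      · intro hy
        obtain ⟨m, hm⟩ := hsub hy
        exact ⟨m, by rw [show g m (F x) = y from hm]; exact hy, hm⟩
    have ht : t.card = n := by
      rw [← hA, ← hAt, Finset.card_image_of_injective _ (hginj (F x))]
    have h1 := ha t ht
    have h2 : (t.image fun m => H m (F x)).card = n := by
      rw [Finset.card_image_of_injective _ (hH (F x)).1.injective, ht]
    rw [if_pos h2, Finset.image_image] at h1
    rw [← hAt]
    exact h1

end BR

/-- The main theorem: for an aperiodic countable Borel equivalence relation `E`,
the following are equivalent: (i) `E →_B (E)^n_k` for some `n, k > 1`;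
(ii) `E →_B (E)^n_k` for all `n, k > 1`; (iii) `E →*_B (E)^n_k` for some `n, k > 1`;
(iv) `E →*_B (E)^n_k` for all `n, k > 1`; (v) `E` is smooth. -/
theorem borel_ramsey_main_theorem {X : Type*} [MeasurableSpace X] [StandardBorelSpace X]
    (E : X → X → Prop) (hE : Equivalence E)
    (hEBorel : MeasurableSet {p : X × X | E p.1 p.2})
    (hcount : ∀ x : X, {y | E x y}.Countable)
    (haper : ∀ x : X, {y | E x y}.Infinite) :
    List.TFAE
      [ ∃ n k : ℕ, 1 < n ∧ 1 < k ∧ StrongBorelRamsey E n k,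
        ∀ n k : ℕ, 1 < n → 1 < k → StrongBorelRamsey E n k,
        ∃ n k : ℕ, 1 < n ∧ 1 < k ∧ WeakBorelRamsey E n k,
        ∀ n k : ℕ, 1 < n → 1 < k → WeakBorelRamsey E n k,
        IsSmooth E ] := by
  have hsw : ∀ n k, StrongBorelRamsey E n k → WeakBorelRamsey E n k := by
    intro n k h c hc
    obtain ⟨Y, hY, hYi, hYm⟩ := h c hc
    refine ⟨Y, hY, fun x => ?_, hYm⟩
    obtain ⟨y, hy⟩ := (hYi x).nonempty
    exact ⟨y, hy.1, hy.2⟩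
  tfae_have 2 → 1 := fun h => ⟨2, 2, by norm_num, by norm_num, h 2 2 (by norm_num) (by norm_num)⟩
  tfae_have 1 → 3 := fun ⟨n, k, hn, hk, h⟩ => ⟨n, k, hn, hk, hsw n k h⟩
  tfae_have 2 → 4 := fun h n k hn hk => hsw n k (h n k hn hk)
  tfae_have 4 → 3 := fun h => ⟨2, 2, by norm_num, by norm_num, h 2 2 (by norm_num) (by norm_num)⟩
  tfae_have 3 → 5 := fun ⟨n, k, hn, hk, h⟩ =>
    BR.weak_smooth E hE hEBorel hcount n k hn hk h
  tfae_have 5 → 2 := fun h n k _ hk => BR.smooth_strong E hcount haper h n k hk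
  tfae_finish
end
end
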